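/- Let r > 0 and let B_r be the open ball of ℝ^d of center 0 and radius r. There exists a nonnegative u ∈ C(B_r) that is a distributional solution of Δ_k u = φ(u) in B_r and satisfies lim_{x→z} u(x) = ∞ for every z ∈ ∂B_r, if and only if there exists a constant a > 0 such that ∫_a^∞ dt/√(∫_0^t φ(s) ds) < ∞ (with the convention that the integrand equals +∞ where ∫_0^t φ(s) ds = 0). -/

import Mathlib

open MeasureTheory Real Filter
open scoped RealInnerProductSpace ENNReal Topology

noncomputable section

abbrev E (d : ℕ) := EuclideanSpace ℝ (Fin d)

/-- The reflection σ_α in the hyperplane orthogonal to α. -/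
def dunklReflect {d : ℕ} (α x : E d) : E d := x - ((2 * ⟪α, x⟫) / ‖α‖ ^ 2) • α

/-- The Euclidean Laplacian, as the trace of the second derivative. -/
def lap {d : ℕ} (u : E d → ℝ) (x : E d) : ℝ :=
  ∑ i : Fin d, iteratedFDeriv ℝ 2 u x ![EuclideanSpace.single i 1, EuclideanSpace.single i 1]

/-- The Dunkl Laplacian Δ_k associated with the root system `R` and multiplicity `k`. -/
def dunklLap {d : ℕ} (R : Finset (E d)) (k : E d → ℝ) (u : E d → ℝ) (x : E d) : ℝ :=
  lap u x + ∑ α ∈ R, k α * (⟪gradient u x, α⟫ / ⟪α, x⟫ -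
    (‖α‖ ^ 2 / 2) * ((u x - u (dunklReflect α x)) / ⟪α, x⟫ ^ 2))

/-- The weight function w_k. -/
def wk {d : ℕ} (R : Finset (E d)) (k : E d → ℝ) (x : E d) : ℝ :=
  ∏ α ∈ R, |⟪x, α⟫| ^ (k α)

/-- `u` is a distributional solution of Δ_k u = φ(u) on `D`. -/
def IsDunklSol {d : ℕ} (R : Finset (E d)) (k : E d → ℝ) (φ : ℝ → ℝ) (D : Set (E d))
    (u : E d → ℝ) : Prop :=
  ∀ ψ : E d → ℝ, ContDiff ℝ (⊤ : ℕ∞) ψ → HasCompactSupport ψ → tsupport ψ ⊆ D →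
    ∫ x in D, u x * dunklLap R k ψ x * wk R k x = ∫ x in D, φ (u x) * ψ x * wk R k x

section Reflection

variable {d : ℕ}

lemma dunklReflect_eq_reflection (α x : E d) :
    dunklReflect α x = (Submodule.span ℝ {α})ᗮ.reflection x := by
  rw [Submodule.reflection_orthogonal]
  simp only [LinearIsometryEquiv.trans_apply, LinearIsometryEquiv.coe_neg,
    Submodule.reflection_singleton_apply, dunklReflect]
  rw [neg_sub, two_smul, ← add_smul]
  congr 2
  simp only [RCLike.ofReal_real_eq_id, id_eq]
  ring

lemma continuous_dunklReflect (α : E d) : Continuous (dunklReflect α) := by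
  have : dunklReflect α = (Submodule.span ℝ {α})ᗮ.reflection := by
    ext1 x; exact dunklReflect_eq_reflection α x
  rw [this]; exact LinearIsometryEquiv.continuous _

lemma norm_dunklReflect (α x : E d) : ‖dunklReflect α x‖ = ‖x‖ := by
  rw [dunklReflect_eq_reflection, LinearIsometryEquiv.norm_map]

lemma dunklReflect_dunklReflect (α x : E d) : dunklReflect α (dunklReflect α x) = x := by
  simp [dunklReflect_eq_reflection]

lemma inner_dunklReflect_dunklReflect (α x y : E d) :
    ⟪dunklReflect α x, dunklReflect α y⟫ = ⟪x, y⟫ := by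
  simp [dunklReflect_eq_reflection]

lemma inner_dunklReflect_left (α x y : E d) :
    ⟪dunklReflect α x, y⟫ = ⟪x, dunklReflect α y⟫ := by
  rw [← inner_dunklReflect_dunklReflect α x, dunklReflect_dunklReflect]

lemma dunklReflect_self {α : E d} (hα : α ≠ 0) : dunklReflect α α = -α := by
  have : ‖α‖ ≠ 0 := by simpa using hα
  rw [dunklReflect, real_inner_self_eq_norm_sq, mul_div_assoc, div_self (by positivity), mul_one,
    two_smul]
  abel

lemma inner_dunklReflect_self {α : E d} (hα : α ≠ 0) (x : E d) :
    ⟪α, dunklReflect α x⟫ = -⟪α, x⟫ := by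
  rw [← inner_dunklReflect_left, dunklReflect_self hα, inner_neg_left]

/-- A function that is odd under a reflection has vanishing integral. -/
lemma integral_eq_zero_of_dunklReflect_odd (α : E d) (f : E d → ℝ)
    (hf : ∀ x, f (dunklReflect α x) = -f x) : ∫ x, f x = 0 := by
  have h := ((Submodule.span ℝ {α})ᗮ.reflection.measurePreserving).integral_comp
    (Submodule.span ℝ {α})ᗮ.reflection.toHomeomorph.measurableEmbedding f
  simp only [← dunklReflect_eq_reflection, hf, integral_neg] at h
  linarith

end Reflection

section Weight

variable {d : ℕ} {R : Finset (E d)} {k : E d → ℝ}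

/-- A smooth positive regularization of the weight `wk`. -/
def regWeight (R : Finset (E d)) (k : E d → ℝ) (ε : ℝ) (x : E d) : ℝ :=
  Real.exp (∑ α ∈ R, k α / 2 * Real.log (⟪x, α⟫ ^ 2 + ε))

lemma regWeight_eq_prod {ε : ℝ} (hε : 0 < ε) (x : E d) :
    regWeight R k ε x = ∏ α ∈ R, (⟪x, α⟫ ^ 2 + ε) ^ (k α / 2) := by
  rw [regWeight, Real.exp_sum]
  refine Finset.prod_congr rfl fun α _ => ?_
  rw [Real.rpow_def_of_pos (by positivity), mul_comm]

lemma regWeight_pos (ε : ℝ) (x : E d) : 0 < regWeight R k ε x := Real.exp_pos _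

lemma regWeight_mono (hk : ∀ α ∈ R, 0 < k α) {ε η : ℝ} (hε : 0 < ε) (h : ε ≤ η) (x : E d) :
    regWeight R k ε x ≤ regWeight R k η x := by
  rw [regWeight, regWeight]
  gcongr with α hα
  exact (half_pos (hk α hα)).le

lemma tendsto_regWeight (hk : ∀ α ∈ R, 0 < k α) (x : E d) :
    Tendsto (fun ε => regWeight R k ε x) (𝓝[>] 0) (𝓝 (wk R k x)) := by
  have h1 : Tendsto (fun ε : ℝ => ∏ α ∈ R, (⟪x, α⟫ ^ 2 + ε) ^ (k α / 2)) (𝓝[>] 0)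
      (𝓝 (wk R k x)) := by
    refine tendsto_finsetProd _ fun α hα => ?_
    have h2 : |⟪x, α⟫| ^ k α = (⟪x, α⟫ ^ 2 + 0) ^ (k α / 2) := by
      rw [add_zero, ← sq_abs, ← Real.rpow_natCast, ← Real.rpow_mul (abs_nonneg _)]
      congr 1; push_cast; ring
    rw [h2]
    have h3 : Tendsto (fun ε : ℝ => ⟪x, α⟫ ^ 2 + ε) (𝓝[>] 0) (𝓝 (⟪x, α⟫ ^ 2 + 0)) :=
      tendsto_const_nhds.add (tendsto_id.mono_left nhdsWithin_le_nhds)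
    exact h3.rpow_const (Or.inr (half_pos (hk α hα)).le)
  refine h1.congr' ?_
  filter_upwards [self_mem_nhdsWithin] with ε hε
  exact (regWeight_eq_prod hε x).symm

lemma hasFDerivAt_regWeight {ε : ℝ} (hε : 0 < ε) (x : E d) :
    HasFDerivAt (regWeight R k ε)
      (regWeight R k ε x • ∑ α ∈ R, (k α * (⟪x, α⟫ / (⟪x, α⟫ ^ 2 + ε))) • innerSL ℝ α) x := by
  have h : HasFDerivAt (fun x : E d => ∑ α ∈ R, k α / 2 * Real.log (⟪x, α⟫ ^ 2 + ε))
      (∑ α ∈ R, (k α * (⟪x, α⟫ / (⟪x, α⟫ ^ 2 + ε))) • innerSL ℝ α) x := by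
    refine HasFDerivAt.fun_sum fun α _ => ?_
    have h1 : HasFDerivAt (fun x : E d => ⟪x, α⟫) (innerSL ℝ α) x := by
      have := (innerSL ℝ α).hasFDerivAt (x := x)
      refine this.congr_of_eventuallyEq (Eventually.of_forall fun y => ?_)
      simp [real_inner_comm]
    have hpos : ⟪x, α⟫ ^ 2 + ε ≠ 0 := by positivity
    have h2 := (((h1.pow 2).add_const ε).log hpos).const_mul (k α / 2)
    refine h2.congr_fderiv ?_
    ext v
    simp only [smul_apply, smul_eq_mul, nsmul_eq_mul, Nat.cast_ofNat]
    field_simp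
    norm_num
  exact h.exp

lemma continuous_regWeight {ε : ℝ} (hε : 0 < ε) : Continuous (regWeight R k ε) :=
  continuous_iff_continuousAt.2 fun x => (hasFDerivAt_regWeight hε x).continuousAt

lemma regWeight_dunklReflect (hRrefl : ∀ α ∈ R, ∀ β ∈ R, dunklReflect α β ∈ R)
    (hkinv : ∀ α ∈ R, ∀ β ∈ R, k (dunklReflect α β) = k β) {α : E d} (hα : α ∈ R)
    (ε : ℝ) (x : E d) : regWeight R k ε (dunklReflect α x) = regWeight R k ε x := by
  rw [regWeight, regWeight]
  congr 1
  refine Finset.sum_nbij' (dunklReflect α) (dunklReflect α) (hRrefl α hα) (hRrefl α hα)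
    (fun β _ => dunklReflect_dunklReflect α β) (fun β _ => dunklReflect_dunklReflect α β)
    fun β hβ => ?_
  rw [hkinv α hα β hβ, inner_dunklReflect_left]

lemma wk_nonneg (x : E d) : 0 ≤ wk R k x :=
  Finset.prod_nonneg fun _ _ => Real.rpow_nonneg (abs_nonneg _) _

lemma continuous_wk (hk : ∀ α ∈ R, 0 < k α) : Continuous (wk R k) := by
  unfold wk
  refine continuous_finsetProd _ fun α hα => ?_
  exact (by fun_prop : Continuous fun x : E d => |⟪x, α⟫|).rpow_const fun _ => Or.inr (hk α hα).le

lemma wk_eq_zero (hk : ∀ α ∈ R, 0 < k α) {α : E d} (hα : α ∈ R) {x : E d} (h : ⟪α, x⟫ = 0) :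
    wk R k x = 0 := by
  refine Finset.prod_eq_zero hα ?_
  rw [real_inner_comm, h, abs_zero, Real.zero_rpow (hk α hα).ne']

end Weight

section DunklLap

variable {d : ℕ} {R : Finset (E d)} {k : E d → ℝ}

/-- The numerator of the part of the Dunkl Laplacian attached to the root `α`, after reduction to
the common denominator `⟪α, x⟫ ^ 2`. -/
def dunklNum (α : E d) (ψ : E d → ℝ) (x : E d) : ℝ :=
  fderiv ℝ ψ x α * ⟪α, x⟫ - ‖α‖ ^ 2 / 2 * (ψ x - ψ (dunklReflect α x))

lemma dunklLap_eq (ψ : E d → ℝ) (x : E d) :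
    dunklLap R k ψ x = lap ψ x + ∑ α ∈ R, k α * (dunklNum α ψ x / ⟪α, x⟫ ^ 2) := by
  rw [dunklLap]
  congr 1
  refine Finset.sum_congr rfl fun α _ => ?_
  rw [dunklNum, inner_gradient_left]
  by_cases h : ⟪α, x⟫ = 0
  · simp [h]
  · field_simp

lemma lap_eq_sum_fderiv (ψ : E d → ℝ) (x : E d) :
    lap ψ x = ∑ i : Fin d, fderiv ℝ (fderiv ℝ ψ) x (EuclideanSpace.single i 1)
      (EuclideanSpace.single i 1) := by
  simp [lap, iteratedFDeriv_two_apply]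

lemma continuous_lap {ψ : E d → ℝ} (hψ : ContDiff ℝ (⊤ : ℕ∞) ψ) : Continuous (lap ψ) := by
  have h1 : ContDiff ℝ 1 (fderiv ℝ ψ) :=
    (contDiff_infty.1 hψ 2).fderiv_right (by norm_num)
  have h2 : Continuous (fderiv ℝ (fderiv ℝ ψ)) := h1.continuous_fderiv one_ne_zero
  simp_rw [funext (lap_eq_sum_fderiv ψ)]
  fun_prop

lemma continuous_fderiv_of_smooth {ψ : E d → ℝ} (hψ : ContDiff ℝ (⊤ : ℕ∞) ψ) :
    Continuous (fderiv ℝ ψ) :=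
  hψ.continuous_fderiv (by simp)

lemma continuous_dunklNum {ψ : E d → ℝ} (hψ : ContDiff ℝ (⊤ : ℕ∞) ψ) (α : E d) :
    Continuous (dunklNum α ψ) := by
  have h1 := continuous_fderiv_of_smooth hψ
  have h2 := hψ.continuous
  have h3 := continuous_dunklReflect α
  unfold dunklNum
  fun_prop

lemma exists_abs_dunklNum_le {ψ : E d → ℝ} (hψ : ContDiff ℝ (⊤ : ℕ∞) ψ)
    (hc : HasCompactSupport ψ) {α : E d} (hα : α ≠ 0) :
    ∃ C : ℝ, 0 ≤ C ∧ ∀ x, |dunklNum α ψ x| ≤ C * ⟪α, x⟫ ^ 2 := by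
  have h1 : ContDiff ℝ 1 (fderiv ℝ ψ) :=
    (contDiff_infty.1 hψ 2).fderiv_right (by norm_num)
  obtain ⟨K, hK⟩ := h1.lipschitzWith_of_hasCompactSupport (hc.fderiv ℝ) one_ne_zero
  refine ⟨2 * K, by positivity, fun x => ?_⟩
  have hα' : 0 < ‖α‖ := norm_pos_iff.2 hα
  set y := dunklReflect α x with hy
  have hyx : y - x = -((2 * ⟪α, x⟫) / ‖α‖ ^ 2) • α := by
    rw [hy, dunklReflect, neg_smul]; abel
  have hn : ‖y - x‖ = 2 * |⟪α, x⟫| / ‖α‖ := by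
    rw [hyx, norm_smul, norm_neg, Real.norm_eq_abs, abs_div, abs_mul, abs_of_pos (two_pos),
      abs_of_pos (pow_pos hα' 2)]
    field_simp
  have h2 : ‖ψ y - ψ x - fderiv ℝ ψ x (y - x)‖ ≤ K * ‖y - x‖ * ‖y - x‖ := by
    refine (convex_segment x y).norm_image_sub_le_of_norm_hasFDerivWithin_le'
      (f' := fderiv ℝ ψ) (fun z _ => ?_) (fun z hz => ?_)
      (left_mem_segment ℝ x y) (right_mem_segment ℝ x y)
    · exact ((hψ.differentiable (by simp)) z).hasFDerivAt.hasFDerivWithinAt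
    · rw [← dist_eq_norm]
      refine (hK.dist_le_mul z x).trans ?_
      gcongr
      rw [dist_eq_norm]
      exact norm_sub_le_of_mem_segment hz
  have h3 : ψ y - ψ x - fderiv ℝ ψ x (y - x) = 2 / ‖α‖ ^ 2 * dunklNum α ψ x := by
    rw [hyx, map_smul, dunklNum, smul_eq_mul, ← hy]
    field_simp
    ring
  rw [h3, hn, Real.norm_eq_abs, abs_mul, abs_of_pos (by positivity)] at h2
  have h4 : K * (2 * |⟪α, x⟫| / ‖α‖) * (2 * |⟪α, x⟫| / ‖α‖)
      = 2 / ‖α‖ ^ 2 * (2 * K * ⟪α, x⟫ ^ 2) := by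
    rw [← sq_abs ⟪α, x⟫]; field_simp
  rw [h4] at h2
  exact le_of_mul_le_mul_left h2 (by positivity)

lemma eventually_eq_zero_of_norm_gt {ψ : E d → ℝ} {ρ : ℝ} (h0 : ∀ x, ρ < ‖x‖ → ψ x = 0)
    {x : E d} (hx : ρ < ‖x‖) : ψ =ᶠ[𝓝 x] fun _ => 0 := by
  filter_upwards [(isOpen_lt continuous_const continuous_norm).mem_nhds hx] with y hy
  exact h0 y hy

lemma fderiv_eq_zero_of_norm_gt {ψ : E d → ℝ} {ρ : ℝ} (h0 : ∀ x, ρ < ‖x‖ → ψ x = 0)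
    {x : E d} (hx : ρ < ‖x‖) : fderiv ℝ ψ x = 0 := by
  rw [(eventually_eq_zero_of_norm_gt h0 hx).fderiv_eq]; simp

lemma lap_eq_zero_of_norm_gt {ψ : E d → ℝ} {ρ : ℝ} (h0 : ∀ x, ρ < ‖x‖ → ψ x = 0)
    {x : E d} (hx : ρ < ‖x‖) : lap ψ x = 0 := by
  have h := (eventually_eq_zero_of_norm_gt h0 hx).fderiv (𝕜 := ℝ)
  rw [lap_eq_sum_fderiv, h.fderiv_eq]
  simp [fderiv_fun_const]

lemma dunklNum_eq_zero_of_norm_gt {ψ : E d → ℝ} {ρ : ℝ} (h0 : ∀ x, ρ < ‖x‖ → ψ x = 0)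
    (α : E d) {x : E d} (hx : ρ < ‖x‖) : dunklNum α ψ x = 0 := by
  rw [dunklNum, fderiv_eq_zero_of_norm_gt h0 hx, h0 x hx,
    h0 _ (by rwa [norm_dunklReflect])]
  simp

lemma dunklLap_eq_zero_of_norm_gt {ψ : E d → ℝ} {ρ : ℝ} (h0 : ∀ x, ρ < ‖x‖ → ψ x = 0)
    {x : E d} (hx : ρ < ‖x‖) : dunklLap R k ψ x = 0 := by
  simp [dunklLap_eq, lap_eq_zero_of_norm_gt h0 hx, dunklNum_eq_zero_of_norm_gt h0 _ hx]

lemma measurable_dunklLap {ψ : E d → ℝ} (hψ : ContDiff ℝ (⊤ : ℕ∞) ψ) :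
    Measurable (dunklLap R k ψ) := by
  rw [funext (dunklLap_eq (R := R) (k := k) ψ)]
  refine (continuous_lap hψ).measurable.add (Finset.measurable_fun_sum _ fun α _ => ?_)
  refine ((continuous_dunklNum hψ α).measurable.div ?_).const_mul _
  exact (by fun_prop : Continuous fun x : E d => ⟪α, x⟫ ^ 2).measurable

lemma exists_abs_dunklLap_le (hR0 : ∀ α ∈ R, α ≠ 0) {ψ : E d → ℝ}
    (hψ : ContDiff ℝ (⊤ : ℕ∞) ψ) (hc : HasCompactSupport ψ) :
    ∃ C : ℝ, ∀ x, |dunklLap R k ψ x| ≤ C := by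
  choose! C hC0 hC using fun α (hα : α ∈ R) => exists_abs_dunklNum_le hψ hc (hR0 α hα)
  have hcl : HasCompactSupport (lap ψ) := by
    refine HasCompactSupport.intro hc fun x hx => ?_
    have h1 : fderiv ℝ (fderiv ℝ ψ) x = 0 :=
      fderiv_of_notMem_tsupport ℝ fun h => hx (tsupport_fderiv_subset ℝ h)
    simp [lap_eq_sum_fderiv, h1]
  obtain ⟨C0, hC0'⟩ := hcl.exists_bound_of_continuous (continuous_lap hψ)
  refine ⟨C0 + ∑ α ∈ R, |k α| * C α, fun x => ?_⟩
  rw [dunklLap_eq]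
  refine (abs_add_le _ _).trans (add_le_add (hC0' x) ?_)
  refine (Finset.abs_sum_le_sum_abs _ _).trans (Finset.sum_le_sum fun α hα => ?_)
  rw [abs_mul, abs_div]
  gcongr
  refine div_le_of_le_mul₀ (abs_nonneg _) (hC0 α hα) ?_
  rw [abs_of_nonneg (sq_nonneg ⟪α, x⟫)]
  exact hC α hα x

end DunklLap

section Divergence

variable {d : ℕ}

lemma integral_hasFDerivAt_apply_eq_zero {f : E d → ℝ} {f' : E d → E d →L[ℝ] ℝ}
    (hf : ∀ x, HasFDerivAt f (f' x) x) (hc : HasCompactSupport f) (v : E d)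
    (hf' : Continuous fun x => f' x v) : ∫ x, f' x v = 0 := by
  have hfd : f' = fderiv ℝ f := funext fun x => (hf x).fderiv.symm
  subst hfd
  have hcv : HasCompactSupport fun x => fderiv ℝ f x v :=
    HasCompactSupport.intro hc fun x hx => by
      rw [fderiv_of_notMem_tsupport ℝ hx]; simp
  have hcont : Continuous f := continuous_iff_continuousAt.2 fun x => (hf x).continuousAt
  have h := integral_mul_fderiv_eq_neg_fderiv_mul_of_integrable (μ := volume)
    (f := fun _ : E d => (1 : ℝ)) (g := f) (v := v) (by simp)
    (by simpa using hf'.integrable_of_hasCompactSupport hcv)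
    (by simpa using hcont.integrable_of_hasCompactSupport hc)
    (fun x _ => differentiableAt_const _) (fun x _ => (hf x).differentiableAt)
  simpa using h

end Divergence

section Green

variable {d : ℕ} {R : Finset (E d)} {k : E d → ℝ}

lemma integrableOn_mul_dunklLap_mul_wk (hR0 : ∀ α ∈ R, α ≠ 0) (hk : ∀ α ∈ R, 0 < k α)
    {ψ : E d → ℝ} (hψ : ContDiff ℝ (⊤ : ℕ∞) ψ) (hc : HasCompactSupport ψ) {ρ : ℝ}
    (h0 : ∀ x, ρ < ‖x‖ → ψ x = 0) {u : E d → ℝ}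
    (hu : ContinuousOn u (Metric.closedBall 0 ρ)) {s : Set (E d)} (hs : MeasurableSet s) :
    IntegrableOn (fun x => u x * dunklLap R k ψ x * wk R k x) s := by
  obtain ⟨C, hC⟩ := exists_abs_dunklLap_le (k := k) hR0 hψ hc
  have h1 : IntegrableOn (fun x => u x * dunklLap R k ψ x * wk R k x)
      (Metric.closedBall 0 ρ) := by
    have h2 : IntegrableOn (fun x => u x * wk R k x) (Metric.closedBall 0 ρ) :=
      (hu.mul (continuous_wk hk).continuousOn).integrableOn_compact (isCompact_closedBall _ _)
    have h3 := h2.mul_bdd (c := C) (g := dunklLap R k ψ)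
      (measurable_dunklLap hψ).aestronglyMeasurable
      (Eventually.of_forall fun x => hC x)
    refine h3.congr (Eventually.of_forall fun x => ?_)
    simp only; ring
  refine h1.of_forall_sdiff_eq_zero hs fun x hx => ?_
  have hx' : ρ < ‖x‖ := by simpa using hx.2
  rw [dunklLap_eq_zero_of_norm_gt h0 hx']; ring

lemma integrableOn_mul_mul_wk (hk : ∀ α ∈ R, 0 < k α)
    {ψ : E d → ℝ} (hψ : Continuous ψ) {ρ : ℝ}
    (h0 : ∀ x, ρ < ‖x‖ → ψ x = 0) {u : E d → ℝ}
    (hu : ContinuousOn u (Metric.closedBall 0 ρ)) {s : Set (E d)} (hs : MeasurableSet s) :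
    IntegrableOn (fun x => u x * ψ x * wk R k x) s := by
  refine (((hu.mul hψ.continuousOn).mul (continuous_wk hk).continuousOn).integrableOn_compact
    (isCompact_closedBall _ _)).of_forall_sdiff_eq_zero hs fun x hx => ?_
  have hx' : ρ < ‖x‖ := by simpa using hx.2
  simp [h0 x hx']

lemma exists_norm_gt_eq_zero {ψ : E d → ℝ} (hc : HasCompactSupport ψ) :
    ∃ ρ : ℝ, 0 < ρ ∧ ∀ x, ρ < ‖x‖ → ψ x = 0 := by
  obtain ⟨ρ, hρ⟩ := hc.isCompact.isBounded.subset_closedBall 0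
  refine ⟨max ρ 1, by positivity, fun x hx => ?_⟩
  by_contra h
  have := hρ (subset_tsupport ψ h)
  simp only [mem_closedBall_zero_iff] at this
  linarith [le_max_left ρ 1]

/-- The regularised integrand in Green's formula for the Dunkl Laplacian. -/
def greenIntegrand (R : Finset (E d)) (k : E d → ℝ) (u a : E d → ℝ) (b : E d → ℝ)
    (ψ : E d → ℝ) (ε : ℝ) (x : E d) : ℝ :=
  u x * lap ψ x * regWeight R k ε x
    + ∑ α ∈ R, k α * u x * (regWeight R k ε x * (dunklNum α ψ x / (⟪α, x⟫ ^ 2 + ε)))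
    - b x * ψ x * regWeight R k ε x
    - ∑ α ∈ R, k α * ψ x * a x * (regWeight R k ε x * (⟪α, x⟫ ^ 2 / (⟪α, x⟫ ^ 2 + ε)))

lemma continuous_greenIntegrand {u a b ψ : E d → ℝ} (hu : Continuous u) (ha : Continuous a)
    (hb : Continuous b) (hψ : ContDiff ℝ (⊤ : ℕ∞) ψ) {ε : ℝ} (hε : 0 < ε) :
    Continuous (greenIntegrand R k u a b ψ ε) := by
  have h1 := continuous_lap hψ
  have h2 := hψ.continuous
  have h3 := continuous_regWeight (R := R) (k := k) hε
  have h4 := continuous_dunklNum hψ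
  have h5 : ∀ α x : E d, ⟪α, x⟫ ^ 2 + ε ≠ 0 := fun α x => by positivity
  unfold greenIntegrand
  fun_prop (disch := exact h5 _)

lemma greenIntegrand_eq_zero {u a b ψ : E d → ℝ} {ρ : ℝ} (h0 : ∀ x, ρ < ‖x‖ → ψ x = 0)
    (ε : ℝ) {x : E d} (hx : ρ < ‖x‖) : greenIntegrand R k u a b ψ ε x = 0 := by
  simp [greenIntegrand, h0 x hx, lap_eq_zero_of_norm_gt h0 hx,
    dunklNum_eq_zero_of_norm_gt h0 _ hx]

lemma integral_greenIntegrand (hRrefl : ∀ α ∈ R, ∀ β ∈ R, dunklReflect α β ∈ R)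
    (hR0 : ∀ α ∈ R, α ≠ 0)
    (hkinv : ∀ α ∈ R, ∀ β ∈ R, k (dunklReflect α β) = k β)
    {u a : E d → ℝ} {D : Fin d → E d → ℝ} {G' : E d → E d →L[ℝ] E d}
    (hu : ∀ x, HasFDerivAt u (a x • innerSL ℝ x) x)
    (hG : ∀ x, HasFDerivAt (fun x => a x • x) (G' x) x)
    (ha : Continuous a) (hD : ∀ i x, G' x (EuclideanSpace.single i 1) i = D i x)
    (hDc : ∀ i, Continuous (D i)) (husym : ∀ α ∈ R, ∀ x, u (dunklReflect α x) = u x)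
    {ψ : E d → ℝ} (hψ : ContDiff ℝ (⊤ : ℕ∞) ψ) (hc : HasCompactSupport ψ)
    {ε : ℝ} (hε : 0 < ε) :
    ∫ x, greenIntegrand R k u a (fun x => ∑ i, D i x) ψ ε x = 0 := by
  obtain ⟨ρ, -, h0⟩ := exists_norm_gt_eq_zero hc
  have huc : Continuous u := continuous_iff_continuousAt.2 fun x => (hu x).continuousAt
  have hψd : ∀ x, HasFDerivAt ψ (fderiv ℝ ψ x) x := fun x =>
    ((hψ.differentiable (by simp)) x).hasFDerivAt
  have hψ2 : ContDiff ℝ 1 (fderiv ℝ ψ) := (contDiff_infty.1 hψ 2).fderiv_right (by norm_num)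
  have hψdd : ∀ x, HasFDerivAt (fderiv ℝ ψ) (fderiv ℝ (fderiv ℝ ψ) x) x := fun x =>
    ((hψ2.differentiable (by simp)) x).hasFDerivAt
  have hψddc : Continuous (fderiv ℝ (fderiv ℝ ψ)) := hψ2.continuous_fderiv one_ne_zero
  have hψdc := continuous_fderiv_of_smooth hψ
  have hψc := hψ.continuous
  have hw := continuous_regWeight (R := R) (k := k) hε
  have h5 : ∀ α x : E d, ⟪α, x⟫ ^ 2 + ε ≠ 0 := fun α x => by positivity
  have h5' : ∀ α x : E d, ⟪x, α⟫ ^ 2 + ε ≠ 0 := fun α x => by positivity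
  -- the divergence, coordinate by coordinate
  set e : Fin d → E d := fun i => EuclideanSpace.single i 1 with he
  set J : Fin d → E d → ℝ := fun i x =>
    regWeight R k ε x * (∑ α ∈ R, (k α * (⟪x, α⟫ / (⟪x, α⟫ ^ 2 + ε))) * α i)
        * (u x * fderiv ℝ ψ x (e i) - ψ x * (a x * x i))
      + regWeight R k ε x * (u x * fderiv ℝ (fderiv ℝ ψ) x (e i) (e i) - ψ x * D i x) with hJ
  have hJc : ∀ i, Continuous (J i) := by
    intro i
    have := hDc i
    simp only [hJ]
    fun_prop (disch := exact h5' _)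
  have hJ0 : ∀ i x, ρ < ‖x‖ → J i x = 0 := by
    intro i x hx
    have h1 : fderiv ℝ (fderiv ℝ ψ) x = 0 := by
      rw [((eventually_eq_zero_of_norm_gt h0 hx).fderiv (𝕜 := ℝ)).fderiv_eq]
      simp [fderiv_fun_const]
    simp [hJ, h0 x hx, fderiv_eq_zero_of_norm_gt h0 hx, h1]
  have hcs : ∀ f : E d → ℝ, (∀ x, ρ < ‖x‖ → f x = 0) → HasCompactSupport f := fun f hf =>
    HasCompactSupport.intro (isCompact_closedBall 0 ρ) fun x hx => hf x (by simpa using hx)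
  have hJint : ∀ i, ∫ x, J i x = 0 := by
    intro i
    have hF : ∀ x, HasFDerivAt (fun x => regWeight R k ε x *
        (u x * fderiv ℝ ψ x (e i) - ψ x * (a x • x) i)) _ x := fun x =>
      (hasFDerivAt_regWeight hε x).mul (((hu x).mul ((hψdd x).clm_apply
        (hasFDerivAt_const (e i) x))).sub ((hψd x).mul
        ((EuclideanSpace.proj (𝕜 := ℝ) i).hasFDerivAt.comp x (hG x))))
    have hval : ∀ x, J i x = _ := fun x => by
      have h1 := DFunLike.congr_fun (hF x).fderiv (e i)
      have h2 : J i x = fderiv ℝ (fun x => regWeight R k ε x *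
        (u x * fderiv ℝ ψ x (e i) - ψ x * (a x • x) i)) x (e i) := by
        rw [h1]
        have h3 : G' x (e i) i = D i x := hD i x
        have h4 : ∀ α : E d, ⟪α, e i⟫ = α i := fun α => by
          simp [he, EuclideanSpace.inner_single_right]
        simp [hJ, h3, h4]
        ring
      exact h2
    have hfd : ∀ x, HasFDerivAt (fun x => regWeight R k ε x *
        (u x * fderiv ℝ ψ x (e i) - ψ x * (a x • x) i)) (fderiv ℝ (fun x => regWeight R k ε x *
        (u x * fderiv ℝ ψ x (e i) - ψ x * (a x • x) i)) x) x := fun x =>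
      (hF x).differentiableAt.hasFDerivAt
    have := integral_hasFDerivAt_apply_eq_zero hfd ?_ (e i) ?_
    · rw [← this]
      exact integral_congr_ae (Eventually.of_forall hval)
    · refine hcs _ fun x hx => ?_
      simp [h0 x hx, fderiv_eq_zero_of_norm_gt h0 hx]
    · rw [← funext hval]; exact hJc i
  -- the odd terms
  set O : E d → E d → ℝ := fun α x => regWeight R k ε x * (k α * u x * (‖α‖ ^ 2 / 2 *
    (ψ x - ψ (dunklReflect α x))) / (⟪α, x⟫ ^ 2 + ε)) with hO
  have hO0 : ∀ α x, ρ < ‖x‖ → O α x = 0 := by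
    intro α x hx
    have : ψ (dunklReflect α x) = 0 := h0 _ (by rwa [norm_dunklReflect])
    simp [hO, h0 x hx, this]
  have hOc : ∀ α, Continuous (O α) := by
    intro α
    have := continuous_dunklReflect α
    simp only [hO]
    fun_prop (disch := exact h5 _)
  have hOint : ∀ α ∈ R, ∫ x, O α x = 0 := by
    intro α hα
    refine integral_eq_zero_of_dunklReflect_odd α _ fun x => ?_
    simp only [hO, regWeight_dunklReflect hRrefl hkinv hα, husym α hα,
      inner_dunklReflect_self (hR0 α hα), dunklReflect_dunklReflect, neg_sq]
    ring
  have key : ∀ x, greenIntegrand R k u a (fun x => ∑ i, D i x) ψ ε x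
      = ∑ i, J i x - ∑ α ∈ R, O α x := by
    intro x
    have hfα : ∀ α : E d, fderiv ℝ ψ x α = ∑ i, α i * fderiv ℝ ψ x (e i) := by
      intro α
      have : α = ∑ i, α i • e i := by
        ext j
        simp [he, Pi.single_apply]
      conv_lhs => rw [this]
      simp
    have hinα : ∀ α : E d, ⟪α, x⟫ = ∑ i, α i * x i := by
      intro α
      simp [PiLp.inner_apply, mul_comm]
    have h1 : ∑ i, J i x = regWeight R k ε x * (∑ α ∈ R, (k α * (⟪α, x⟫ / (⟪α, x⟫ ^ 2 + ε)) *
        (u x * fderiv ℝ ψ x α - ψ x * (a x * ⟪α, x⟫))))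
        + regWeight R k ε x * (u x * lap ψ x - ψ x * ∑ i, D i x) := by
      simp only [hJ, Finset.sum_add_distrib, ← Finset.mul_sum, Finset.sum_sub_distrib,
        lap_eq_sum_fderiv]
      congr 1
      have h3 : ∀ α : E d, u x * fderiv ℝ ψ x α - ψ x * (a x * ⟪α, x⟫)
          = ∑ i, α i * (u x * fderiv ℝ ψ x (e i) - ψ x * (a x * x i)) := by
        intro α
        rw [hfα, hinα, Finset.mul_sum, Finset.mul_sum, Finset.mul_sum, ← Finset.sum_sub_distrib]
        exact Finset.sum_congr rfl fun i _ => by ring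
      simp_rw [h3, Finset.mul_sum, Finset.sum_mul]
      rw [Finset.sum_comm]
      refine Finset.sum_congr rfl fun α _ => Finset.sum_congr rfl fun i _ => ?_
      rw [real_inner_comm]
      ring
    have h2 : ∑ α ∈ R, k α * u x * (regWeight R k ε x * (dunklNum α ψ x / (⟪α, x⟫ ^ 2 + ε)))
        - ∑ α ∈ R, k α * ψ x * a x * (regWeight R k ε x * (⟪α, x⟫ ^ 2 / (⟪α, x⟫ ^ 2 + ε)))
        = regWeight R k ε x * (∑ α ∈ R, (k α * (⟪α, x⟫ / (⟪α, x⟫ ^ 2 + ε)) *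
        (u x * fderiv ℝ ψ x α - ψ x * (a x * ⟪α, x⟫)))) - ∑ α ∈ R, O α x := by
      rw [Finset.mul_sum, ← Finset.sum_sub_distrib, ← Finset.sum_sub_distrib]
      refine Finset.sum_congr rfl fun α _ => ?_
      simp only [hO, dunklNum, div_eq_mul_inv]
      ring
    rw [h1, greenIntegrand]
    linear_combination h2
  simp_rw [key]
  rw [integral_sub, integral_finsetSum, integral_finsetSum, Finset.sum_eq_zero fun i _ => hJint i,
    Finset.sum_eq_zero hOint, sub_zero]
  · exact fun α _ => (hOc α).integrable_of_hasCompactSupport (hcs _ (hO0 α))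
  · exact fun i _ => (hJc i).integrable_of_hasCompactSupport (hcs _ (hJ0 i))
  · exact integrable_finsetSum _ fun i _ => (hJc i).integrable_of_hasCompactSupport (hcs _ (hJ0 i))
  · exact integrable_finsetSum _ fun α _ =>
      (hOc α).integrable_of_hasCompactSupport (hcs _ (hO0 α))

end Green

section GreenLimit

variable {d : ℕ} {R : Finset (E d)} {k : E d → ℝ}

lemma tendsto_regWeight_mul_div (hk : ∀ α ∈ R, 0 < k α) {α : E d} {x : E d} {s : ℝ}
    (hs : ⟪α, x⟫ = 0 → s = 0) :
    Tendsto (fun ε => regWeight R k ε x * (s / (⟪α, x⟫ ^ 2 + ε))) (𝓝[>] 0)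
      (𝓝 (wk R k x * (s / ⟪α, x⟫ ^ 2))) := by
  by_cases h : ⟪α, x⟫ = 0
  · simp [hs h]
  · refine (tendsto_regWeight hk x).mul (tendsto_const_nhds.div ?_ (pow_ne_zero 2 h))
    have : Tendsto (fun ε : ℝ => ⟪α, x⟫ ^ 2 + ε) (𝓝 0) (𝓝 (⟪α, x⟫ ^ 2 + 0)) :=
      (continuous_const.add continuous_id).tendsto 0
    simpa using this.mono_left nhdsWithin_le_nhds

/-- Green's formula for the Dunkl Laplacian and a reflection-invariant function `u` whose gradient
at `x` is `a x • x`. -/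
theorem integral_mul_dunklLap (hRrefl : ∀ α ∈ R, ∀ β ∈ R, dunklReflect α β ∈ R)
    (hR0 : ∀ α ∈ R, α ≠ 0) (hk : ∀ α ∈ R, 0 < k α)
    (hkinv : ∀ α ∈ R, ∀ β ∈ R, k (dunklReflect α β) = k β)
    {u a : E d → ℝ} {D : Fin d → E d → ℝ} {G' : E d → E d →L[ℝ] E d}
    (hu : ∀ x, HasFDerivAt u (a x • innerSL ℝ x) x)
    (hG : ∀ x, HasFDerivAt (fun x => a x • x) (G' x) x)
    (ha : Continuous a) (hD : ∀ i x, G' x (EuclideanSpace.single i 1) i = D i x)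
    (hDc : ∀ i, Continuous (D i)) (husym : ∀ α ∈ R, ∀ x, u (dunklReflect α x) = u x)
    {ψ : E d → ℝ} (hψ : ContDiff ℝ (⊤ : ℕ∞) ψ) (hc : HasCompactSupport ψ) :
    ∫ x, u x * dunklLap R k ψ x * wk R k x
      = ∫ x, ((∑ i, D i x) + (∑ α ∈ R, k α) * a x) * ψ x * wk R k x := by
  obtain ⟨ρ, -, h0⟩ := exists_norm_gt_eq_zero hc
  have huc : Continuous u := continuous_iff_continuousAt.2 fun x => (hu x).continuousAt
  choose! C hC0 hC using fun α (hα : α ∈ R) => exists_abs_dunklNum_le hψ hc (hR0 α hα)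
  have hbc : Continuous fun x => ∑ i, D i x := continuous_finsetSum _ fun i _ => hDc i
  set b : E d → ℝ := fun x => ∑ i, D i x with hb
  have hlap := continuous_lap hψ
  have hψc := hψ.continuous
  have hwc := continuous_regWeight (R := R) (k := k) one_pos
  set L : E d → ℝ := fun x => u x * dunklLap R k ψ x * wk R k x
    - (b x + (∑ α ∈ R, k α) * a x) * ψ x * wk R k x with hL
  set B : E d → ℝ := fun x => regWeight R k 1 x * (|u x * lap ψ x| + ∑ α ∈ R, k α * |u x| * C α
    + |b x * ψ x| + ∑ α ∈ R, k α * |ψ x * a x|) with hB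
  have hBc : Continuous B := by simp only [hB]; fun_prop
  have hnum0 : ∀ α ∈ R, ∀ x, ⟪α, x⟫ = 0 → dunklNum α ψ x = 0 := by
    intro α hα x h
    have := hC α hα x
    rw [h] at this
    exact abs_nonpos_iff.1 (by simpa using this)
  have hlim : Tendsto (fun ε => ∫ x, greenIntegrand R k u a b ψ ε x) (𝓝[>] 0) (𝓝 (∫ x, L x)) := by
    refine tendsto_integral_filter_of_dominated_convergence
      ((Metric.closedBall 0 ρ).indicator B) ?_ ?_ ?_ ?_
    · filter_upwards [self_mem_nhdsWithin] with ε hε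
      exact (continuous_greenIntegrand huc ha hbc hψ hε).aestronglyMeasurable
    · filter_upwards [self_mem_nhdsWithin, Ioo_mem_nhdsGT one_pos] with ε (hε : 0 < ε) hε1
      refine Eventually.of_forall fun x => ?_
      by_cases hx : x ∈ Metric.closedBall 0 ρ
      · rw [Set.indicator_of_mem hx, Real.norm_eq_abs]
        have hw : regWeight R k ε x ≤ regWeight R k 1 x := regWeight_mono hk hε hε1.2.le x
        have hw0 : 0 < regWeight R k ε x := regWeight_pos ε x
        have hrat : ∀ α : E d, |⟪α, x⟫ ^ 2 / (⟪α, x⟫ ^ 2 + ε)| ≤ 1 := fun α => by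
          rw [abs_of_nonneg (by positivity)]
          exact div_le_one_of_le₀ (by linarith) (by positivity)
        have hrat2 : ∀ α ∈ R, |dunklNum α ψ x / (⟪α, x⟫ ^ 2 + ε)| ≤ C α := fun α hα => by
          rw [abs_div, abs_of_pos (by positivity : 0 < ⟪α, x⟫ ^ 2 + ε)]
          refine div_le_of_le_mul₀ (by positivity) (hC0 α hα) ((hC α hα x).trans ?_)
          have := hC0 α hα
          gcongr; linarith
        have e : greenIntegrand R k u a b ψ ε x = regWeight R k ε x * (u x * lap ψ x
            + ∑ α ∈ R, k α * u x * (dunklNum α ψ x / (⟪α, x⟫ ^ 2 + ε))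
            - b x * ψ x - ∑ α ∈ R, k α * (ψ x * a x) * (⟪α, x⟫ ^ 2 / (⟪α, x⟫ ^ 2 + ε))) := by
          rw [greenIntegrand, mul_sub, mul_sub, mul_add, Finset.mul_sum, Finset.mul_sum]
          congr 1
          · congr 1
            · congr 1
              · ring
              · exact Finset.sum_congr rfl fun α _ => by ring
            · ring
          · exact Finset.sum_congr rfl fun α _ => by ring
        rw [e, abs_mul, abs_of_pos hw0]
        refine mul_le_mul hw ?_ (abs_nonneg _) (regWeight_pos 1 x).le
        refine (abs_sub _ _).trans (add_le_add ((abs_sub _ _).trans (add_le_add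
          ((abs_add_le _ _).trans (add_le_add le_rfl ?_)) le_rfl)) ?_)
        · refine (Finset.abs_sum_le_sum_abs _ _).trans (Finset.sum_le_sum fun α hα => ?_)
          rw [abs_mul, abs_mul, abs_of_pos (hk α hα)]
          have := (hk α hα).le
          gcongr
          exact hrat2 α hα
        · refine (Finset.abs_sum_le_sum_abs _ _).trans (Finset.sum_le_sum fun α hα => ?_)
          rw [abs_mul, abs_mul, abs_of_pos (hk α hα)]
          have := (hk α hα).le
          exact mul_le_of_le_one_right (by positivity) (hrat α)
      · rw [greenIntegrand_eq_zero h0 ε (by simpa using hx)]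
        simp [Set.indicator_of_notMem hx]
    · rw [integrable_indicator_iff measurableSet_closedBall]
      exact hBc.continuousOn.integrableOn_compact (isCompact_closedBall _ _)
    · refine Eventually.of_forall fun x => ?_
      have e : L x = u x * lap ψ x * wk R k x
          + ∑ α ∈ R, k α * u x * (wk R k x * (dunklNum α ψ x / ⟪α, x⟫ ^ 2))
          - b x * ψ x * wk R k x
          - ∑ α ∈ R, k α * ψ x * a x * (wk R k x * 1) := by
        simp only [hL, dunklLap_eq, mul_add, add_mul, Finset.mul_sum, Finset.sum_mul]
        rw [sub_add_eq_sub_sub]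
        congr 1
        · congr 2
          exact Finset.sum_congr rfl fun α _ => by ring
        · exact Finset.sum_congr rfl fun α _ => by ring
      rw [e]
      refine (((tendsto_const_nhds.mul (tendsto_regWeight hk x)).add
        (tendsto_finsetSum _ fun α hα => tendsto_const_nhds.mul ?_)).sub
        (tendsto_const_nhds.mul (tendsto_regWeight hk x))).sub
        (tendsto_finsetSum _ fun α hα => tendsto_const_nhds.mul ?_)
      · exact tendsto_regWeight_mul_div hk (hnum0 α hα x)
      · have := tendsto_regWeight_mul_div hk (α := α) (x := x) (s := ⟪α, x⟫ ^ 2)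
          (fun h => by simp [h])
        convert this using 2
        by_cases h : ⟪α, x⟫ = 0
        · simp [wk_eq_zero hk hα h]
        · rw [div_self (pow_ne_zero 2 h)]
  have hzero : ∫ x, L x = 0 := by
    refine tendsto_nhds_unique hlim ?_
    refine tendsto_const_nhds.congr' ?_
    filter_upwards [self_mem_nhdsWithin] with ε hε
    exact (integral_greenIntegrand hRrefl hR0 hkinv hu hG ha hD hDc husym hψ hc hε).symm
  have hi1 := integrableOn_mul_dunklLap_mul_wk hR0 hk hψ hc h0 huc.continuousOn
    MeasurableSet.univ
  have hi2 := integrableOn_mul_mul_wk (u := fun x => b x + (∑ α ∈ R, k α) * a x) hk hψc h0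
    (by fun_prop) MeasurableSet.univ
  rw [integrableOn_univ] at hi1 hi2
  rw [hL, integral_sub hi1 hi2] at hzero
  linarith

end GreenLimit

section Radial

/-- The average `∫₀¹ τ ^ (m - 1) q (t τ) dτ`. -/
def radialMean (m : ℝ) (q : ℝ → ℝ) (t : ℝ) : ℝ := ∫ τ in (0:ℝ)..1, τ ^ (m - 1) * q (t * τ)

/-- The solution of `v'' + (m - 1) / ρ v' = q` with `v 0 = c` and `v' 0 = 0`. -/
def radialSol (m : ℝ) (q : ℝ → ℝ) (c ρ : ℝ) : ℝ :=
  c + 2⁻¹ * ∫ σ in (0:ℝ)..ρ ^ 2, radialMean m q (√σ)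

variable {m : ℝ} {q : ℝ → ℝ}

lemma continuous_radialMean (hm : 1 < m) (hq : Continuous q) : Continuous (radialMean m q) := by
  have h : Continuous fun τ : ℝ => τ ^ (m - 1) :=
    Real.continuous_rpow_const (by linarith)
  refine intervalIntegral.continuous_parametric_intervalIntegral_of_continuous' ?_ _ _
  exact (h.comp continuous_snd).mul (hq.comp (continuous_fst.mul continuous_snd))

lemma radialMean_zero (hm : 1 < m) : radialMean m q 0 = q 0 / m := by
  simp only [radialMean, zero_mul, intervalIntegral.integral_mul_const]
  rw [integral_rpow (Or.inl (by linarith))]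
  simp [Real.zero_rpow (by linarith : m ≠ 0)]
  ring

lemma rpow_mul_radialMean {ρ : ℝ} (hρ : 0 < ρ) :
    ρ ^ m * radialMean m q ρ = ∫ s in (0:ℝ)..ρ, s ^ (m - 1) * q s := by
  have h := intervalIntegral.smul_integral_comp_mul_left (a := 0) (b := 1)
    (fun s => s ^ (m - 1) * q s) ρ
  rw [mul_zero, mul_one] at h
  rw [← h, radialMean, ← intervalIntegral.integral_const_mul, smul_eq_mul,
    ← intervalIntegral.integral_const_mul]
  refine intervalIntegral.integral_congr fun τ hτ => ?_
  rw [Set.uIcc_of_le zero_le_one] at hτ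
  rw [Real.mul_rpow hρ.le hτ.1, ← mul_assoc, ← mul_assoc, ← mul_assoc]
  congr 2
  rw [Real.rpow_sub_one hρ.ne']
  field_simp

lemma hasDerivAt_radialMean (hm : 1 < m) (hq : Continuous q) {ρ : ℝ} (hρ : 0 < ρ) :
    HasDerivAt (radialMean m q) ((q ρ - m * radialMean m q ρ) / ρ) ρ := by
  have hc : Continuous fun s : ℝ => s ^ (m - 1) * q s :=
    (Real.continuous_rpow_const (by linarith)).mul hq
  have h1 : HasDerivAt (fun ρ => ∫ s in (0:ℝ)..ρ, s ^ (m - 1) * q s) (ρ ^ (m - 1) * q ρ) ρ :=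
    (hc.integral_hasStrictDerivAt _ _).hasDerivAt
  have h2 : HasDerivAt (fun ρ : ℝ => ρ ^ (-m)) (-m * ρ ^ (-m - 1)) ρ :=
    Real.hasDerivAt_rpow_const (Or.inl hρ.ne')
  have h3 := h2.mul h1
  have h4 : radialMean m q =ᶠ[𝓝 ρ] fun ρ => ρ ^ (-m) * ∫ s in (0:ℝ)..ρ, s ^ (m - 1) * q s := by
    filter_upwards [lt_mem_nhds hρ] with t ht
    rw [← rpow_mul_radialMean ht, ← mul_assoc, ← Real.rpow_add ht]
    simp
  refine (h3.congr_of_eventuallyEq h4).congr_deriv ?_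
  rw [← rpow_mul_radialMean hρ, Real.rpow_sub_one hρ.ne', Real.rpow_sub_one hρ.ne',
    Real.rpow_neg hρ.le]
  have := Real.rpow_pos_of_pos hρ m
  field_simp
  ring

lemma hasDerivAt_radialSol (hm : 1 < m) (hq : Continuous q) (c ρ : ℝ) :
    HasDerivAt (radialSol m q c) (ρ * radialMean m q |ρ|) ρ := by
  have hc : Continuous fun σ => radialMean m q (√σ) :=
    (continuous_radialMean hm hq).comp Real.continuous_sqrt
  have h1 : HasDerivAt (fun s => ∫ σ in (0:ℝ)..s, radialMean m q (√σ))
      (radialMean m q √(ρ ^ 2)) (ρ ^ 2) :=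
    (hc.integral_hasStrictDerivAt _ _).hasDerivAt
  have h2 := ((h1.comp ρ (h := fun ρ => ρ ^ 2) (hasDerivAt_pow 2 ρ)).const_mul 2⁻¹).const_add c
  refine h2.congr_deriv ?_
  rw [Real.sqrt_sq_eq_abs]
  simp
  ring

lemma radialSol_zero (c : ℝ) : radialSol m q c 0 = c := by simp [radialSol]

lemma continuous_radialSol (hm : 1 < m) (hq : Continuous q) (c : ℝ) :
    Continuous (radialSol m q c) :=
  continuous_iff_continuousAt.2 fun ρ => (hasDerivAt_radialSol hm hq c ρ).continuousAt

variable {d : ℕ} {R : Finset (E d)} {k : E d → ℝ}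

lemma hasFDerivAt_radialSol_norm (hm : 1 < m) (hq : Continuous q) (c : ℝ) (x : E d) :
    HasFDerivAt (fun x : E d => radialSol m q c ‖x‖) (radialMean m q ‖x‖ • innerSL ℝ x) x := by
  have hc : Continuous fun σ => radialMean m q (√σ) :=
    (continuous_radialMean hm hq).comp Real.continuous_sqrt
  have h1 : HasDerivAt (fun s => ∫ σ in (0:ℝ)..s, radialMean m q (√σ))
      (radialMean m q √(‖x‖ ^ 2)) (‖x‖ ^ 2) :=
    (hc.integral_hasStrictDerivAt _ _).hasDerivAt
  have h2 := ((h1.comp_hasFDerivAt x (hasStrictFDerivAt_norm_sq x).hasFDerivAt).const_mul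
    2⁻¹).const_add c
  refine h2.congr_fderiv ?_
  rw [Real.sqrt_sq (norm_nonneg x)]
  ext h
  simp
  ring

lemma hasFDerivAt_radialMean_smul (hm : 1 < m) (hq : Continuous q) (x : E d) :
    HasFDerivAt (fun x : E d => radialMean m q ‖x‖ • x)
      (radialMean m q ‖x‖ • ContinuousLinearMap.id ℝ (E d) +
        ((q ‖x‖ - m * radialMean m q ‖x‖) / ‖x‖ ^ 2) • (innerSL ℝ x).smulRight x) x := by
  by_cases hx : x = 0
  · subst hx
    have hA := (continuous_radialMean hm hq)
    have : HasFDerivAt (fun x : E d => radialMean m q ‖x‖ • x)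
        (radialMean m q ‖(0 : E d)‖ • ContinuousLinearMap.id ℝ (E d)) 0 := by
      rw [hasFDerivAt_iff_isLittleO]
      have h1 : (fun x : E d => radialMean m q ‖x‖ - radialMean m q ‖(0 : E d)‖)
          =o[𝓝 0] fun _ => (1 : ℝ) := by
        rw [Asymptotics.isLittleO_one_iff]
        have : Continuous fun x : E d => radialMean m q ‖x‖ - radialMean m q ‖(0 : E d)‖ := by
          fun_prop
        simpa using this.tendsto 0
      have h2 := h1.smul_isBigO (Asymptotics.isBigO_refl (fun x : E d => x) (𝓝 0))
      refine h2.congr (fun y => ?_) (fun y => ?_)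
      · simp [sub_smul]
      · simp
    simpa using this
  · have hx' : 0 < ‖x‖ := norm_pos_iff.2 hx
    have h1 : HasFDerivAt (fun x : E d => radialMean m q √(‖x‖ ^ 2)) _ x :=
      HasDerivAt.comp_hasFDerivAt x (h₂ := fun s => radialMean m q √s)
        (((hasDerivAt_radialMean hm hq (by rwa [Real.sqrt_sq hx'.le] :
          0 < √(‖x‖ ^ 2))).comp (‖x‖ ^ 2) (Real.hasDerivAt_sqrt (by positivity))))
        (hasStrictFDerivAt_norm_sq x).hasFDerivAt
    simp_rw [Real.sqrt_sq (norm_nonneg _)] at h1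
    refine (h1.smul (hasFDerivAt_id x)).congr_fderiv ?_
    ext h i
    simp
    field_simp

/-- The radial function `x ↦ radialSol m q c ‖x‖` solves `Δ_k u = q(‖x‖)` weakly. -/
theorem integral_radialSol_mul_dunklLap (hRrefl : ∀ α ∈ R, ∀ β ∈ R, dunklReflect α β ∈ R)
    (hR0 : ∀ α ∈ R, α ≠ 0) (hk : ∀ α ∈ R, 0 < k α)
    (hkinv : ∀ α ∈ R, ∀ β ∈ R, k (dunklReflect α β) = k β)
    (hm : m = d + ∑ α ∈ R, k α) (hm1 : 1 < m) (hq : Continuous q) (c : ℝ)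
    {ψ : E d → ℝ} (hψ : ContDiff ℝ (⊤ : ℕ∞) ψ) (hc : HasCompactSupport ψ) :
    ∫ x, radialSol m q c ‖x‖ * dunklLap R k ψ x * wk R k x
      = ∫ x, q ‖x‖ * ψ x * wk R k x := by
  have hA : Continuous (radialMean m q) := continuous_radialMean hm1 hq
  have h := integral_mul_dunklLap hRrefl hR0 hk hkinv
    (D := fun i x => radialMean m q ‖x‖ + (q ‖x‖ - m * radialMean m q ‖x‖) / ‖x‖ ^ 2 * (x i * x i))
    (hasFDerivAt_radialSol_norm hm1 hq c) (hasFDerivAt_radialMean_smul hm1 hq)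
    (hA.comp continuous_norm) ?_ ?_ ?_ hψ hc
  · rw [h]
    refine integral_congr_ae (Eventually.of_forall fun x => ?_)
    simp only
    congr 2
    rw [Finset.sum_add_distrib, ← Finset.mul_sum]
    have h2 : ∑ i, x i * x i = ‖x‖ ^ 2 := by
      rw [EuclideanSpace.real_norm_sq_eq]
      exact Finset.sum_congr rfl fun i _ => (sq _).symm
    rw [h2]
    by_cases hx : x = 0
    · subst hx
      have : m ≠ 0 := by linarith
      simp [radialMean_zero hm1]
      rw [← add_mul, ← hm]
      field_simp
    · have hx' : ‖x‖ ≠ 0 := norm_ne_zero_iff.2 hx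
      rw [div_mul_cancel₀ _ (pow_ne_zero 2 hx')]
      simp [hm]
      ring
  · intro i x
    simp [EuclideanSpace.inner_single_right]
  · intro i
    refine (hA.comp continuous_norm).add ?_
    rw [continuous_iff_continuousAt]
    intro x
    by_cases hx : x = 0
    · subst hx
      have hb : Tendsto (fun x : E d => |q ‖x‖ - m * radialMean m q ‖x‖|) (𝓝 0) (𝓝 0) := by
        have : Continuous fun x : E d => |q ‖x‖ - m * radialMean m q ‖x‖| := by fun_prop
        have h0 := this.tendsto 0
        have hm0 : m ≠ 0 := by linarith
        simpa [radialMean_zero hm1, mul_div_cancel₀ _ hm0] using h0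
      rw [ContinuousAt]
      have h0 : (q ‖(0 : E d)‖ - m * radialMean m q ‖(0 : E d)‖) / ‖(0 : E d)‖ ^ 2 *
          ((0 : E d) i * (0 : E d) i) = 0 := by simp
      rw [h0]
      refine squeeze_zero_norm (fun x => ?_) hb
      rw [Real.norm_eq_abs, abs_mul, abs_div, abs_of_nonneg (sq_nonneg ‖x‖), div_mul_eq_mul_div]
      refine div_le_of_le_mul₀ (by positivity) (abs_nonneg _) ?_
      gcongr
      rw [← sq, abs_of_nonneg (sq_nonneg _), ← sq_abs]
      gcongr
      exact PiLp.norm_apply_le x i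
    · have hx' : ‖x‖ ^ 2 ≠ 0 := pow_ne_zero 2 (norm_ne_zero_iff.2 hx)
      have h1 : Continuous fun x : E d => q ‖x‖ - m * radialMean m q ‖x‖ := by fun_prop
      have h2 : Continuous fun x : E d => ‖x‖ ^ 2 := by fun_prop
      have h3 : Continuous fun x : E d => x i * x i := by fun_prop
      exact (h1.continuousAt.div h2.continuousAt hx').mul h3.continuousAt
  · intro α _ x
    simp [norm_dunklReflect]

end Radial

section RadialODE

variable {m : ℝ} {q : ℝ → ℝ}

lemma radialMean_nonneg (hq0 : ∀ t, 0 ≤ q t) (t : ℝ) : 0 ≤ radialMean m q t :=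
  intervalIntegral.integral_nonneg zero_le_one fun _ hτ =>
    mul_nonneg (Real.rpow_nonneg hτ.1 _) (hq0 _)

lemma monotoneOn_radialSol (hm : 1 < m) (hq : Continuous q) (hq0 : ∀ t, 0 ≤ q t) (c : ℝ) :
    MonotoneOn (radialSol m q c) (Set.Ici 0) := by
  refine monotoneOn_of_deriv_nonneg (convex_Ici 0) (continuous_radialSol hm hq c).continuousOn
    (fun x _ => (hasDerivAt_radialSol hm hq c x).differentiableAt.differentiableWithinAt)
    fun x hx => ?_
  rw [interior_Ici] at hx
  rw [(hasDerivAt_radialSol hm hq c x).deriv]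
  exact mul_nonneg (le_of_lt hx) (radialMean_nonneg hq0 _)

lemma abs_radialMean_sub_le (hm : 1 < m) {q₁ q₂ : ℝ → ℝ} (hq₁ : Continuous q₁)
    (hq₂ : Continuous q₂) {t B : ℝ} (ht : 0 ≤ t)
    (h : ∀ s ∈ Set.Icc 0 t, |q₁ s - q₂ s| ≤ B) :
    |radialMean m q₁ t - radialMean m q₂ t| ≤ B := by
  have hp : Continuous fun τ : ℝ => τ ^ (m - 1) := Real.continuous_rpow_const (by linarith)
  have h1 : ∀ q : ℝ → ℝ, Continuous q →
      IntervalIntegrable (fun τ => τ ^ (m - 1) * q (t * τ)) volume 0 1 := fun q hq =>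
    (hp.mul (hq.comp (continuous_const.mul continuous_id))).intervalIntegrable _ _
  rw [radialMean, radialMean, ← intervalIntegral.integral_sub (h1 _ hq₁) (h1 _ hq₂)]
  have h2 := intervalIntegral.norm_integral_le_of_norm_le_const (a := (0:ℝ)) (b := 1) (C := B)
    (f := fun τ => τ ^ (m - 1) * q₁ (t * τ) - τ ^ (m - 1) * q₂ (t * τ)) fun τ hτ => ?_
  · simpa using h2
  · rw [Set.uIoc_of_le zero_le_one] at hτ
    rw [← mul_sub, norm_mul, Real.norm_eq_abs, Real.norm_eq_abs,
      abs_of_nonneg (Real.rpow_nonneg hτ.1.le _)]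
    have h3 := h (t * τ) ⟨mul_nonneg ht hτ.1.le, mul_le_of_le_one_right ht hτ.2⟩
    exact (mul_le_of_le_one_left (abs_nonneg _)
      (Real.rpow_le_one hτ.1.le hτ.2 (by linarith))).trans h3

lemma abs_radialSol_sub_le (hm : 1 < m) {q₁ q₂ : ℝ → ℝ} (hq₁ : Continuous q₁)
    (hq₂ : Continuous q₂) (c₁ c₂ : ℝ) {r M l : ℝ} (hM : 0 ≤ M) (hl : 0 < l)
    (h : ∀ s ∈ Set.Icc 0 r, |q₁ s - q₂ s| ≤ M * Real.exp (l * s)) {ρ : ℝ} (hρ : ρ ∈ Set.Icc 0 r) :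
    |radialSol m q₁ c₁ ρ - radialSol m q₂ c₂ ρ|
      ≤ |c₁ - c₂| + r * M / l * Real.exp (l * ρ) := by
  have hr : 0 ≤ r := hρ.1.trans hρ.2
  have hB : ∀ x, HasDerivAt (fun ρ => |c₁ - c₂| + r * M / l * Real.exp (l * ρ))
      (r * M * Real.exp (l * x)) x := fun x => by
    have h1 : HasDerivAt (fun ρ : ℝ => l * ρ) l x := by
      simpa using (hasDerivAt_id x).const_mul l
    refine ((h1.exp.const_mul _).const_add _).congr_deriv ?_
    field_simp
  have hd := fun x => (hasDerivAt_radialSol hm hq₁ c₁ x).sub (hasDerivAt_radialSol hm hq₂ c₂ x)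
  refine image_norm_le_of_norm_deriv_right_le_deriv_boundary
    (f := fun ρ => radialSol m q₁ c₁ ρ - radialSol m q₂ c₂ ρ)
    ((continuous_radialSol hm hq₁ c₁).sub (continuous_radialSol hm hq₂ c₂)).continuousOn
    (fun x _ => (hd x).hasDerivWithinAt) ?_ hB (fun x hx => ?_) hρ
  · simp only [radialSol_zero, Real.norm_eq_abs]
    have : 0 ≤ r * M / l * Real.exp (l * 0) := by positivity
    linarith
  · rw [← mul_sub, norm_mul, Real.norm_eq_abs, Real.norm_eq_abs, abs_of_nonneg hx.1, mul_assoc]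
    refine mul_le_mul hx.2.le (abs_radialMean_sub_le hm hq₁ hq₂ hx.1 fun s hs => ?_)
      (abs_nonneg _) hr
    refine (h s ⟨hs.1, hs.2.trans hx.2.le⟩).trans ?_
    have := hs.2
    gcongr

variable {φ : ℝ → ℝ}

lemma exists_lipschitz_truncation
    (hφnonneg : ∀ t : ℝ, 0 ≤ t → 0 ≤ φ t)
    (hφlip : LocallyLipschitzOn (Set.Ici 0) φ) {n : ℝ} (hn : 0 < n) :
    ∃ (f : ℝ → ℝ) (K : NNReal), LipschitzWith K f ∧ (∀ s, 0 ≤ f s) ∧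
      ∀ s ∈ Set.Icc 0 n, f s = φ s := by
  obtain ⟨K, hK⟩ := (hφlip.mono Set.Icc_subset_Ici_self).exists_lipschitzOnWith_of_compact
    (isCompact_Icc (a := (0:ℝ)) (b := n))
  refine ⟨fun s => φ (Set.projIcc 0 n hn.le s), K, ?_, fun s => hφnonneg _ (Set.projIcc 0 n hn.le s).2.1,
    fun s hs => by simp only [Set.projIcc_of_mem hn.le hs]⟩
  have h1 := hK.to_restrict.comp (LipschitzWith.projIcc hn.le)
  rw [mul_one] at h1
  exact h1

/-- The map whose fixed points are the weighted solutions of the radial equation. -/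
def radialMap {m r : ℝ} (hm : 1 < m) (hr : 0 ≤ r) {f : ℝ → ℝ} (hf : Continuous f) (l c : ℝ)
    (y : C(Set.Icc (0:ℝ) r, ℝ)) : C(Set.Icc (0:ℝ) r, ℝ) where
  toFun ρ := Real.exp (-(l * ρ)) * radialSol m
    (fun s => f (Real.exp (l * (Set.projIcc 0 r hr s : ℝ)) * y (Set.projIcc 0 r hr s))) c ρ
  continuous_toFun := by
    have h1 : Continuous fun s =>
        f (Real.exp (l * (Set.projIcc 0 r hr s : ℝ)) * y (Set.projIcc 0 r hr s)) := by
      have := continuous_projIcc (h := hr)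
      fun_prop
    have h2 := continuous_radialSol hm h1 c
    fun_prop

lemma dist_radialMap_le {r : ℝ} (hm : 1 < m) (hr : 0 ≤ r) {f : ℝ → ℝ} {K : NNReal}
    (hf : LipschitzWith K f) {l : ℝ} (hl : 0 < l) (c₁ c₂ : ℝ)
    (y₁ y₂ : C(Set.Icc (0:ℝ) r, ℝ)) :
    dist (radialMap hm hr hf.continuous l c₁ y₁) (radialMap hm hr hf.continuous l c₂ y₂)
      ≤ |c₁ - c₂| + r * K / l * dist y₁ y₂ := by
  rw [ContinuousMap.dist_le (by positivity)]
  intro ρ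
  have hcont : ∀ y : C(Set.Icc (0:ℝ) r, ℝ), Continuous fun s =>
      f (Real.exp (l * (Set.projIcc 0 r hr s : ℝ)) * y (Set.projIcc 0 r hr s)) := fun y => by
    have := continuous_projIcc (h := hr)
    have := hf.continuous
    fun_prop
  have h := abs_radialSol_sub_le hm (hcont y₁) (hcont y₂) c₁ c₂ (r := r) (M := K * dist y₁ y₂)
    (by positivity) hl (fun s hs => ?_) ρ.2
  · rw [Real.dist_eq]
    simp only [radialMap, ContinuousMap.coe_mk]
    rw [← mul_sub, abs_mul, abs_of_pos (Real.exp_pos _)]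
    have he : Real.exp (-(l * ρ)) ≤ 1 := Real.exp_le_one_iff.2 (by
      have := mul_nonneg hl.le ρ.2.1
      linarith)
    calc _ ≤ Real.exp (-(l * ρ)) * (|c₁ - c₂| + r * (K * dist y₁ y₂) / l * Real.exp (l * ρ)) := by
          gcongr
      _ = Real.exp (-(l * ρ)) * |c₁ - c₂| + r * K / l * dist y₁ y₂ := by
          rw [Real.exp_neg]
          field_simp
      _ ≤ _ := by
          gcongr
          exact mul_le_of_le_one_left (abs_nonneg _) he
  · have h1 := hf.dist_le_mul (Real.exp (l * (Set.projIcc 0 r hr s : ℝ)) * y₁ (Set.projIcc 0 r hr s))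
      (Real.exp (l * (Set.projIcc 0 r hr s : ℝ)) * y₂ (Set.projIcc 0 r hr s))
    rw [Real.dist_eq, Real.dist_eq, ← mul_sub, abs_mul, abs_of_pos (Real.exp_pos _)] at h1
    refine h1.trans ?_
    rw [Set.projIcc_of_mem hr hs, mul_assoc, mul_comm (dist y₁ y₂)]
    gcongr
    rw [← Real.dist_eq]
    exact ContinuousMap.dist_apply_le_dist _

/-- Solvability of the radial problem with prescribed boundary value `n` at `r`. -/
theorem exists_radialSol_eq {r : ℝ} (hm : 1 < m) (hr : 0 < r) (hφ0 : φ 0 = 0)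
    (hφnonneg : ∀ t : ℝ, 0 ≤ t → 0 ≤ φ t)
    (hφlip : LocallyLipschitzOn (Set.Ici 0) φ) {n : ℝ} (hn : 0 < n) :
    ∃ (q : ℝ → ℝ) (c : ℝ), Continuous q ∧ (∀ t, 0 ≤ q t) ∧ 0 ≤ c ∧ radialSol m q c r = n ∧
      ∀ ρ ∈ Set.Icc 0 r, q ρ = φ (radialSol m q c ρ) := by
  obtain ⟨f, K, hfK, hf0, hfφ⟩ := exists_lipschitz_truncation hφnonneg hφlip hn
  set l : ℝ := 2 * r * K + 1 with hl
  have hl0 : 0 < l := by positivity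
  have hfc := hfK.continuous
  set T := radialMap hm hr.le hfc l with hT
  have hcontr : ∀ c, ContractingWith (2⁻¹ : NNReal) (T c) := fun c => by
    refine ⟨by rw [inv_lt_one_iff₀]; norm_num, LipschitzWith.of_dist_le_mul fun y₁ y₂ => ?_⟩
    refine (dist_radialMap_le hm hr.le hfK hl0 c c y₁ y₂).trans ?_
    rw [sub_self, abs_zero, zero_add]
    gcongr
    rw [div_le_iff₀ hl0]
    push_cast
    rw [hl]
    linarith
  set y : ℝ → C(Set.Icc (0:ℝ) r, ℝ) := fun c => (hcontr c).fixedPoint (T c) with hy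
  have hfix : ∀ c, T c (y c) = y c := fun c => (hcontr c).fixedPoint_isFixedPt
  have hyc : Continuous y := by
    have : ∀ c₁ c₂, dist (y c₁) (y c₂) ≤ 2 * dist c₁ c₂ := by
      intro c₁ c₂
      have h1 := dist_radialMap_le hm hr.le hfK hl0 c₁ c₂ (y c₁) (y c₂)
      rw [← hT, hfix, hfix] at h1
      have h2 : r * K / l ≤ 2⁻¹ := by
        rw [div_le_iff₀ hl0, hl]; linarith
      have h3 := mul_le_mul_of_nonneg_right h2 (dist_nonneg (x := y c₁) (y := y c₂))
      rw [Real.dist_eq]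
      linarith
    exact (LipschitzWith.of_dist_le_mul (K := 2) this).continuous
  set Q : ℝ → ℝ → ℝ := fun c s => f (Real.exp (l * (Set.projIcc 0 r hr.le s : ℝ)) *
    y c (Set.projIcc 0 r hr.le s)) with hQ
  have hQc : ∀ c, Continuous (Q c) := fun c => by
    have := continuous_projIcc (h := hr.le)
    simp only [hQ]
    fun_prop
  have hval : ∀ c, ∀ ρ (hρ : ρ ∈ Set.Icc 0 r),
      radialSol m (Q c) c ρ = Real.exp (l * ρ) * y c ⟨ρ, hρ⟩ := fun c ρ hρ => by
    have h1 := DFunLike.congr_fun (hfix c) ⟨ρ, hρ⟩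
    rw [← h1]
    simp only [hT, radialMap, ContinuousMap.coe_mk]
    rw [← mul_assoc, ← Real.exp_add]
    simp [hQ]
  have hQv : ∀ c, ∀ ρ ∈ Set.Icc 0 r, Q c ρ = f (radialSol m (Q c) c ρ) := fun c ρ hρ => by
    rw [hval c ρ hρ]
    simp only [hQ, Set.projIcc_of_mem hr.le hρ]
  have hQ0 : ∀ c t, 0 ≤ Q c t := fun c t => hf0 _
  have hrmem : r ∈ Set.Icc 0 r := ⟨hr.le, le_rfl⟩
  have hendc : Continuous fun c => radialSol m (Q c) c r := by
    simp_rw [fun c => hval c r hrmem]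
    have : Continuous fun c => y c ⟨r, hrmem⟩ := (continuous_eval_const (⟨r, hrmem⟩ : Set.Icc (0:ℝ) r)).comp hyc
    fun_prop
  have hy0 : y 0 = 0 := by
    refine ((hcontr 0).fixedPoint_unique (x := 0) ?_).symm
    ext ρ
    have : f 0 = 0 := by rw [hfφ 0 ⟨le_rfl, hn.le⟩, hφ0]
    simp [hT, radialMap, this, radialSol, radialMean]
  have hend0 : radialSol m (Q 0) 0 r = 0 := by rw [hval 0 r hrmem, hy0]; simp
  have hendn : n ≤ radialSol m (Q n) n r := by
    have := monotoneOn_radialSol hm (hQc n) (hQ0 n) n (Set.mem_Ici.2 le_rfl) hr.le hr.le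
    rwa [radialSol_zero] at this
  obtain ⟨c, hc, hcn⟩ := intermediate_value_Icc hn.le hendc.continuousOn
    (show n ∈ Set.Icc (radialSol m (Q 0) 0 r) (radialSol m (Q n) n r) from
      ⟨by rw [hend0]; exact hn.le, hendn⟩)
  refine ⟨Q c, c, hQc c, hQ0 c, hc.1, hcn, fun ρ hρ => ?_⟩
  have hmono := monotoneOn_radialSol hm (hQc c) (hQ0 c) c
  rw [hQv c ρ hρ]
  refine hfφ _ ⟨?_, ?_⟩
  · have := hmono (Set.mem_Ici.2 le_rfl) hρ.1 hρ.1
    rw [radialSol_zero] at this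
    exact hc.1.trans this
  · rw [← hcn]
    exact hmono hρ.1 hr.le hρ.2

end RadialODE

section RadialTest

variable {d : ℕ} {g : ℝ → ℝ} {a b : ℝ}

/-- The radial function about `x₀` whose profile has derivative `-g` in the squared distance. -/
def radialTest (g : ℝ → ℝ) (b : ℝ) (x₀ x : E d) : ℝ := ∫ s in (‖x - x₀‖ ^ 2)..b, g s

lemma hasDerivAt_integral_left (hg : ContinuousOn g (Set.Ioi a)) (hb : a < b) {σ : ℝ}
    (hσ : a < σ) : HasDerivAt (fun σ => ∫ s in σ..b, g s) (-g σ) σ := by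
  refine intervalIntegral.integral_hasDerivAt_left ?_ ?_ (hg.continuousAt (Ioi_mem_nhds hσ))
  · refine (hg.mono fun s hs => ?_).intervalIntegrable
    rw [Set.mem_uIcc] at hs
    rcases hs with hs | hs
    · exact lt_of_lt_of_le hσ hs.1
    · exact lt_of_lt_of_le hb hs.1
  · exact hg.stronglyMeasurableAtFilter isOpen_Ioi σ hσ

lemma contDiff_radialTest (hg : ContDiffOn ℝ (⊤ : ℕ∞) g (Set.Ioi a)) (ha : a < 0) (hb : a < b)
    (x₀ : E d) : ContDiff ℝ (⊤ : ℕ∞) (radialTest g b x₀) := by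
  have h1 : ContDiffOn ℝ (⊤ : ℕ∞) (fun σ => ∫ s in σ..b, g s) (Set.Ioi a) := by
    rw [contDiffOn_infty_iff_deriv_of_isOpen isOpen_Ioi]
    have hd := fun σ (hσ : σ ∈ Set.Ioi a) => hasDerivAt_integral_left hg.continuousOn hb hσ
    exact ⟨fun σ hσ => (hd σ hσ).differentiableAt.differentiableWithinAt,
      hg.neg.congr fun σ hσ => (hd σ hσ).deriv⟩
  have h2 : ContDiff ℝ (⊤ : ℕ∞) fun x : E d => ‖x - x₀‖ ^ 2 :=
    (contDiff_id.sub contDiff_const).norm_sq ℝ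
  rw [← contDiffOn_univ]
  exact h1.comp h2.contDiffOn fun x _ => lt_of_lt_of_le ha (sq_nonneg ‖x - x₀‖)

lemma hasFDerivAt_norm_sub_sq (x₀ x : E d) :
    HasFDerivAt (fun x : E d => ‖x - x₀‖ ^ 2) (2 • innerSL ℝ (x - x₀)) x := by
  have := (hasStrictFDerivAt_norm_sq (x - x₀)).hasFDerivAt.comp x
    ((hasFDerivAt_id x).sub_const x₀)
  rw [ContinuousLinearMap.comp_id] at this
  exact this

lemma fderiv_radialTest (hg : ContinuousOn g (Set.Ioi a)) (ha : a < 0) (hb : a < b)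
    (x₀ x : E d) :
    fderiv ℝ (radialTest g b x₀) x = (-2 * g (‖x - x₀‖ ^ 2)) • innerSL ℝ (x - x₀) := by
  have h := ((hasDerivAt_integral_left hg hb
    (lt_of_lt_of_le ha (sq_nonneg ‖x - x₀‖))).comp_hasFDerivAt x (hasFDerivAt_norm_sub_sq x₀ x))
  refine h.fderiv.trans ?_
  ext v
  simp
  ring

lemma lap_radialTest (hg : ContinuousOn g (Set.Ioi a)) (ha : a < 0) (hb : a < b)
    (x₀ x : E d) {g' : ℝ} (hg' : HasDerivAt g g' (‖x - x₀‖ ^ 2)) :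
    lap (radialTest g b x₀) x = -4 * ‖x - x₀‖ ^ 2 * g' - 2 * d * g (‖x - x₀‖ ^ 2) := by
  have h0 : fderiv ℝ (radialTest g b x₀) = fun x => (-2 * g (‖x - x₀‖ ^ 2)) • innerSL ℝ (x - x₀) :=
    funext fun x => fderiv_radialTest hg ha hb x₀ x
  have h1 : HasFDerivAt (fun x : E d => innerSL ℝ (x - x₀)) (innerSL ℝ : E d →L[ℝ] _) x :=
    (innerSL ℝ : E d →L[ℝ] _).hasFDerivAt.comp x ((hasFDerivAt_id x).sub_const x₀)
  have h2 := ((hg'.comp_hasFDerivAt x (hasFDerivAt_norm_sub_sq x₀ x)).const_mul (-2)).smul h1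
  rw [lap_eq_sum_fderiv, h0]
  have h3 := HasFDerivAt.fderiv h2
  have h4 : ∀ i, fderiv ℝ (fun x => (-2 * g (‖x - x₀‖ ^ 2)) • innerSL ℝ (x - x₀)) x
      (EuclideanSpace.single i 1) (EuclideanSpace.single i 1)
      = -2 * g (‖x - x₀‖ ^ 2) - 4 * g' * ((x - x₀) i) ^ 2 := by
    intro i
    refine (congrArg (fun L => L (EuclideanSpace.single i 1) (EuclideanSpace.single i 1)) h3).trans
      ?_
    have h5 : innerSL ℝ (EuclideanSpace.single i (1 : ℝ)) (EuclideanSpace.single i (1 : ℝ)) =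
        (1 : ℝ) := by rw [innerSL_apply_apply]; simp
    simp [EuclideanSpace.inner_single_right, h5]
    ring
  have h6 : ∑ i, 4 * g' * ((x - x₀) i) ^ 2 = 4 * g' * ‖x - x₀‖ ^ 2 := by
    rw [← Finset.mul_sum, ← EuclideanSpace.real_norm_sq_eq]
  simp_rw [h4]
  rw [Finset.sum_sub_distrib, h6]
  simp
  ring

end RadialTest

section Profile

/-- The profile `z ↦ z ^ (-μ / 2) exp (-C √z)`. -/
def expPow (μ C z : ℝ) : ℝ := z ^ (-(μ / 2)) * Real.exp (-(C * √z))

/-- The derivative profile of the test functions used in the comparison principle. -/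
def testDensity (μ C r θ σ : ℝ) : ℝ :=
  expPow μ C (σ + θ ^ 2) * Real.smoothTransition (1 - σ / r ^ 2)

variable {μ C r θ : ℝ}

lemma contDiffOn_expPow : ContDiffOn ℝ (⊤ : ℕ∞) (expPow μ C) (Set.Ioi 0) := by
  intro z hz
  have hz' : z ≠ 0 := ne_of_gt hz
  refine ContDiffAt.contDiffWithinAt ?_
  exact (Real.contDiffAt_rpow_const_of_ne hz').mul
    ((contDiffAt_const.mul (Real.contDiffAt_sqrt hz')).neg.exp)

lemma expPow_pos {z : ℝ} (hz : 0 < z) : 0 < expPow μ C z :=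
  mul_pos (Real.rpow_pos_of_pos hz _) (Real.exp_pos _)

lemma expPow_le (hC : 0 ≤ C) {z : ℝ} (hz : 0 < z) : expPow μ C z ≤ z ^ (-(μ / 2)) :=
  mul_le_of_le_one_right (Real.rpow_nonneg hz.le _)
    (Real.exp_le_one_iff.2 (neg_nonpos.2 (mul_nonneg hC (Real.sqrt_nonneg _))))

lemma expPow_anti (hμ : 0 ≤ μ) (hC : 0 ≤ C) {z w : ℝ} (hz : 0 < z) (h : z ≤ w) :
    expPow μ C w ≤ expPow μ C z := by
  unfold expPow
  refine mul_le_mul (Real.rpow_le_rpow_of_nonpos hz h (by linarith)) ?_ (Real.exp_pos _).le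
    (Real.rpow_nonneg hz.le _)
  gcongr

lemma hasDerivAt_expPow {z : ℝ} (hz : 0 < z) :
    HasDerivAt (expPow μ C) (-(expPow μ C z * (μ + C * √z) / (2 * z))) z := by
  have h1 := Real.hasDerivAt_rpow_const (p := -(μ / 2)) (Or.inl hz.ne')
  have h2 := ((Real.hasDerivAt_sqrt hz.ne').const_mul C).neg.exp
  refine (h1.mul h2).congr_deriv ?_
  rw [expPow, Real.rpow_sub_one hz.ne']
  have hs : 0 < √z := Real.sqrt_pos.2 hz
  have : z = √z * √z := (Real.mul_self_sqrt hz.le).symm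
  simp only [Pi.neg_apply]
  field_simp
  have h3 : √z ^ 2 = z := Real.sq_sqrt hz.le
  linear_combination C * h3

lemma contDiffOn_testDensity :
    ContDiffOn ℝ (⊤ : ℕ∞) (testDensity μ C r θ) (Set.Ioi (-θ ^ 2)) := by
  have h1 : ContDiffOn ℝ (⊤ : ℕ∞) (fun σ => expPow μ C (σ + θ ^ 2)) (Set.Ioi (-θ ^ 2)) :=
    contDiffOn_expPow.comp (contDiff_id.add contDiff_const).contDiffOn fun σ hσ => by
      simp only [Set.mem_Ioi] at hσ ⊢
      linarith
  have h2 : ContDiff ℝ (⊤ : ℕ∞) fun σ : ℝ => Real.smoothTransition (1 - σ / r ^ 2) :=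
    Real.smoothTransition.contDiff.comp (contDiff_const.sub (contDiff_id.div_const _))
  exact h1.mul h2.contDiffOn

lemma testDensity_nonneg {σ : ℝ} (hσ : 0 < σ + θ ^ 2) : 0 ≤ testDensity μ C r θ σ :=
  mul_nonneg (expPow_pos hσ).le (Real.smoothTransition.nonneg _)

lemma testDensity_eq_zero (hr : 0 < r) {σ : ℝ} (hσ : r ^ 2 ≤ σ) : testDensity μ C r θ σ = 0 := by
  rw [testDensity, Real.smoothTransition.zero_of_nonpos, mul_zero]
  have : 1 ≤ σ / r ^ 2 := (one_le_div (by positivity)).2 hσ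
  linarith

lemma testDensity_pos (hr : 0 < r) {σ : ℝ} (h0 : 0 < σ + θ ^ 2) (hσ : σ < r ^ 2) :
    0 < testDensity μ C r θ σ := by
  refine mul_pos (expPow_pos h0) (Real.smoothTransition.pos_of_pos ?_)
  have : σ / r ^ 2 < 1 := (div_lt_one (by positivity)).2 hσ
  linarith

/-- The derivative of the density is bounded above by that of its singular factor. -/
lemma exists_hasDerivAt_testDensity_le {σ : ℝ} (h0 : 0 < σ + θ ^ 2) :
    ∃ g', HasDerivAt (testDensity μ C r θ) g' σ ∧
      g' ≤ -(testDensity μ C r θ σ * (μ + C * √(σ + θ ^ 2)) / (2 * (σ + θ ^ 2))) := by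
  have hT : Differentiable ℝ Real.smoothTransition :=
    (Real.smoothTransition.contDiff (n := 1)).differentiable (by simp)
  have h1 : HasDerivAt (fun σ => expPow μ C (σ + θ ^ 2)) _ σ :=
    (hasDerivAt_expPow h0).comp_add_const σ (θ ^ 2)
  have h2 : HasDerivAt (fun σ : ℝ => 1 - σ / r ^ 2) (-(1 / r ^ 2)) σ :=
    ((hasDerivAt_id σ).div_const _).const_sub 1
  have h3 := h1.mul ((hT (1 - σ / r ^ 2)).hasDerivAt.comp σ h2)
  refine ⟨_, h3, ?_⟩
  have h4 : 0 ≤ deriv Real.smoothTransition (1 - σ / r ^ 2) :=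
    Real.smoothTransition.monotone.deriv_nonneg
  have h5 := expPow_pos (μ := μ) (C := C) h0
  have h6 : 0 ≤ expPow μ C (σ + θ ^ 2) *
      (deriv Real.smoothTransition (1 - σ / r ^ 2) * (1 / r ^ 2)) := by positivity
  have h7 : testDensity μ C r θ σ * (μ + C * √(σ + θ ^ 2)) / (2 * (σ + θ ^ 2))
    = expPow μ C (σ + θ ^ 2) * (μ + C * √(σ + θ ^ 2)) / (2 * (σ + θ ^ 2)) *
      Real.smoothTransition (1 - σ / r ^ 2) := by rw [testDensity]; ring
  rw [h7]
  simp only [Function.comp]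
  linarith

end Profile

section LocalBounds

variable {d : ℕ} {R : Finset (E d)} {k : E d → ℝ}

lemma wk_pos_of_inner_ne_zero {x : E d} (h : ∀ α ∈ R, ⟪α, x⟫ ≠ 0) : 0 < wk R k x :=
  Finset.prod_pos fun α hα => Real.rpow_pos_of_pos
    (abs_pos.2 (by rw [real_inner_comm]; exact h α hα)) _

lemma dense_wk_pos (hR0 : ∀ α ∈ R, α ≠ 0) : Dense {x : E d | 0 < wk R k x} := by
  refine Measure.dense_of_ae (μ := volume) ?_
  have h : ∀ᵐ x : E d, ∀ α ∈ R, ⟪α, x⟫ ≠ 0 := by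
    rw [Filter.eventually_all_finset]
    intro α hα
    have h1 : (ℝ ∙ α)ᗮ ≠ ⊤ := by
      intro h
      have : α ∈ (ℝ ∙ α)ᗮ := h ▸ Submodule.mem_top
      rw [Submodule.mem_orthogonal_singleton_iff_inner_right, inner_self_eq_zero] at this
      exact hR0 α hα this
    have h2 := Measure.addHaar_submodule (volume : Measure (E d)) _ h1
    rw [ae_iff]
    refine measure_mono_null (fun x hx => ?_) h2
    rw [SetLike.mem_coe, Submodule.mem_orthogonal_singleton_iff_inner_right]
    simpa using hx
  filter_upwards [h] with x hx using wk_pos_of_inner_ne_zero hx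

open Classical in
/-- The multiplicity restricted to the roots orthogonal to `x₀`. -/
def stabMult (k : E d → ℝ) (x₀ α : E d) : ℝ := if ⟪α, x₀⟫ = 0 then k α else 0

lemma stabMult_nonneg (hk : ∀ α ∈ R, 0 < k α) (x₀ : E d) : ∀ α ∈ R, 0 ≤ stabMult k x₀ α := by
  intro α hα
  unfold stabMult
  split_ifs
  exacts [(hk α hα).le, le_rfl]

lemma exists_wk_le_rpow (hk : ∀ α ∈ R, 0 < k α) (x₀ : E d) (ρ : ℝ) (hρ : 0 ≤ ρ) :
    ∃ D, 0 ≤ D ∧ ∀ x, ‖x - x₀‖ ≤ ρ →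
      wk R k x ≤ D * ‖x - x₀‖ ^ (∑ α ∈ R, stabMult k x₀ α) := by
  classical
  let B : E d → ℝ := fun α => if ⟪α, x₀⟫ = 0 then ‖α‖ ^ k α else ((‖x₀‖ + ρ) * ‖α‖) ^ k α
  have hB : ∀ α, 0 ≤ B α := by
    intro α
    dsimp only [B]
    split_ifs <;> positivity
  refine ⟨∏ α ∈ R, B α, Finset.prod_nonneg fun α _ => hB α, fun x hx => ?_⟩
  rw [Real.rpow_sum_of_nonneg (norm_nonneg _) (stabMult_nonneg hk x₀), ← Finset.prod_mul_distrib]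
  refine Finset.prod_le_prod (fun α _ => Real.rpow_nonneg (abs_nonneg _) _) fun α hα => ?_
  dsimp only [B, stabMult]
  split_ifs with h
  · rw [← Real.mul_rpow (norm_nonneg _) (norm_nonneg _)]
    refine Real.rpow_le_rpow (abs_nonneg _) ?_ (hk α hα).le
    have h1 : ⟪x, α⟫ = ⟪α, x - x₀⟫ := by rw [inner_sub_right, h, sub_zero, real_inner_comm]
    rw [h1]
    exact abs_real_inner_le_norm _ _
  · rw [Real.rpow_zero, mul_one]
    refine Real.rpow_le_rpow (abs_nonneg _) ?_ (hk α hα).le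
    refine (abs_real_inner_le_norm _ _).trans ?_
    gcongr
    calc ‖x‖ = ‖x₀ + (x - x₀)‖ := by rw [add_sub_cancel]
      _ ≤ ‖x₀‖ + ‖x - x₀‖ := norm_add_le _ _
      _ ≤ _ := by gcongr

/-- Coefficient bounding the drift of the roots not orthogonal to `x₀`. -/
def driftBound (R : Finset (E d)) (k : E d → ℝ) (x₀ : E d) : ℝ :=
  ∑ α ∈ R, k α * (‖α‖ * (2 / |⟪α, x₀⟫|))

/-- Coefficient bounding the jumps of the roots not orthogonal to `x₀`. -/
def jumpBound (R : Finset (E d)) (k : E d → ℝ) (x₀ : E d) : ℝ :=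
  ∑ α ∈ R, k α * (‖α‖ ^ 2 / 2 * (2 / |⟪α, x₀⟫|) ^ 2)

lemma driftBound_nonneg (hk : ∀ α ∈ R, 0 < k α) (x₀ : E d) : 0 ≤ driftBound R k x₀ :=
  Finset.sum_nonneg fun α hα => mul_nonneg (hk α hα).le (by positivity)

lemma eventually_abs_inner_ge (R : Finset (E d)) (x₀ : E d) :
    ∀ᶠ x in 𝓝 x₀, ∀ α ∈ R, |⟪α, x₀⟫| / 2 ≤ |⟪α, x⟫| := by
  rw [Filter.eventually_all_finset]
  intro α _
  by_cases h : ⟪α, x₀⟫ = 0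
  · simp [h]
  · have hc : Continuous fun x : E d => |⟪α, x⟫| := by fun_prop
    have := (hc.tendsto x₀).eventually_const_lt (half_lt_self (abs_pos.2 h))
    filter_upwards [this] with x hx using hx.le

/-- Lower bound for the Dunkl Laplacian of a radial function about `x₀`, near `x₀`. -/
lemma dunklLap_radialTest_ge (hk : ∀ α ∈ R, 0 < k α) {g : ℝ → ℝ} {a b : ℝ}
    (hg : ContinuousOn g (Set.Ioi a)) (ha : a < 0) (hb : a < b) {x₀ x : E d} {g' : ℝ}
    (hg' : HasDerivAt g g' (‖x - x₀‖ ^ 2)) (hg0 : 0 ≤ g (‖x - x₀‖ ^ 2))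
    (hψ : ∀ y, 0 ≤ radialTest g b x₀ y) (hx : ∀ α ∈ R, |⟪α, x₀⟫| / 2 ≤ |⟪α, x⟫|)
    (hx0 : ∀ α ∈ R, ⟪α, x⟫ ≠ 0) :
    -4 * ‖x - x₀‖ ^ 2 * g' - 2 * (d + ∑ α ∈ R, stabMult k x₀ α + driftBound R k x₀ * ‖x - x₀‖)
      * g (‖x - x₀‖ ^ 2) - jumpBound R k x₀ * radialTest g b x₀ x
      ≤ dunklLap R k (radialTest g b x₀) x := by
  rw [dunklLap_eq, lap_radialTest hg ha hb x₀ x hg']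
  set G := g (‖x - x₀‖ ^ 2) with hG
  set ψ := radialTest g b x₀ with hψdef
  have key : ∀ α ∈ R, -2 * G * stabMult k x₀ α
      - 2 * G * (k α * (‖α‖ * (2 / |⟪α, x₀⟫|))) * ‖x - x₀‖
      - ψ x * (k α * (‖α‖ ^ 2 / 2 * (2 / |⟪α, x₀⟫|) ^ 2))
      ≤ k α * (dunklNum α ψ x / ⟪α, x⟫ ^ 2) := by
    intro α hα
    have hkα := (hk α hα).le
    have hne := hx0 α hα
    have hnum : dunklNum α ψ x / ⟪α, x⟫ ^ 2
        = -2 * G * (⟪α, x - x₀⟫ / ⟪α, x⟫)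
          - ‖α‖ ^ 2 / 2 * (ψ x - ψ (dunklReflect α x)) * (1 / ⟪α, x⟫) ^ 2 := by
      have hf : fderiv ℝ ψ x α = -2 * G * ⟪α, x - x₀⟫ := by
        rw [hψdef, fderiv_radialTest hg ha hb x₀ x, ← hG]
        rw [smul_apply, innerSL_apply_apply, smul_eq_mul,
          real_inner_comm]
      rw [dunklNum, hf]
      field_simp
    rw [hnum]
    by_cases h : ⟪α, x₀⟫ = 0
    · have h1 : ⟪α, x - x₀⟫ = ⟪α, x⟫ := by rw [inner_sub_right, h, sub_zero]
      have h2 : ψ (dunklReflect α x) = ψ x := by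
        have hr : dunklReflect α x₀ = x₀ := by simp [dunklReflect, h]
        have h3 : ‖dunklReflect α x - x₀‖ = ‖x - x₀‖ := by
          rw [← norm_dunklReflect α (x - x₀)]
          congr 1
          rw [dunklReflect, dunklReflect, h1]
          abel
        simp only [hψdef, radialTest, h3]
      have h3 : stabMult k x₀ α = k α := if_pos h
      rw [h1, h2, h3, div_self hne, h, abs_zero]
      simp
      linarith
    · have h3 : stabMult k x₀ α = 0 := if_neg h
      have hpos : 0 < |⟪α, x₀⟫| := abs_pos.2 h
      have h4 : 1 / |⟪α, x⟫| ≤ 2 / |⟪α, x₀⟫| := by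
        rw [div_le_div_iff₀ (abs_pos.2 hne) hpos]
        linarith [hx α hα]
      have h5 : ⟪α, x - x₀⟫ / ⟪α, x⟫ ≤ ‖α‖ * (2 / |⟪α, x₀⟫|) * ‖x - x₀‖ := by
        calc ⟪α, x - x₀⟫ / ⟪α, x⟫ ≤ |⟪α, x - x₀⟫ / ⟪α, x⟫| := le_abs_self _
          _ = |⟪α, x - x₀⟫| * (1 / |⟪α, x⟫|) := by rw [abs_div]; ring
          _ ≤ (‖α‖ * ‖x - x₀‖) * (2 / |⟪α, x₀⟫|) := by
            gcongr
            exact abs_real_inner_le_norm _ _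
          _ = _ := by ring
      have h6 : (1 / ⟪α, x⟫) ^ 2 ≤ (2 / |⟪α, x₀⟫|) ^ 2 := by
        rw [← sq_abs (1 / ⟪α, x⟫), abs_div, abs_one]
        gcongr
      have h7 : (ψ x - ψ (dunklReflect α x)) * (1 / ⟪α, x⟫) ^ 2
          ≤ ψ x * (2 / |⟪α, x₀⟫|) ^ 2 := by
        calc _ ≤ ψ x * (1 / ⟪α, x⟫) ^ 2 := by
              gcongr
              linarith [hψ (dunklReflect α x)]
          _ ≤ _ := by
              gcongr
              exact hψ x
      rw [h3]
      have h8 := mul_le_mul_of_nonneg_left h5 (mul_nonneg hkα hg0)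
      have h9 := mul_le_mul_of_nonneg_left h7 (mul_nonneg hkα (by positivity : 0 ≤ ‖α‖ ^ 2 / 2))
      linarith
  have hsum := Finset.sum_le_sum key
  simp only [Finset.sum_sub_distrib, ← Finset.mul_sum, ← Finset.sum_mul] at hsum
  rw [← driftBound, ← jumpBound] at hsum
  linarith

end LocalBounds

lemma pow_mul_one_add_sq_rpow_le (d : ℕ) {t : ℝ} (ht : 0 < t) :
    t ^ d * (1 + t ^ 2) ^ (-((d : ℝ) + 2) / 2) ≤ (t ^ 2)⁻¹ := by
  have hd : -((d : ℝ) + 2) / 2 ≤ 0 := by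
    have : (0 : ℝ) ≤ d := Nat.cast_nonneg d
    linarith
  have ht2 : 0 < t ^ 2 := pow_pos ht 2
  have h1 : (1 + t ^ 2) ^ (-((d : ℝ) + 2) / 2) ≤ (t ^ 2) ^ (-((d : ℝ) + 2) / 2) :=
    Real.rpow_le_rpow_of_nonpos ht2 (by linarith) hd
  have h2 : (t ^ 2) ^ (-((d : ℝ) + 2) / 2) = (t ^ (d + 2))⁻¹ := by
    rw [← Real.rpow_natCast t 2, ← Real.rpow_mul ht.le, ← Real.rpow_natCast,
      ← Real.rpow_neg ht.le]
    congr 1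
    push_cast
    ring
  rw [h2] at h1
  calc _ ≤ t ^ d * (t ^ (d + 2))⁻¹ := by gcongr
    _ = (t ^ 2)⁻¹ := by
      rw [pow_add]
      field_simp

lemma tendsto_integral_rpow_kernel {d : ℕ} {Q : E d → ℝ} {x₀ : E d} (hQ : Integrable Q)
    (hQc : ContinuousAt Q x₀) (hQ0 : Q x₀ = 0) :
    Tendsto (fun t : ℝ => ∫ x, t ^ d * (1 + ‖t • (x₀ - x)‖ ^ 2) ^ (-((d : ℝ) + 2) / 2) * Q x)
      atTop (𝓝 0) := by
  let f : E d → ℝ := fun x => (1 + ‖x‖ ^ 2) ^ (-((d : ℝ) + 2) / 2)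
  have hfx : ∀ x : E d, 0 < ‖x‖ → ‖x‖ ^ d * f x ≤ (‖x‖ ^ 2)⁻¹ := fun x hx =>
    pow_mul_one_add_sq_rpow_le d hx
  have hfpos : ∀ x, 0 < f x := fun x => Real.rpow_pos_of_pos (by positivity) _
  have hfc : Continuous f := by
    refine Continuous.rpow_const (by fun_prop) fun x => Or.inl (by positivity)
  have hfi : Integrable f := integrable_rpow_neg_one_add_norm_sq (by simp)
  set Z := ∫ x, f x with hZdef
  have hZ : 0 < Z := integral_pos_of_integrable_nonneg_nonzero (x := 0) hfc hfi
    (fun x => (hfpos x).le) (hfpos 0).ne'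
  have hdecay : Tendsto (fun x : E d => ‖x‖ ^ d * (f x / Z)) (Bornology.cobounded (E d)) (𝓝 0) := by
    have h1 : Tendsto (fun x : E d => Z⁻¹ * (‖x‖ ^ 2)⁻¹) (Bornology.cobounded (E d)) (𝓝 0) := by
      rw [← mul_zero Z⁻¹]
      refine Tendsto.const_mul _ (Tendsto.inv_tendsto_atTop ?_)
      exact (tendsto_pow_atTop two_ne_zero).comp tendsto_norm_cobounded_atTop
    refine tendsto_of_tendsto_of_tendsto_of_le_of_le' tendsto_const_nhds h1
      (Eventually.of_forall fun x => mul_nonneg (by positivity)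
        (div_nonneg (hfpos x).le hZ.le)) ?_
    filter_upwards [tendsto_norm_cobounded_atTop.eventually_gt_atTop 0] with x hx
    calc ‖x‖ ^ d * (f x / Z) = Z⁻¹ * (‖x‖ ^ d * f x) := by ring
      _ ≤ Z⁻¹ * (‖x‖ ^ 2)⁻¹ := by
        exact mul_le_mul_of_nonneg_left (hfx x hx) (inv_nonneg.2 hZ.le)
  have h := tendsto_integral_comp_smul_smul_of_integrable' (μ := (volume : Measure (E d)))
    (φ := fun x => f x / Z) (fun x => div_nonneg (hfpos x).le hZ.le)
    (by rw [integral_div, div_self hZ.ne']) (by simpa using hdecay) hQ hQc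
  rw [hQ0] at h
  have h2 := h.const_mul Z
  rw [mul_zero] at h2
  refine h2.congr fun t => ?_
  rw [← integral_const_mul]
  refine integral_congr_ae (Eventually.of_forall fun x => ?_)
  simp only [finrank_euclideanSpace, Fintype.card_fin, smul_eq_mul]
  rw [← show f (t • (x₀ - x)) = (1 + ‖t • (x₀ - x)‖ ^ 2) ^ (-((d : ℝ) + 2) / 2) from rfl]
  field_simp

section TestFun

variable {d : ℕ} {R : Finset (E d)} {k : E d → ℝ} {μ C ρ θ : ℝ} {x₀ : E d}

/-- The bump function about `x₀` used in the comparison principle. -/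
def testFun (μ C ρ θ : ℝ) (x₀ : E d) : E d → ℝ := radialTest (testDensity μ C ρ θ) (ρ ^ 2) x₀

lemma neg_sq_lt_sq (hθ : 0 < θ) : -θ ^ 2 < ρ ^ 2 := by nlinarith [sq_nonneg ρ, pow_pos hθ 2]

lemma neg_sq_neg (hθ : 0 < θ) : -θ ^ 2 < 0 := by nlinarith [pow_pos hθ 2]

lemma contDiff_testFun (hθ : 0 < θ) : ContDiff ℝ (⊤ : ℕ∞) (testFun μ C ρ θ x₀) :=
  contDiff_radialTest contDiffOn_testDensity (neg_sq_neg hθ) (neg_sq_lt_sq hθ) x₀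

lemma testFun_eq_zero (hρ : 0 < ρ) {x : E d} (hx : ρ ≤ ‖x - x₀‖) :
    testFun μ C ρ θ x₀ x = 0 := by
  have h : ρ ^ 2 ≤ ‖x - x₀‖ ^ 2 := by gcongr
  rw [testFun, radialTest, intervalIntegral.integral_congr (g := fun _ => (0 : ℝ))]
  · simp
  · intro s hs
    rw [Set.uIcc_of_ge h] at hs
    exact testDensity_eq_zero hρ hs.1

lemma intervalIntegrable_testDensity (hθ : 0 < θ) {σ : ℝ} (hσ : 0 ≤ σ) :
    IntervalIntegrable (testDensity μ C ρ θ) volume σ (ρ ^ 2) := by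
  refine (contDiffOn_testDensity.continuousOn.mono fun s hs => ?_).intervalIntegrable
  rw [Set.mem_uIcc] at hs
  rcases hs with hs | hs
  · exact lt_of_lt_of_le (neg_sq_neg hθ) (hσ.trans hs.1)
  · exact lt_of_lt_of_le (neg_sq_lt_sq hθ) hs.1

lemma testFun_nonneg (hρ : 0 < ρ) (hθ : 0 < θ) (x : E d) : 0 ≤ testFun μ C ρ θ x₀ x := by
  rcases le_or_gt ρ ‖x - x₀‖ with h | h
  · rw [testFun_eq_zero hρ h]
  · refine intervalIntegral.integral_nonneg (by gcongr) fun s hs => testDensity_nonneg ?_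
    nlinarith [sq_nonneg ‖x - x₀‖, pow_pos hθ 2, hs.1]

lemma testFun_anti (hμ : 0 ≤ μ) (hC : 0 ≤ C) (hρ : 0 < ρ) (hθ : 0 < θ) {θ' : ℝ} (h : θ ≤ θ')
    (x : E d) : testFun μ C ρ θ' x₀ x ≤ testFun μ C ρ θ x₀ x := by
  rcases le_or_gt ρ ‖x - x₀‖ with hx | hx
  · rw [testFun_eq_zero hρ hx, testFun_eq_zero hρ hx]
  · refine intervalIntegral.integral_mono_on (by gcongr)
      (intervalIntegrable_testDensity (hθ.trans_le h) (sq_nonneg _))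
      (intervalIntegrable_testDensity hθ (sq_nonneg _)) fun s hs => ?_
    have hs0 : 0 ≤ s := (sq_nonneg _).trans hs.1
    refine mul_le_mul_of_nonneg_right (expPow_anti hμ hC (by positivity) (by gcongr))
      (Real.smoothTransition.nonneg _)

lemma testFun_pos (hρ : 0 < ρ) (hθ : 0 < θ) {x : E d} (hx : ‖x - x₀‖ < ρ) :
    0 < testFun μ C ρ θ x₀ x := by
  refine intervalIntegral.intervalIntegral_pos_of_pos_on
    (intervalIntegrable_testDensity hθ (sq_nonneg _)) (fun s hs => ?_) (by gcongr)
  exact testDensity_pos hρ (by nlinarith [sq_nonneg ‖x - x₀‖, pow_pos hθ 2, hs.1]) hs.2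

lemma tsupport_testFun_subset (hρ : 0 < ρ) :
    tsupport (testFun μ C ρ θ x₀) ⊆ Metric.closedBall x₀ ρ := by
  refine closure_minimal (fun x hx => ?_) Metric.isClosed_closedBall
  rw [Metric.mem_closedBall, dist_eq_norm]
  by_contra h
  exact hx (testFun_eq_zero hρ (not_le.1 h).le)

lemma hasCompactSupport_testFun (hρ : 0 < ρ) : HasCompactSupport (testFun μ C ρ θ x₀) :=
  (isCompact_closedBall x₀ ρ).of_isClosed_subset (isClosed_tsupport _)
    (tsupport_testFun_subset hρ)

lemma dunklLap_testFun_nonneg (hk : ∀ α ∈ R, 0 < k α) (hρ : 0 < ρ) (hθ : 0 < θ) {x : E d}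
    (hx : ρ ≤ ‖x - x₀‖) : 0 ≤ dunklLap R k (testFun μ C ρ θ x₀) x := by
  have h0 : 0 < ‖x - x₀‖ ^ 2 + θ ^ 2 := by positivity
  obtain ⟨g', hg', hle⟩ := exists_hasDerivAt_testDensity_le (μ := μ) (C := C) (r := ρ) h0
  have hz : testDensity μ C ρ θ (‖x - x₀‖ ^ 2) = 0 :=
    testDensity_eq_zero hρ (by gcongr)
  rw [hz] at hle
  have hle' : g' ≤ 0 := by simpa using hle
  have hcont := (contDiffOn_testDensity (μ := μ) (C := C) (r := ρ) (θ := θ)).continuousOn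
  rw [dunklLap_eq]
  refine add_nonneg ?_ (Finset.sum_nonneg fun α hα => mul_nonneg (hk α hα).le
    (div_nonneg ?_ (sq_nonneg _)))
  · rw [testFun, lap_radialTest hcont (neg_sq_neg hθ) (neg_sq_lt_sq hθ) x₀ x hg', hz]
    have := mul_nonneg (sq_nonneg ‖x - x₀‖) (neg_nonneg.2 hle')
    linarith
  · have hf : fderiv ℝ (testFun μ C ρ θ x₀) x = 0 := by
      rw [testFun, fderiv_radialTest hcont (neg_sq_neg hθ) (neg_sq_lt_sq hθ) x₀ x, hz]
      simp
    rw [dunklNum, hf, testFun_eq_zero hρ hx]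
    have := mul_nonneg (sq_nonneg ‖α‖)
      (testFun_nonneg (μ := μ) (C := C) (x₀ := x₀) hρ hθ (dunklReflect α x))
    simp
    linarith

lemma profile_drift_le {s G g' : ℝ} (hθ : 0 < θ) (hC : 0 ≤ C) (hG : 0 ≤ G)
    (hg : g' ≤ -(G * (μ + C * √(s ^ 2 + θ ^ 2)) / (2 * (s ^ 2 + θ ^ 2)))) :
    -(2 * G * θ ^ 2 * (μ + C * √(s ^ 2 + θ ^ 2)) / (s ^ 2 + θ ^ 2))
      ≤ -4 * s ^ 2 * g' - 2 * (μ + C * s) * G := by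
  have hw0 : 0 < s ^ 2 + θ ^ 2 := by positivity
  have hsw : s ≤ √(s ^ 2 + θ ^ 2) := Real.le_sqrt_of_sq_le (by linarith [sq_nonneg θ])
  have h1 := mul_le_mul_of_nonneg_left hg (by positivity : 0 ≤ 4 * s ^ 2)
  have h2 : 4 * s ^ 2 * -(G * (μ + C * √(s ^ 2 + θ ^ 2)) / (2 * (s ^ 2 + θ ^ 2)))
      = 2 * G * θ ^ 2 * (μ + C * √(s ^ 2 + θ ^ 2)) / (s ^ 2 + θ ^ 2)
        - 2 * G * (μ + C * √(s ^ 2 + θ ^ 2)) := by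
    field_simp
    ring
  have h3 := mul_le_mul_of_nonneg_left hsw (mul_nonneg hC hG)
  rw [h2] at h1
  linarith

lemma kernel_rescale {t s : ℝ} (ht : 0 < t) (n : ℕ) :
    (t⁻¹) ^ 2 * (s ^ 2 + t⁻¹ ^ 2) ^ (-((n : ℝ) + 2) / 2)
      = t ^ n * (1 + (t * s) ^ 2) ^ (-((n : ℝ) + 2) / 2) := by
  have h1 : 1 + (t * s) ^ 2 = t ^ 2 * (s ^ 2 + t⁻¹ ^ 2) := by
    field_simp
    ring
  have h2 : (t ^ 2) ^ (-((n : ℝ) + 2) / 2) = (t ^ (n + 2))⁻¹ := by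
    rw [← Real.rpow_natCast t 2, ← Real.rpow_mul ht.le, ← Real.rpow_natCast,
      ← Real.rpow_neg ht.le]
    congr 1
    push_cast
    ring
  rw [h1, Real.mul_rpow (by positivity) (by positivity), h2, pow_add]
  field_simp

/-- Weighted lower bound for the Dunkl Laplacian of the bump function inside its support. -/
lemma dunklLap_testFun_mul_wk_ge (hk : ∀ α ∈ R, 0 < k α) (hρ : 0 < ρ) {t : ℝ} (ht : 1 ≤ t)
    {D : ℝ} (hD : 0 ≤ D) {x : E d}
    (hwk : wk R k x ≤ D * ‖x - x₀‖ ^ (∑ α ∈ R, stabMult k x₀ α))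
    (hx : ∀ α ∈ R, |⟪α, x₀⟫| / 2 ≤ |⟪α, x⟫|) (hxρ : ‖x - x₀‖ < ρ) :
    -(2 * (d + ∑ α ∈ R, stabMult k x₀ α + driftBound R k x₀ * (ρ + 1)) * D *
        (t ^ d * (1 + ‖t • (x₀ - x)‖ ^ 2) ^ (-((d : ℝ) + 2) / 2)))
      - jumpBound R k x₀ * testFun (d + ∑ α ∈ R, stabMult k x₀ α) (driftBound R k x₀) ρ t⁻¹ x₀ x
          * wk R k x
      ≤ dunklLap R k
          (testFun (d + ∑ α ∈ R, stabMult k x₀ α) (driftBound R k x₀) ρ t⁻¹ x₀) x * wk R k x := by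
  have ht0 : 0 < t := by linarith
  set γ := ∑ α ∈ R, stabMult k x₀ α with hγ
  have hγ0 : 0 ≤ γ := Finset.sum_nonneg (stabMult_nonneg hk x₀)
  set C := driftBound R k x₀ with hC
  have hC0 : 0 ≤ C := driftBound_nonneg hk x₀
  set θ := t⁻¹ with hθdef
  have hθ : 0 < θ := inv_pos.2 ht0
  have hθ1 : θ ≤ 1 := inv_le_one_of_one_le₀ ht
  set s := ‖x - x₀‖ with hs
  have hs0 : 0 ≤ s := norm_nonneg _
  have hmain : 0 ≤ 2 * (d + γ + C * (ρ + 1)) * D *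
        (t ^ d * (1 + ‖t • (x₀ - x)‖ ^ 2) ^ (-((d : ℝ) + 2) / 2)) := by positivity
  by_cases hne : ∀ α ∈ R, ⟪α, x⟫ ≠ 0
  swap
  · push Not at hne
    obtain ⟨α, hα, h0⟩ := hne
    rw [wk_eq_zero hk hα h0, mul_zero, mul_zero]
    linarith
  have hw : 0 < s ^ 2 + θ ^ 2 := by positivity
  obtain ⟨g', hg', hle⟩ :=
    exists_hasDerivAt_testDensity_le (μ := d + γ) (C := C) (r := ρ) (θ := θ) (σ := s ^ 2) hw
  have hG0 : 0 ≤ testDensity (d + γ) C ρ θ (s ^ 2) := testDensity_nonneg hw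
  have hcont := (contDiffOn_testDensity (μ := d + γ) (C := C) (r := ρ) (θ := θ)).continuousOn
  have h1 := dunklLap_radialTest_ge hk hcont (neg_sq_neg hθ) (neg_sq_lt_sq (ρ := ρ) hθ) hg' hG0
    (fun y => testFun_nonneg hρ hθ y) hx hne
  rw [← hs, ← hC, ← hγ] at h1
  have h2 := profile_drift_le hθ hC0 hG0 hle
  have hwk0 : 0 ≤ wk R k x := wk_nonneg x
  have h3 := mul_le_mul_of_nonneg_right ((sub_le_sub_right h2 _).trans h1) hwk0
  refine le_trans ?_ h3
  rw [sub_mul]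
  refine sub_le_sub_right ?_ _
  rw [neg_mul, neg_le_neg_iff]
  have hsqrt : √(s ^ 2 + θ ^ 2) ≤ ρ + 1 := by
    rw [Real.sqrt_le_left (by linarith)]
    nlinarith
  have hnorm : ‖t • (x₀ - x)‖ = t * s := by
    rw [norm_smul, Real.norm_of_nonneg ht0.le, norm_sub_rev]
  rw [hnorm, ← kernel_rescale ht0]
  have hGw : testDensity (d + γ) C ρ θ (s ^ 2) * wk R k x / (s ^ 2 + θ ^ 2)
      ≤ D * (s ^ 2 + θ ^ 2) ^ (-((d : ℝ) + 2) / 2) := by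
    have e1 : testDensity (d + γ) C ρ θ (s ^ 2) ≤ (s ^ 2 + θ ^ 2) ^ (-((d + γ) / 2)) :=
      (mul_le_of_le_one_right (expPow_pos hw).le (Real.smoothTransition.le_one _)).trans
        (expPow_le hC0 hw)
    have e2 : s ^ γ ≤ (s ^ 2 + θ ^ 2) ^ (γ / 2) := by
      calc s ^ γ = (s ^ 2) ^ (γ / 2) := by
            rw [← Real.rpow_natCast s 2, ← Real.rpow_mul hs0]
            congr 1
            push_cast
            ring
        _ ≤ _ := Real.rpow_le_rpow (sq_nonneg s) (by linarith [sq_nonneg θ]) (by positivity)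
    have e3 : (s ^ 2 + θ ^ 2) ^ (-((d + γ) / 2)) * (s ^ 2 + θ ^ 2) ^ (γ / 2) / (s ^ 2 + θ ^ 2)
        = (s ^ 2 + θ ^ 2) ^ (-((d : ℝ) + 2) / 2) := by
      rw [← Real.rpow_add hw, ← Real.rpow_sub_one hw.ne']
      congr 1
      ring
    calc _ ≤ (s ^ 2 + θ ^ 2) ^ (-((d + γ) / 2)) * (D * (s ^ 2 + θ ^ 2) ^ (γ / 2))
          / (s ^ 2 + θ ^ 2) := by
          gcongr
          exact hwk.trans (by gcongr)
      _ = D * ((s ^ 2 + θ ^ 2) ^ (-((d + γ) / 2)) * (s ^ 2 + θ ^ 2) ^ (γ / 2)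
          / (s ^ 2 + θ ^ 2)) := by ring
      _ = _ := by rw [e3]
  have hμC : 0 ≤ d + γ + C * √(s ^ 2 + θ ^ 2) := by positivity
  calc 2 * testDensity (d + γ) C ρ θ (s ^ 2) * θ ^ 2 * (d + γ + C * √(s ^ 2 + θ ^ 2))
        / (s ^ 2 + θ ^ 2) * wk R k x
      = 2 * (d + γ + C * √(s ^ 2 + θ ^ 2)) * θ ^ 2 *
        (testDensity (d + γ) C ρ θ (s ^ 2) * wk R k x / (s ^ 2 + θ ^ 2)) := by ring
    _ ≤ 2 * (d + γ + C * (ρ + 1)) * θ ^ 2 * (D * (s ^ 2 + θ ^ 2) ^ (-((d : ℝ) + 2) / 2)) := by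
        gcongr
    _ = _ := by ring

end TestFun

section StrictSuper

variable {d : ℕ} {R : Finset (E d)} {k : E d → ℝ}

/-- A nonnegative function which is a strict weak supersolution near a zero cannot exist. -/
lemma not_strict_weak_super (hR0 : ∀ α ∈ R, α ≠ 0) (hk : ∀ α ∈ R, 0 < k α) {r : ℝ}
    {x₀ : E d} (hx₀ : x₀ ∈ Metric.ball (0 : E d) r) {P : E d → ℝ}
    (hPc : ContinuousOn P (Metric.ball 0 r)) (hP0 : ∀ x ∈ Metric.ball 0 r, 0 ≤ P x)
    (hPx₀ : P x₀ = 0) {c : ℝ} (hc : 0 < c) {U : Set (E d)} (hU : U ∈ 𝓝 x₀)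
    (H : ∀ ψ : E d → ℝ, ContDiff ℝ (⊤ : ℕ∞) ψ → HasCompactSupport ψ → tsupport ψ ⊆ U →
      tsupport ψ ⊆ Metric.ball 0 r → (∀ x, 0 ≤ ψ x) →
      ∫ x in Metric.ball 0 r, P x * dunklLap R k ψ x * wk R k x
        ≤ -c * ∫ x in Metric.ball 0 r, ψ x * wk R k x) : False := by
  have hball : Metric.ball (0 : E d) r ∈ 𝓝 x₀ := Metric.isOpen_ball.mem_nhds hx₀
  have hPcx : ContinuousAt P x₀ := hPc.continuousAt hball
  have hev : ∀ᶠ x in 𝓝 x₀, (∀ α ∈ R, |⟪α, x₀⟫| / 2 ≤ |⟪α, x⟫|) ∧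
      jumpBound R k x₀ * P x < c / 2 ∧ x ∈ U ∧ x ∈ Metric.ball (0 : E d) r := by
    refine (eventually_abs_inner_ge R x₀).and (Eventually.and ?_ (Eventually.and hU hball))
    have : Tendsto (fun x => jumpBound R k x₀ * P x) (𝓝 x₀) (𝓝 0) := by
      simpa [hPx₀] using hPcx.tendsto.const_mul (jumpBound R k x₀)
    exact this.eventually_lt_const (half_pos hc)
  obtain ⟨ε, hε, hsub⟩ := Metric.eventually_nhds_iff_ball.1 hev
  set ρ := ε / 2 with hρdef
  have hρ : 0 < ρ := half_pos hε
  have hloc : ∀ x, ‖x - x₀‖ ≤ ρ → (∀ α ∈ R, |⟪α, x₀⟫| / 2 ≤ |⟪α, x⟫|) ∧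
      jumpBound R k x₀ * P x < c / 2 ∧ x ∈ U ∧ x ∈ Metric.ball (0 : E d) r := by
    intro x hx
    refine hsub x ?_
    rw [Metric.mem_ball, dist_eq_norm]
    linarith [half_lt_self hε]
  have hcb : ∀ x ∈ Metric.closedBall x₀ ρ, ‖x - x₀‖ ≤ ρ := fun x hx => by
    rwa [Metric.mem_closedBall, dist_eq_norm] at hx
  obtain ⟨D, hD, hwk⟩ := exists_wk_le_rpow hk x₀ ρ hρ.le
  set γ := ∑ α ∈ R, stabMult k x₀ α with hγ
  have hγ0 : 0 ≤ γ := Finset.sum_nonneg (stabMult_nonneg hk x₀)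
  set C := driftBound R k x₀ with hC
  have hC0 : 0 ≤ C := driftBound_nonneg hk x₀
  set ψ : ℝ → E d → ℝ := fun t => testFun (d + γ) C ρ t⁻¹ x₀ with hψdef
  -- the support lies in a closed ball about the origin
  obtain ⟨ρ₀, hρ₀r, hρ₀⟩ : ∃ ρ₀ < r, ∀ x ∈ Metric.closedBall x₀ ρ, ‖x‖ ≤ ρ₀ := by
    obtain ⟨y, hy, hmax⟩ := (isCompact_closedBall x₀ ρ).exists_isMaxOn
      (Metric.nonempty_closedBall.2 hρ.le) continuous_norm.continuousOn
    refine ⟨‖y‖, ?_, fun x hx => hmax hx⟩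
    simpa using (hloc y (hcb y hy)).2.2.2
  have hψ0 : ∀ t x, ρ₀ < ‖x‖ → ψ t x = 0 := by
    intro t x hx
    refine testFun_eq_zero hρ (le_of_lt ?_)
    by_contra h
    refine absurd (hρ₀ x ?_) (not_le.2 hx)
    rw [Metric.mem_closedBall, dist_eq_norm]
    exact not_lt.1 h
  have hPc' : ContinuousOn P (Metric.closedBall 0 ρ₀) :=
    hPc.mono (Metric.closedBall_subset_ball hρ₀r)
  have hψsm : ∀ t, 1 ≤ t → ContDiff ℝ (⊤ : ℕ∞) (ψ t) := fun t ht =>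
    contDiff_testFun (inv_pos.2 (by linarith))
  have hint1 : ∀ t, 1 ≤ t → IntegrableOn (fun x => ψ t x * wk R k x) (Metric.ball 0 r) :=
    fun t ht => by
      simpa using integrableOn_mul_mul_wk (u := fun _ => (1 : ℝ)) hk (hψsm t ht).continuous (hψ0 t)
        continuousOn_const (measurableSet_ball (x := (0 : E d)) (ε := r))
  have hint2 : ∀ t, 1 ≤ t →
      IntegrableOn (fun x => P x * dunklLap R k (ψ t) x * wk R k x) (Metric.ball 0 r) :=
    fun t ht => integrableOn_mul_dunklLap_mul_wk hR0 hk (hψsm t ht) (hasCompactSupport_testFun hρ)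
      (hψ0 t) hPc' measurableSet_ball
  -- the localised function
  set Q : E d → ℝ := (Metric.closedBall x₀ ρ).indicator P with hQ
  have hQi : Integrable Q := by
    rw [hQ, integrable_indicator_iff measurableSet_closedBall]
    exact (hPc.mono fun x hx => (hloc x (hcb x hx)).2.2.2).integrableOn_compact
      (isCompact_closedBall _ _)
  have hQx₀ : Q x₀ = 0 := by simp [hQ, hPx₀]
  have hQc : ContinuousAt Q x₀ := by
    refine hPcx.congr ?_
    filter_upwards [Metric.closedBall_mem_nhds x₀ hρ] with x hx
    rw [hQ, Set.indicator_of_mem hx]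
  set M := 2 * (d + γ + C * (ρ + 1)) * D with hM
  set F : ℝ → E d → ℝ := fun t x =>
    t ^ d * (1 + ‖t • (x₀ - x)‖ ^ 2) ^ (-((d : ℝ) + 2) / 2) * Q x with hF
  have hlim := tendsto_integral_rpow_kernel hQi hQc hQx₀
  have hFi : ∀ t, 1 ≤ t → Integrable (F t) := by
    intro t ht
    refine hQi.bdd_mul (c := t ^ d) ?_ (Eventually.of_forall fun x => ?_)
    · refine (Continuous.mul continuous_const
        (Continuous.rpow_const (by fun_prop) fun x => Or.inl ?_)).aestronglyMeasurable
      positivity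
    · have h1 : (1 + ‖t • (x₀ - x)‖ ^ 2) ^ (-((d : ℝ) + 2) / 2) ≤ 1 := by
        refine Real.rpow_le_one_of_one_le_of_nonpos (by linarith [sq_nonneg ‖t • (x₀ - x)‖]) ?_
        have : (0 : ℝ) ≤ d := Nat.cast_nonneg d
        linarith
      rw [Real.norm_of_nonneg (by positivity)]
      exact mul_le_of_le_one_right (by positivity) h1
  have hF0 : ∀ t, 1 ≤ t → ∀ x, 0 ≤ F t x := by
    intro t ht x
    refine mul_nonneg (by positivity) ?_
    rw [hQ]
    exact Set.indicator_nonneg (fun x hx => hP0 x (hloc x (hcb x hx)).2.2.2) x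
  have hM0 : 0 ≤ M := by positivity
  -- pointwise lower bound
  have hpt : ∀ t, 1 ≤ t → ∀ x ∈ Metric.ball (0 : E d) r,
      -(M * F t x) - c / 2 * (ψ t x * wk R k x) ≤ P x * dunklLap R k (ψ t) x * wk R k x := by
    intro t ht x hx
    have ht0 : 0 < t⁻¹ := inv_pos.2 (by linarith)
    have hw0 : 0 ≤ wk R k x := wk_nonneg x
    have hPx := hP0 x hx
    rcases le_or_gt ρ ‖x - x₀‖ with h | h
    · have h1 : ψ t x = 0 := testFun_eq_zero hρ h
      have h2 : 0 ≤ dunklLap R k (ψ t) x := dunklLap_testFun_nonneg hk hρ ht0 h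
      have h3 := mul_nonneg hM0 (hF0 t ht x)
      have h4 := mul_nonneg (mul_nonneg hPx h2) hw0
      rw [h1]
      linarith
    · have hx' := hloc x h.le
      have h1 := dunklLap_testFun_mul_wk_ge hk hρ ht hD (hwk x h.le) hx'.1 h
      rw [← hγ, ← hC] at h1
      have h2 := mul_le_mul_of_nonneg_left h1 hPx
      have hQx : Q x = P x := by
        rw [hQ, Set.indicator_of_mem]
        rw [Metric.mem_closedBall, dist_eq_norm]
        exact h.le
      have h3 : 0 ≤ ψ t x * wk R k x := mul_nonneg (testFun_nonneg hρ ht0 x) hw0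
      have h4 := mul_le_mul_of_nonneg_right hx'.2.1.le h3
      simp only [hF, hQx, hM, hψdef] at h4 ⊢
      linarith
  have hineq : ∀ t, 1 ≤ t →
      c / 2 * ∫ x in Metric.ball 0 r, ψ t x * wk R k x ≤ M * ∫ x, F t x := by
    intro t ht
    have hH := H (ψ t) (hψsm t ht) (hasCompactSupport_testFun hρ)
      (fun x hx => (hloc x (hcb x (tsupport_testFun_subset hρ hx))).2.2.1)
      (fun x hx => (hloc x (hcb x (tsupport_testFun_subset hρ hx))).2.2.2)
      (fun x => testFun_nonneg hρ (inv_pos.2 (by linarith)) x)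
    have h1 := setIntegral_mono_on
      ((((hFi t ht).integrableOn (s := Metric.ball 0 r)).const_mul M).neg.sub
        ((hint1 t ht).const_mul (c / 2))) (hint2 t ht) measurableSet_ball (hpt t ht)
    have h2 : ∫ x in Metric.ball 0 r, (-(M * F t x) - c / 2 * (ψ t x * wk R k x))
        = -(M * ∫ x in Metric.ball 0 r, F t x)
          - c / 2 * ∫ x in Metric.ball 0 r, ψ t x * wk R k x := by
      rw [integral_sub (f := fun x => -(M * F t x)) ((hFi t ht).integrableOn.const_mul M).neg
        ((hint1 t ht).const_mul (c / 2)), integral_neg, integral_const_mul, integral_const_mul]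
    have h3 : ∫ x in Metric.ball 0 r, F t x ≤ ∫ x, F t x :=
      setIntegral_le_integral (hFi t ht) (Eventually.of_forall (hF0 t ht))
    have h4 := mul_le_mul_of_nonneg_left h3 hM0
    have h5 := h2.symm.le.trans (h1.trans hH)
    linarith
  have hpos : 0 < ∫ x in Metric.ball 0 r, ψ 1 x * wk R k x := by
    obtain ⟨y, hy, hyw⟩ := (dense_wk_pos (k := k) hR0).inter_open_nonempty (Metric.ball x₀ ρ)
      Metric.isOpen_ball ⟨x₀, Metric.mem_ball_self hρ⟩
    rw [Metric.mem_ball, dist_eq_norm] at hy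
    rw [setIntegral_eq_integral_of_forall_compl_eq_zero]
    · refine Continuous.integral_pos_of_hasCompactSupport_nonneg_nonzero (x := y)
        ((hψsm 1 le_rfl).continuous.mul (continuous_wk hk))
        (HasCompactSupport.mul_right (hasCompactSupport_testFun hρ))
        (fun x => mul_nonneg (testFun_nonneg hρ (by norm_num) x) (wk_nonneg x)) ?_
      exact (mul_pos (testFun_pos hρ (by norm_num) hy) hyw).ne'
    · intro x hx
      rw [hψ0 1 x, zero_mul]
      simp only [Metric.mem_ball, dist_zero_right, not_lt] at hx
      linarith
  have hle : ∀ᶠ t : ℝ in atTop,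
      c / 2 * ∫ x in Metric.ball 0 r, ψ 1 x * wk R k x ≤ M * ∫ x, F t x := by
    filter_upwards [eventually_ge_atTop 1] with t ht
    refine le_trans ?_ (hineq t ht)
    refine mul_le_mul_of_nonneg_left ?_ (half_pos hc).le
    refine setIntegral_mono (hint1 1 le_rfl) (hint1 t ht) fun x => ?_
    refine mul_le_mul_of_nonneg_right ?_ (wk_nonneg x)
    refine testFun_anti (by positivity) hC0 hρ (inv_pos.2 (by linarith)) ?_ x
    rw [inv_one]
    exact inv_le_one_of_one_le₀ ht
  have hlim' := hlim.const_mul M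
  rw [mul_zero] at hlim'
  have := ge_of_tendsto hlim' hle
  have := mul_pos (half_pos hc) hpos
  linarith

end StrictSuper

section Comparison

variable {d : ℕ} {R : Finset (E d)} {k : E d → ℝ} {m : ℝ} {φ : ℝ → ℝ} {r : ℝ}

lemma radialSol_zero_fun (m c t : ℝ) : radialSol m (fun _ => 0) c t = c := by
  simp [radialSol, radialMean]

lemma radialSol_const (hm : 1 < m) (t : ℝ) : radialSol m (fun _ => 2 * m) 0 t = t ^ 2 := by
  have h : ∀ s, radialMean m (fun _ => 2 * m) s = 2 := by
    intro s
    have h0 := radialMean_zero (q := fun _ => 2 * m) (m := m) hm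
    have : radialMean m (fun _ => 2 * m) s = radialMean m (fun _ => 2 * m) 0 := rfl
    rw [this, h0]
    field_simp
  simp only [radialSol, h, intervalIntegral.integral_const, sub_zero, smul_eq_mul]
  ring

lemma exists_norm_gt_eq_zero_of_tsupport_subset {ψ : E d → ℝ} (hc : HasCompactSupport ψ)
    (hr : 0 < r) (hs : tsupport ψ ⊆ Metric.ball 0 r) :
    ∃ ρ, 0 < ρ ∧ ρ < r ∧ ∀ x, ρ < ‖x‖ → ψ x = 0 := by
  rcases (tsupport ψ).eq_empty_or_nonempty with he | hne
  · rw [tsupport_eq_empty_iff] at he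
    exact ⟨r / 2, half_pos hr, half_lt_self hr, fun x _ => by rw [he]; rfl⟩
  · obtain ⟨y, hy, hmax⟩ := hc.exists_isMaxOn hne continuous_norm.continuousOn
    have hyr : ‖y‖ < r := by simpa using hs hy
    refine ⟨max ‖y‖ (r / 2), lt_max_of_lt_right (half_pos hr),
      max_lt hyr (half_lt_self hr), fun x hx => ?_⟩
    by_contra h
    exact absurd (hmax (subset_tsupport _ h)) (not_le.2 ((le_max_left _ _).trans_lt hx))

lemma setIntegral_mul_dunklLap_eq {ψ : E d → ℝ} {ρ : ℝ} (hρ : ρ < r)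
    (h0 : ∀ x, ρ < ‖x‖ → ψ x = 0) (u : E d → ℝ) :
    ∫ x in Metric.ball 0 r, u x * dunklLap R k ψ x * wk R k x
      = ∫ x, u x * dunklLap R k ψ x * wk R k x := by
  refine setIntegral_eq_integral_of_forall_compl_eq_zero fun x hx => ?_
  simp only [Metric.mem_ball, dist_zero_right, not_lt] at hx
  rw [dunklLap_eq_zero_of_norm_gt h0 (hρ.trans_le hx), mul_zero, zero_mul]

lemma setIntegral_mul_mul_wk_eq {ψ : E d → ℝ} {ρ : ℝ} (hρ : ρ < r)
    (h0 : ∀ x, ρ < ‖x‖ → ψ x = 0) (u : E d → ℝ) :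
    ∫ x in Metric.ball 0 r, u x * ψ x * wk R k x = ∫ x, u x * ψ x * wk R k x := by
  refine setIntegral_eq_integral_of_forall_compl_eq_zero fun x hx => ?_
  simp only [Metric.mem_ball, dist_zero_right, not_lt] at hx
  rw [h0 x (hρ.trans_le hx), mul_zero, zero_mul]

/-- Radial solutions of the ordinary differential equation are distributional solutions. -/
lemma isDunklSol_radialSol (hR0 : ∀ α ∈ R, α ≠ 0)
    (hRrefl : ∀ α ∈ R, ∀ β ∈ R, dunklReflect α β ∈ R) (hk : ∀ α ∈ R, 0 < k α)
    (hkinv : ∀ α ∈ R, ∀ β ∈ R, k (dunklReflect α β) = k β) (hm : m = d + ∑ α ∈ R, k α)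
    (hm1 : 1 < m) (hr : 0 < r) {q : ℝ → ℝ} (hq : Continuous q) {c : ℝ}
    (h : ∀ t, 0 ≤ t → t < r → q t = φ (radialSol m q c t)) :
    IsDunklSol R k φ (Metric.ball 0 r) fun x => radialSol m q c ‖x‖ := by
  intro ψ hψ hc hs
  obtain ⟨ρ, -, hρ, h0⟩ := exists_norm_gt_eq_zero_of_tsupport_subset hc hr hs
  rw [setIntegral_mul_dunklLap_eq hρ h0 fun x => radialSol m q c ‖x‖,
    integral_radialSol_mul_dunklLap hRrefl hR0 hk hkinv hm hm1 hq c hψ hc,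
    ← setIntegral_mul_mul_wk_eq hρ h0 fun x => q ‖x‖]
  refine setIntegral_congr_fun measurableSet_ball fun x hx => ?_
  simp only [Metric.mem_ball, dist_zero_right] at hx
  simp only [h ‖x‖ (norm_nonneg x) hx]

lemma continuous_indicator_max_zero {h : E d → ℝ} (hh : ContinuousOn h (Metric.ball 0 r))
    (hb : ∀ z : E d, ‖z‖ = r → ∀ᶠ x in 𝓝[Metric.ball 0 r] z, h x ≤ 0) :
    Continuous ((Metric.ball (0 : E d) r).indicator fun x => max (h x) 0) := by
  rw [continuous_iff_continuousAt]
  intro x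
  by_cases hx : x ∈ Metric.ball (0 : E d) r
  · have hn := Metric.isOpen_ball.mem_nhds hx
    have hc : ContinuousAt (fun x => max (h x) 0) x :=
      (hh.continuousAt hn).max continuousAt_const
    refine hc.congr ?_
    filter_upwards [hn] with y hy
    rw [Set.indicator_of_mem hy]
  · have h0 : ∀ᶠ y in 𝓝 x, (Metric.ball (0 : E d) r).indicator (fun x => max (h x) 0) y = 0 := by
      have hx' : r ≤ ‖x‖ := by simpa using hx
      rcases hx'.eq_or_lt with he | hlt
      · filter_upwards [eventually_nhdsWithin_iff.1 (hb x he.symm)] with y hy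
        by_cases hyb : y ∈ Metric.ball (0 : E d) r
        · rw [Set.indicator_of_mem hyb, max_eq_right (hy hyb)]
        · rw [Set.indicator_of_notMem hyb]
      · filter_upwards [continuous_norm.continuousAt.eventually_const_lt hlt] with y hy
        refine Set.indicator_of_notMem ?_ _
        simpa using hy.le
    exact (continuousAt_const (y := (0 : ℝ))).congr (h0.mono fun y hy => hy.symm)

/-- Comparison principle for distributional solutions of the semilinear equation. -/
lemma IsDunklSol.le_of_boundary_le (hR0 : ∀ α ∈ R, α ≠ 0)
    (hRrefl : ∀ α ∈ R, ∀ β ∈ R, dunklReflect α β ∈ R) (hk : ∀ α ∈ R, 0 < k α)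
    (hkinv : ∀ α ∈ R, ∀ β ∈ R, k (dunklReflect α β) = k β) (hm : m = d + ∑ α ∈ R, k α)
    (hm1 : 1 < m) (hr : 0 < r) (hφc : ContinuousOn φ (Set.Ici 0))
    (hφmono : MonotoneOn φ (Set.Ici 0)) {u V : E d → ℝ}
    (hu : ContinuousOn u (Metric.ball 0 r)) (hV : ContinuousOn V (Metric.ball 0 r))
    (hu0 : ∀ x ∈ Metric.ball 0 r, 0 ≤ u x) (hV0 : ∀ x ∈ Metric.ball 0 r, 0 ≤ V x)
    (hus : IsDunklSol R k φ (Metric.ball 0 r) u) (hVs : IsDunklSol R k φ (Metric.ball 0 r) V)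
    (hb : ∀ z : E d, ‖z‖ = r → ∀ᶠ x in 𝓝[Metric.ball 0 r] z, V x ≤ u x) :
    ∀ x ∈ Metric.ball 0 r, V x ≤ u x := by
  intro x₁ hx₁
  by_contra! hlt
  set h : E d → ℝ := fun x => V x - u x with hh
  have hhc : ContinuousOn h (Metric.ball 0 r) := hV.sub hu
  set H := (Metric.ball (0 : E d) r).indicator fun x => max (h x) 0 with hH
  have hHc : Continuous H := continuous_indicator_max_zero hhc fun z hz =>
    (hb z hz).mono fun x hx => sub_nonpos.2 hx
  have hHx : ∀ x ∈ Metric.ball (0 : E d) r, H x = max (h x) 0 := fun x hx =>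
    Set.indicator_of_mem hx _
  have hH₁ : 0 < H x₁ := by
    rw [hHx x₁ hx₁]
    exact lt_max_of_lt_left (sub_pos.2 hlt)
  set δ := H x₁ / (2 * r ^ 2) with hδdef
  have hδ : 0 < δ := by positivity
  have hδr : δ * r ^ 2 = H x₁ / 2 := by
    rw [hδdef]
    field_simp
  obtain ⟨x₀, hx₀, hmax⟩ := (isCompact_closedBall (0 : E d) r).exists_isMaxOn
    (Metric.nonempty_closedBall.2 hr.le)
    (f := fun x => H x + δ * ‖x‖ ^ 2) (by fun_prop)
  have hmax' : ∀ x ∈ Metric.closedBall (0 : E d) r, H x + δ * ‖x‖ ^ 2 ≤ H x₀ + δ * ‖x₀‖ ^ 2 :=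
    fun x hx => hmax hx
  have hH₀ : 0 < H x₀ := by
    have h1 := hmax' x₁ (Metric.ball_subset_closedBall hx₁)
    have h2 : ‖x₀‖ ≤ r := by simpa using hx₀
    have h3 : δ * ‖x₀‖ ^ 2 ≤ δ * r ^ 2 := by gcongr
    have h4 : 0 ≤ δ * ‖x₁‖ ^ 2 := by positivity
    linarith
  have hx₀b : x₀ ∈ Metric.ball (0 : E d) r := by
    by_contra hx
    rw [hH, Set.indicator_of_notMem hx] at hH₀
    exact lt_irrefl _ hH₀
  have hh₀ : H x₀ = h x₀ := by
    rw [hHx x₀ hx₀b] at hH₀ ⊢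
    rcases lt_max_iff.1 hH₀ with h1 | h1
    · exact max_eq_left h1.le
    · exact absurd h1 (lt_irrefl _)
  set M := H x₀ + δ * ‖x₀‖ ^ 2 with hM
  set P : E d → ℝ := fun x => M - h x - δ * ‖x‖ ^ 2 with hP
  have hPc : ContinuousOn P (Metric.ball 0 r) :=
    (continuousOn_const.sub hhc).sub (by fun_prop)
  refine not_strict_weak_super hR0 hk hx₀b hPc (fun x hx => ?_) ?_
    (c := 2 * m * δ) (by positivity)
    (U := {x | x ∈ Metric.ball (0 : E d) r ∧ u x < V x}) ?_ ?_
  · have h1 := hmax' x (Metric.ball_subset_closedBall hx)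
    have h2 : h x ≤ H x := (hHx x hx) ▸ le_max_left _ _
    simp only [hP]
    linarith
  · simp only [hP, hM, hh₀]
    ring
  · have hn := Metric.isOpen_ball.mem_nhds hx₀b
    have h1 : 0 < h x₀ := hh₀ ▸ hH₀
    filter_upwards [hn, (hhc.continuousAt hn).eventually_const_lt h1] with x hx1 hx2
    exact ⟨hx1, sub_pos.1 hx2⟩
  · intro ψ hψ hc hsU hs hψ0
    obtain ⟨ρ, -, hρ, h0⟩ := exists_norm_gt_eq_zero_of_tsupport_subset hc hr hs
    have hsub : Metric.closedBall (0 : E d) ρ ⊆ Metric.ball 0 r := Metric.closedBall_subset_ball hρ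
    have hms := measurableSet_ball (x := (0 : E d)) (ε := r)
    have i1 {f : E d → ℝ} (hf : ContinuousOn f (Metric.ball 0 r)) :
        IntegrableOn (fun x => f x * dunklLap R k ψ x * wk R k x) (Metric.ball 0 r) :=
      integrableOn_mul_dunklLap_mul_wk hR0 hk hψ hc h0 (hf.mono hsub) hms
    have i2 {f : E d → ℝ} (hf : ContinuousOn f (Metric.ball 0 r)) :
        IntegrableOn (fun x => f x * ψ x * wk R k x) (Metric.ball 0 r) :=
      integrableOn_mul_mul_wk hk hψ.continuous h0 (hf.mono hsub) hms
    have eM : ∫ x in Metric.ball 0 r, M * dunklLap R k ψ x * wk R k x = 0 := by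
      have := integral_radialSol_mul_dunklLap hRrefl hR0 hk hkinv hm hm1
        (q := fun _ => 0) continuous_const M hψ hc
      rw [setIntegral_mul_dunklLap_eq hρ h0 fun _ => M]
      simpa [radialSol_zero_fun] using this
    have eN : ∫ x in Metric.ball 0 r, ‖x‖ ^ 2 * dunklLap R k ψ x * wk R k x
        = 2 * m * ∫ x in Metric.ball 0 r, ψ x * wk R k x := by
      have := integral_radialSol_mul_dunklLap hRrefl hR0 hk hkinv hm hm1
        (q := fun _ => 2 * m) continuous_const 0 hψ hc
      simp only [radialSol_const hm1] at this
      rw [setIntegral_mul_dunklLap_eq hρ h0 fun x => ‖x‖ ^ 2, this,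
        ← setIntegral_mul_mul_wk_eq hρ h0 fun _ => 2 * m, ← integral_const_mul]
      simp only [mul_assoc]
    have cφu : ContinuousOn (fun x => φ (u x)) (Metric.ball 0 r) := hφc.comp hu hu0
    have cφV : ContinuousOn (fun x => φ (V x)) (Metric.ball 0 r) := hφc.comp hV hV0
    have cN : ContinuousOn (fun x : E d => ‖x‖ ^ 2) (Metric.ball 0 r) := by fun_prop
    have hsplit : ∫ x in Metric.ball 0 r, P x * dunklLap R k ψ x * wk R k x
        = (∫ x in Metric.ball 0 r, M * dunklLap R k ψ x * wk R k x)
          - (∫ x in Metric.ball 0 r, V x * dunklLap R k ψ x * wk R k x)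
          + (∫ x in Metric.ball 0 r, u x * dunklLap R k ψ x * wk R k x)
          - δ * ∫ x in Metric.ball 0 r, ‖x‖ ^ 2 * dunklLap R k ψ x * wk R k x := by
      have iM : IntegrableOn (fun x => M * dunklLap R k ψ x * wk R k x) (Metric.ball 0 r) :=
        i1 continuousOn_const
      have iMV : IntegrableOn (fun x => M * dunklLap R k ψ x * wk R k x
          - V x * dunklLap R k ψ x * wk R k x) (Metric.ball 0 r) := iM.sub (i1 hV)
      have iMVu : IntegrableOn (fun x => M * dunklLap R k ψ x * wk R k x
          - V x * dunklLap R k ψ x * wk R k x + u x * dunklLap R k ψ x * wk R k x)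
          (Metric.ball 0 r) := iMV.add (i1 hu)
      rw [← integral_const_mul, ← integral_sub iM (i1 hV), ← integral_add iMV (i1 hu),
        ← integral_sub iMVu ((i1 cN).const_mul δ)]
      refine integral_congr_ae (Eventually.of_forall fun x => ?_)
      simp only [hP, hh]
      ring
    have hmonoφ : ∫ x in Metric.ball 0 r, φ (u x) * ψ x * wk R k x
        ≤ ∫ x in Metric.ball 0 r, φ (V x) * ψ x * wk R k x := by
      refine setIntegral_mono_on (i2 cφu) (i2 cφV) hms fun x hx => ?_
      by_cases hxψ : ψ x = 0
      · simp [hxψ]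
      · have hxU := hsU (subset_tsupport _ hxψ)
        have := hφmono (hu0 x hx) (hV0 x hx) hxU.2.le
        have h1 := hψ0 x
        have h2 : 0 ≤ wk R k x := wk_nonneg x
        gcongr
    rw [hsplit, eM, eN, hus ψ hψ hc hs, hVs ψ hψ hc hs]
    linarith

end Comparison

section Primitive

variable {f : ℝ → ℝ}

/-- The primitive of `f` vanishing at the origin. -/
def prim (f : ℝ → ℝ) (t : ℝ) : ℝ := ∫ s in (0 : ℝ)..t, f s

lemma hasDerivAt_prim (hf : Continuous f) (t : ℝ) : HasDerivAt (prim f) (f t) t :=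
  intervalIntegral.integral_hasDerivAt_right (hf.intervalIntegrable _ _)
    (hf.stronglyMeasurableAtFilter _ _) hf.continuousAt

lemma continuous_prim (hf : Continuous f) : Continuous (prim f) :=
  continuous_iff_continuousAt.2 fun t => (hasDerivAt_prim hf t).continuousAt

lemma monotone_prim (hf : Continuous f) (hf0 : ∀ t, 0 ≤ f t) : Monotone (prim f) :=
  monotone_of_deriv_nonneg (fun t => (hasDerivAt_prim hf t).differentiableAt) fun t => by
    rw [(hasDerivAt_prim hf t).deriv]
    exact hf0 t

lemma prim_nonneg (hf0 : ∀ t, 0 ≤ f t) {t : ℝ} (ht : 0 ≤ t) : 0 ≤ prim f t :=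
  intervalIntegral.integral_nonneg ht fun s _ => hf0 s

lemma prim_sub (hf : Continuous f) (a b : ℝ) : prim f b - prim f a = ∫ s in a..b, f s :=
  intervalIntegral.integral_interval_sub_left (hf.intervalIntegrable _ _)
    (hf.intervalIntegrable _ _)

lemma mul_le_prim_sub (hf : Continuous f) (hmono : Monotone f) {a b : ℝ} (hab : a ≤ b) :
    (b - a) * f a ≤ prim f b - prim f a := by
  rw [prim_sub hf]
  calc (b - a) * f a = ∫ _ in a..b, f a := by simp
    _ ≤ _ := intervalIntegral.integral_mono_on hab (by simp) (hf.intervalIntegrable _ _)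
      fun s hs => hmono hs.1

lemma prim_sub_le_mul (hf : Continuous f) (hmono : Monotone f) {a b : ℝ} (hab : a ≤ b) :
    prim f b - prim f a ≤ (b - a) * f b := by
  rw [prim_sub hf]
  calc _ ≤ ∫ _ in a..b, f b := intervalIntegral.integral_mono_on hab
          (hf.intervalIntegrable _ _) (by simp) fun s hs => hmono hs.2
    _ = (b - a) * f b := by simp

lemma two_mul_prim_le (hf : Continuous f) (hmono : Monotone f) {a : ℝ} (ha : 0 ≤ a) :
    2 * prim f a ≤ prim f (2 * a) := by
  have h1 := mul_le_prim_sub hf hmono (a := a) (b := 2 * a) (by linarith)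
  have h2 := prim_sub_le_mul hf hmono ha
  have h3 : prim f 0 = 0 := by simp [prim]
  linarith

/-- The Keller-Osserman primitive, with integrand frozen below `b`. -/
def koPrim (f : ℝ → ℝ) (b t : ℝ) : ℝ := ∫ s in b..t, (√(prim f (max s b)))⁻¹

variable {b : ℝ}

lemma sqrt_prim_max_pos (hf : Continuous f) (hf0 : ∀ t, 0 ≤ f t) (hb : 0 < prim f b) (s : ℝ) :
    0 < √(prim f (max s b)) :=
  Real.sqrt_pos.2 (hb.trans_le (monotone_prim hf hf0 (le_max_right _ _)))

lemma continuous_koIntegrand (hf : Continuous f) (hf0 : ∀ t, 0 ≤ f t) (hb : 0 < prim f b) :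
    Continuous fun s => (√(prim f (max s b)))⁻¹ :=
  Continuous.inv₀ ((continuous_prim hf).comp (continuous_id.max continuous_const)).sqrt
    fun s => (sqrt_prim_max_pos hf hf0 hb s).ne'

lemma hasDerivAt_koPrim (hf : Continuous f) (hf0 : ∀ t, 0 ≤ f t) (hb : 0 < prim f b) (t : ℝ) :
    HasDerivAt (koPrim f b) (√(prim f (max t b)))⁻¹ t :=
  have hc := continuous_koIntegrand hf hf0 hb
  intervalIntegral.integral_hasDerivAt_right (hc.intervalIntegrable _ _)
    (hc.stronglyMeasurableAtFilter _ _) hc.continuousAt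

lemma continuous_koPrim (hf : Continuous f) (hf0 : ∀ t, 0 ≤ f t) (hb : 0 < prim f b) :
    Continuous (koPrim f b) :=
  continuous_iff_continuousAt.2 fun t => (hasDerivAt_koPrim hf hf0 hb t).continuousAt

lemma monotone_koPrim (hf : Continuous f) (hf0 : ∀ t, 0 ≤ f t) (hb : 0 < prim f b) :
    Monotone (koPrim f b) :=
  monotone_of_deriv_nonneg (fun t => (hasDerivAt_koPrim hf hf0 hb t).differentiableAt) fun t => by
    rw [(hasDerivAt_koPrim hf hf0 hb t).deriv]
    positivity

end Primitive

section RadialODE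

variable {f q : ℝ → ℝ} {m c r : ℝ}

lemma hasDerivAt_slope (hm : 1 < m) (hq : Continuous q) {ρ : ℝ} (hρ : 0 < ρ) :
    HasDerivAt (fun ρ => ρ * radialMean m q ρ) (q ρ - (m - 1) * radialMean m q ρ) ρ := by
  refine ((hasDerivAt_id ρ).mul (hasDerivAt_radialMean hm hq hρ)).congr_deriv ?_
  simp only [id]
  field_simp
  ring

lemma hasDerivAt_radialSol_of_pos (hm : 1 < m) (hq : Continuous q) {ρ : ℝ} (hρ : 0 < ρ) :
    HasDerivAt (radialSol m q c) (ρ * radialMean m q ρ) ρ := by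
  have := hasDerivAt_radialSol hm hq c ρ
  rwa [abs_of_pos hρ] at this

/-- A solution of the radial equation satisfies the upper energy bound. -/
lemma slope_sq_le_energy (hm : 1 < m) (hq : Continuous q) (hq0 : ∀ t, 0 ≤ q t) (hc : 0 ≤ c)
    (hf : Continuous f) (hf0 : ∀ t, 0 ≤ f t)
    (h : ∀ ρ ∈ Set.Icc 0 r, q ρ = f (radialSol m q c ρ)) {ρ : ℝ} (hρ : ρ ∈ Set.Icc 0 r) :
    (ρ * radialMean m q ρ) ^ 2 ≤ 2 * prim f (radialSol m q c ρ) := by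
  set F : ℝ → ℝ := fun ρ => 2 * prim f (radialSol m q c ρ) - (ρ * radialMean m q ρ) ^ 2 with hF
  have hFc : Continuous F :=
    (((continuous_prim hf).comp (continuous_radialSol hm hq c)).const_mul 2).sub
      ((continuous_id.mul (continuous_radialMean hm hq)).pow 2)
  have hder : ∀ t ∈ Set.Ioo 0 r, HasDerivAt F
      (2 * (t * radialMean m q t) * ((m - 1) * radialMean m q t)) t := by
    intro t ht
    have h1 := ((hasDerivAt_prim hf (radialSol m q c t)).comp t
      (hasDerivAt_radialSol_of_pos hm hq ht.1)).const_mul 2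
    have h2 := (hasDerivAt_slope hm hq ht.1).pow 2
    refine (h1.sub h2).congr_deriv ?_
    rw [h t ⟨ht.1.le, ht.2.le⟩]
    ring
  have hmono : MonotoneOn F (Set.Icc 0 r) := by
    refine monotoneOn_of_deriv_nonneg (convex_Icc _ _) hFc.continuousOn ?_ ?_
    · rw [interior_Icc]
      exact fun t ht => (hder t ht).differentiableAt.differentiableWithinAt
    · rw [interior_Icc]
      intro t ht
      rw [(hder t ht).deriv]
      have := radialMean_nonneg (m := m) hq0 t
      have := ht.1
      have : 0 ≤ m - 1 := by linarith
      positivity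
  have h0 := hmono ⟨le_rfl, hρ.1.trans hρ.2⟩ hρ hρ.1
  have h1 : 0 ≤ F 0 := by
    simp only [hF, radialSol_zero]
    have := prim_nonneg hf0 hc
    simp
    exact this
  have h2 := h1.trans h0
  simp only [hF] at h2
  linarith

/-- The Keller-Osserman primitive grows at most linearly along radial solutions. -/
lemma koPrim_radialSol_le (hm : 1 < m) (hr : 0 ≤ r) (hq : Continuous q) (hq0 : ∀ t, 0 ≤ q t)
    (hc : 0 ≤ c) (hf : Continuous f) (hf0 : ∀ t, 0 ≤ f t)
    (h : ∀ ρ ∈ Set.Icc 0 r, q ρ = f (radialSol m q c ρ)) {b : ℝ} (hb : 0 < prim f b) :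
    koPrim f b (radialSol m q c r) ≤ koPrim f b c + √2 * r := by
  set F : ℝ → ℝ := fun ρ => √2 * ρ - koPrim f b (radialSol m q c ρ) with hF
  have hFc : Continuous F := (continuous_const.mul continuous_id).sub
    ((continuous_koPrim hf hf0 hb).comp (continuous_radialSol hm hq c))
  have hder : ∀ t ∈ Set.Ioo 0 r, HasDerivAt F
      (√2 - (√(prim f (max (radialSol m q c t) b)))⁻¹ * (t * radialMean m q t)) t := by
    intro t ht
    have h1 := (hasDerivAt_koPrim hf hf0 hb (radialSol m q c t)).comp t
      (hasDerivAt_radialSol_of_pos hm hq ht.1)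
    have h2 := ((hasDerivAt_id t).const_mul √2).sub h1
    exact h2.congr_deriv (by simp)
  have hmono : MonotoneOn F (Set.Icc 0 r) := by
    refine monotoneOn_of_deriv_nonneg (convex_Icc _ _) hFc.continuousOn ?_ ?_
    · rw [interior_Icc]
      exact fun t ht => (hder t ht).differentiableAt.differentiableWithinAt
    · rw [interior_Icc]
      intro t ht
      rw [(hder t ht).deriv]
      have hpos := sqrt_prim_max_pos hf hf0 hb (radialSol m q c t)
      have h1 := slope_sq_le_energy hm hq hq0 hc hf hf0 h ⟨ht.1.le, ht.2.le⟩
      have h2 : t * radialMean m q t ≤ √2 * √(prim f (max (radialSol m q c t) b)) := by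
        rw [← Real.sqrt_mul (by norm_num)]
        refine Real.le_sqrt_of_sq_le (h1.trans ?_)
        have := monotone_prim hf hf0 (le_max_left (radialSol m q c t) b)
        linarith
      rw [sub_nonneg, inv_mul_le_iff₀ hpos]
      linarith
  have h0 := hmono ⟨le_rfl, hr⟩ ⟨hr, le_rfl⟩ hr
  simp only [hF, radialSol_zero, mul_zero] at h0
  linarith

lemma monotoneOn_source (hm : 1 < m) (hq : Continuous q) (hq0 : ∀ t, 0 ≤ q t)
    (hmonof : Monotone f) (h : ∀ ρ ∈ Set.Icc 0 r, q ρ = f (radialSol m q c ρ)) :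
    MonotoneOn q (Set.Icc 0 r) := by
  intro s hs t ht hst
  rw [h s hs, h t ht]
  exact hmonof (monotoneOn_radialSol hm hq hq0 c hs.1 ht.1 hst)

lemma radialMean_le_div (hm : 1 < m) (hq : Continuous q) (hmono : MonotoneOn q (Set.Icc 0 r))
    {ρ : ℝ} (hρ : ρ ∈ Set.Icc 0 r) : radialMean m q ρ ≤ q ρ / m := by
  have h1 : radialMean m (fun _ => q ρ) 0 = q ρ / m := radialMean_zero (q := fun _ => q ρ) hm
  rw [← h1]
  have hcont : Continuous fun τ : ℝ => τ ^ (m - 1) :=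
    Real.continuous_rpow_const (by linarith)
  refine intervalIntegral.integral_mono_on zero_le_one
    ((hcont.mul (by fun_prop)).intervalIntegrable _ _)
    ((hcont.mul continuous_const).intervalIntegrable _ _) fun τ hτ => ?_
  refine mul_le_mul_of_nonneg_left (hmono ⟨mul_nonneg hρ.1 hτ.1, ?_⟩ hρ ?_)
    (Real.rpow_nonneg hτ.1 _)
  · exact (mul_le_of_le_one_right hρ.1 hτ.2).trans hρ.2
  · exact mul_le_of_le_one_right hρ.1 hτ.2

lemma div_le_deriv_slope (hm : 1 < m) (hq : Continuous q) (hmono : MonotoneOn q (Set.Icc 0 r))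
    {ρ : ℝ} (hρ : ρ ∈ Set.Icc 0 r) : q ρ / m ≤ q ρ - (m - 1) * radialMean m q ρ := by
  have h1 := mul_le_mul_of_nonneg_left (radialMean_le_div hm hq hmono hρ)
    (by linarith : 0 ≤ m - 1)
  have h2 : (m - 1) * (q ρ / m) = q ρ - q ρ / m := by
    field_simp
  linarith

lemma monotoneOn_of_hasDerivAt_nonneg {F F' : ℝ → ℝ} {a b : ℝ} (hF : Continuous F)
    (hder : ∀ t ∈ Set.Ioo a b, HasDerivAt F (F' t) t) (h0 : ∀ t ∈ Set.Ioo a b, 0 ≤ F' t) :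
    MonotoneOn F (Set.Icc a b) := by
  refine monotoneOn_of_deriv_nonneg (convex_Icc _ _) hF.continuousOn ?_ ?_ <;> rw [interior_Icc]
  · exact fun t ht => (hder t ht).differentiableAt.differentiableWithinAt
  · intro t ht
    rw [(hder t ht).deriv]
    exact h0 t ht

lemma continuous_slope (hm : 1 < m) (hq : Continuous q) :
    Continuous fun ρ => ρ * radialMean m q ρ :=
  continuous_id.mul (continuous_radialMean hm hq)

/-- Quadratic growth of radial solutions after the radius `ρ₀`. -/
lemma radialSol_quadratic_growth (hm : 1 < m) (hq : Continuous q) (hq0 : ∀ t, 0 ≤ q t)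
    (hmono : MonotoneOn q (Set.Icc 0 r)) {ρ₀ ρ : ℝ} (h0 : 0 ≤ ρ₀) (hρ : ρ ∈ Set.Icc ρ₀ r) :
    radialSol m q c ρ₀ + (ρ - ρ₀) ^ 2 * (q ρ₀ / (2 * m)) ≤ radialSol m q c ρ := by
  have hle : ∀ t ∈ Set.Ioo ρ₀ r, 0 < t ∧ t ∈ Set.Icc 0 r := fun t ht =>
    ⟨h0.trans_lt ht.1, h0.trans ht.1.le, ht.2.le⟩
  have hρ₀ : ρ₀ ∈ Set.Icc 0 r := ⟨h0, hρ.1.trans hρ.2⟩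
  have hend : ρ₀ ∈ Set.Icc ρ₀ r := ⟨le_rfl, hρ.1.trans hρ.2⟩
  have hslope : ∀ t ∈ Set.Icc ρ₀ r, (t - ρ₀) * (q ρ₀ / m) ≤ t * radialMean m q t := by
    intro t ht
    have := monotoneOn_of_hasDerivAt_nonneg (a := ρ₀) (b := r)
      (F := fun t => t * radialMean m q t - t * (q ρ₀ / m))
      (F' := fun t => q t - (m - 1) * radialMean m q t - q ρ₀ / m)
      ((continuous_slope hm hq).sub (by fun_prop))
      (fun s hs => by
        have := (hasDerivAt_slope hm hq (hle s hs).1).sub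
          ((hasDerivAt_id s).mul_const (q ρ₀ / m))
        exact this.congr_deriv (by simp))
      (fun s hs => by
        have h1 := div_le_deriv_slope hm hq hmono (hle s hs).2
        have h2 : q ρ₀ / m ≤ q s / m := by
          gcongr
          exact hmono hρ₀ (hle s hs).2 hs.1.le
        linarith) hend ht ht.1
    simp only at this
    have h3 := mul_nonneg h0 (radialMean_nonneg (m := m) hq0 ρ₀)
    linarith
  have := monotoneOn_of_hasDerivAt_nonneg (a := ρ₀) (b := r)
    (F := fun t => radialSol m q c t - (t - ρ₀) ^ 2 * (q ρ₀ / (2 * m)))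
    (F' := fun t => t * radialMean m q t - (t - ρ₀) * (q ρ₀ / m))
    ((continuous_radialSol hm hq c).sub (by fun_prop))
    (fun s hs => by
      have := (hasDerivAt_radialSol_of_pos (c := c) hm hq (hle s hs).1).sub
        ((((hasDerivAt_id s).sub_const ρ₀).pow 2).mul_const (q ρ₀ / (2 * m)))
      refine this.congr_deriv ?_
      simp
      field_simp)
    (fun s hs => by
      have := hslope s ⟨hs.1.le, hs.2.le⟩
      linarith) hend hρ hρ.1
  simp only [sub_self] at this
  linarith

/-- Lower energy bound for radial solutions. -/
lemma energy_le_slope_sq (hm : 1 < m) (hq : Continuous q) (hq0 : ∀ t, 0 ≤ q t)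
    (hf : Continuous f) (hmonof : Monotone f)
    (h : ∀ ρ ∈ Set.Icc 0 r, q ρ = f (radialSol m q c ρ)) {ρ₀ ρ : ℝ} (h0 : 0 ≤ ρ₀)
    (hρ : ρ ∈ Set.Icc ρ₀ r) :
    2 / m * (prim f (radialSol m q c ρ) - prim f (radialSol m q c ρ₀))
      ≤ (ρ * radialMean m q ρ) ^ 2 := by
  have hle : ∀ t ∈ Set.Ioo ρ₀ r, 0 < t ∧ t ∈ Set.Icc 0 r := fun t ht =>
    ⟨h0.trans_lt ht.1, h0.trans ht.1.le, ht.2.le⟩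
  have hmono := monotoneOn_source hm hq hq0 hmonof h
  have := monotoneOn_of_hasDerivAt_nonneg (a := ρ₀) (b := r)
    (F := fun t => (t * radialMean m q t) ^ 2 - 2 / m * prim f (radialSol m q c t))
    (F' := fun t => 2 * (t * radialMean m q t) *
      (q t - (m - 1) * radialMean m q t - q t / m))
    (((continuous_slope hm hq).pow 2).sub
      (((continuous_prim hf).comp (continuous_radialSol hm hq c)).const_mul _))
    (fun s hs => by
      have h1 := ((hasDerivAt_prim hf (radialSol m q c s)).comp s
        (hasDerivAt_radialSol_of_pos hm hq (hle s hs).1)).const_mul (2 / m)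
      have h2 := (hasDerivAt_slope hm hq (hle s hs).1).pow 2
      refine (h2.sub h1).congr_deriv ?_
      rw [h s (hle s hs).2]
      ring)
    (fun s hs => by
      have h1 := div_le_deriv_slope hm hq hmono (hle s hs).2
      have h2 := mul_nonneg (hle s hs).1.le (radialMean_nonneg (m := m) hq0 s)
      exact mul_nonneg (by linarith) (by linarith)) ⟨le_rfl, hρ.1.trans hρ.2⟩ hρ hρ.1
  simp only at this
  have h1 := sq_nonneg (ρ₀ * radialMean m q ρ₀)
  linarith

/-- Once doubled, a radial solution makes the Keller-Osserman primitive grow linearly. -/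
lemma le_koPrim_radialSol (hm : 1 < m) (hq : Continuous q) (hq0 : ∀ t, 0 ≤ q t) (hc : 0 ≤ c)
    (hf : Continuous f) (hf0 : ∀ t, 0 ≤ f t) (hmonof : Monotone f)
    (h : ∀ ρ ∈ Set.Icc 0 r, q ρ = f (radialSol m q c ρ)) {b : ℝ} (hb : 0 < prim f b)
    {ρ₀ ρ₁ : ℝ} (h0 : 0 ≤ ρ₀) (h01 : ρ₀ ≤ ρ₁) (h1r : ρ₁ ≤ r) (hbv : b ≤ radialSol m q c ρ₁)
    (hdouble : 2 * radialSol m q c ρ₀ ≤ radialSol m q c ρ₁) :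
    (r - ρ₁) * (√m)⁻¹ ≤ koPrim f b (radialSol m q c r) - koPrim f b (radialSol m q c ρ₁) := by
  have hle : ∀ t ∈ Set.Ioo ρ₁ r, 0 < t ∧ t ∈ Set.Icc ρ₀ r := fun t ht =>
    ⟨(h0.trans h01).trans_lt ht.1, h01.trans ht.1.le, ht.2.le⟩
  have hmv := monotoneOn_radialSol hm hq hq0 c
  have := monotoneOn_of_hasDerivAt_nonneg (a := ρ₁) (b := r)
    (F := fun t => koPrim f b (radialSol m q c t) - t * (√m)⁻¹)
    (F' := fun t => (√(prim f (max (radialSol m q c t) b)))⁻¹ * (t * radialMean m q t) - (√m)⁻¹)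
    (((continuous_koPrim hf hf0 hb).comp (continuous_radialSol hm hq c)).sub (by fun_prop))
    (fun s hs => by
      have h1 := (hasDerivAt_koPrim hf hf0 hb (radialSol m q c s)).comp s
        (hasDerivAt_radialSol_of_pos hm hq (hle s hs).1)
      exact (h1.sub ((hasDerivAt_id s).mul_const (√m)⁻¹)).congr_deriv (by simp))
    (fun s hs => by
      have hs0 := (hle s hs).1.le
      have hvs : radialSol m q c ρ₁ ≤ radialSol m q c s := hmv (h0.trans h01) hs0 hs.1.le
      have hpos := sqrt_prim_max_pos hf hf0 hb (radialSol m q c s)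
      rw [max_eq_left (hbv.trans hvs)] at hpos ⊢
      have hE := energy_le_slope_sq hm hq hq0 hf hmonof h h0 (hle s hs).2
      have hv0 : 0 ≤ radialSol m q c ρ₀ := by
        refine hc.trans ?_
        have := hmv (Set.self_mem_Ici) h0 h0
        rwa [radialSol_zero] at this
      have hhalf : 2 * prim f (radialSol m q c ρ₀) ≤ prim f (radialSol m q c s) :=
        (two_mul_prim_le hf hmonof hv0).trans (monotone_prim hf hf0 (hdouble.trans hvs))
      have h3 : prim f (radialSol m q c s) / m ≤ (s * radialMean m q s) ^ 2 := by
        refine le_trans ?_ hE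
        rw [div_mul_eq_mul_div]
        gcongr
        linarith
      have h4 : √(prim f (radialSol m q c s)) / √m ≤ s * radialMean m q s := by
        rw [← Real.sqrt_div' _ (by linarith)]
        exact (Real.sqrt_le_left (mul_nonneg hs0 (radialMean_nonneg hq0 s))).2 h3
      rw [sub_nonneg, inv_mul_eq_div, le_div_iff₀ hpos, inv_mul_eq_div]
      exact h4) ⟨le_rfl, h1r⟩ ⟨h1r, le_rfl⟩ h1r
  simp only at this
  linarith

end RadialODE

section KellerOsserman

variable {f : ℝ → ℝ} {b : ℝ}

lemma koIntegrand_eq (hf : Continuous f) (hf0 : ∀ t, 0 ≤ f t) (hb : 0 < prim f b) {t : ℝ}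
    (ht : t ∈ Set.Ioi b) :
    (ENNReal.ofReal √(prim f t))⁻¹ = ENNReal.ofReal (√(prim f (max t b)))⁻¹ := by
  rw [ENNReal.ofReal_inv_of_pos (sqrt_prim_max_pos hf hf0 hb t), max_eq_left (le_of_lt ht)]

/-- Boundedness of the Keller-Osserman primitive gives the Keller-Osserman condition. -/
lemma lintegral_lt_top_of_koPrim_le (hf : Continuous f) (hf0 : ∀ t, 0 ≤ f t)
    (hb : 0 < prim f b) {C : ℝ} (hC : ∀ n : ℕ, koPrim f b n ≤ C) :
    ∫⁻ t in Set.Ioi b, (ENNReal.ofReal √(prim f t))⁻¹ < ⊤ := by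
  have hc := continuous_koIntegrand hf hf0 hb
  have hint : IntegrableOn (fun s => (√(prim f (max s b)))⁻¹) (Set.Ioi b) := by
    refine integrableOn_Ioi_of_intervalIntegral_norm_bounded C b
      (fun n : ℕ => hc.integrableOn_Ioc) tendsto_natCast_atTop_atTop ?_
    refine Eventually.of_forall fun n => le_trans (le_of_eq ?_) (hC n)
    refine intervalIntegral.integral_congr fun t _ => ?_
    exact Real.norm_of_nonneg (inv_nonneg.2 (Real.sqrt_nonneg _))
  rw [setLIntegral_congr_fun measurableSet_Ioi fun t ht => koIntegrand_eq hf hf0 hb ht]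
  exact Integrable.lintegral_lt_top hint

/-- The Keller-Osserman condition forces the primitive to be positive. -/
lemma prim_pos_of_lintegral_lt_top (hf : Continuous f) (hf0 : ∀ t, 0 ≤ f t) {a : ℝ}
    (ha : ∫⁻ t in Set.Ioi a, (ENNReal.ofReal √(prim f t))⁻¹ < ⊤) (hab : a < b) :
    0 < prim f b := by
  by_contra! h
  refine ha.ne (top_le_iff.1 ?_)
  calc (⊤ : ℝ≥0∞) = ∫⁻ _ in Set.Ioc a b, ⊤ := by simp [hab]
    _ = ∫⁻ t in Set.Ioc a b, (ENNReal.ofReal √(prim f t))⁻¹ := by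
      refine setLIntegral_congr_fun measurableSet_Ioc fun t ht => ?_
      simp [Real.sqrt_eq_zero_of_nonpos ((monotone_prim hf hf0 ht.2).trans h)]
    _ ≤ _ := lintegral_mono_set Set.Ioc_subset_Ioi_self

/-- Under the Keller-Osserman condition the Keller-Osserman primitive converges. -/
lemma exists_tendsto_koPrim (hf : Continuous f) (hf0 : ∀ t, 0 ≤ f t) {a : ℝ}
    (ha : ∫⁻ t in Set.Ioi a, (ENNReal.ofReal √(prim f t))⁻¹ < ⊤) (hab : a < b) :
    ∃ L, Tendsto (koPrim f b) atTop (𝓝 L) := by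
  have hb := prim_pos_of_lintegral_lt_top hf hf0 ha hab
  have hc := continuous_koIntegrand hf hf0 hb
  have hint : IntegrableOn (fun s => (√(prim f (max s b)))⁻¹) (Set.Ioi b) := by
    refine ⟨hc.aestronglyMeasurable, ?_⟩
    rw [hasFiniteIntegral_iff_ofReal (ae_of_all _ fun t => inv_nonneg.2 (Real.sqrt_nonneg _)),
      ← setLIntegral_congr_fun measurableSet_Ioi fun t ht => koIntegrand_eq hf hf0 hb ht]
    exact (lintegral_mono_set (Set.Ioi_subset_Ioi hab.le)).trans_lt ha
  exact ⟨_, intervalIntegral_tendsto_integral_Ioi b hint tendsto_id⟩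

lemma koPrim_sub (hf : Continuous f) (hf0 : ∀ t, 0 ≤ f t) (hb : 0 < prim f b) (s t : ℝ) :
    koPrim f b t - koPrim f b s = ∫ x in s..t, (√(prim f (max x b)))⁻¹ :=
  have hc := continuous_koIntegrand hf hf0 hb
  intervalIntegral.integral_interval_sub_left (hc.intervalIntegrable _ _)
    (hc.intervalIntegrable _ _)

/-- Under the Keller-Osserman condition the nonlinearity is superlinear. -/
lemma tendsto_div_atTop_of_koPrim (hf : Continuous f) (hf0 : ∀ t, 0 ≤ f t) (hmono : Monotone f)
    (hb0 : 0 < b) (hb : 0 < prim f b) {L : ℝ} (hL : Tendsto (koPrim f b) atTop (𝓝 L)) :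
    Tendsto (fun a => f a / a) atTop atTop := by
  have h1 : Tendsto (fun a => koPrim f b a - koPrim f b (a / 2)) atTop (𝓝 0) := by
    have := hL.sub (hL.comp (tendsto_id.atTop_div_const (two_pos : (0 : ℝ) < 2)))
    simpa using this
  have hle : ∀ a, b ≤ a → 0 < f a ∧ (√(f a / a))⁻¹ / 2 ≤ koPrim f b a - koPrim f b (a / 2) := by
    intro a ha
    have ha0 : 0 < a := hb0.trans_le ha
    have hp : prim f a ≤ a * f a := by
      have := prim_sub_le_mul hf hmono ha0.le
      simpa [prim] using this
    have hpa : 0 < prim f a := hb.trans_le (monotone_prim hf hf0 ha)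
    have hfa : 0 < f a := by
      by_contra! h
      have := mul_nonpos_of_nonneg_of_nonpos ha0.le h
      linarith
    refine ⟨hfa, ?_⟩
    rw [koPrim_sub hf hf0 hb]
    calc (√(f a / a))⁻¹ / 2 = ∫ _ in (a / 2)..a, (√(a * f a))⁻¹ := by
          rw [intervalIntegral.integral_const, smul_eq_mul, Real.sqrt_div' _ ha0.le,
            Real.sqrt_mul ha0.le]
          have h3 : √a * √a = a := Real.mul_self_sqrt ha0.le
          have h4 : 0 < √a := Real.sqrt_pos.2 ha0
          have h5 : 0 < √(f a) := Real.sqrt_pos.2 hfa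
          field_simp
          nlinarith
      _ ≤ _ := by
        refine intervalIntegral.integral_mono_on (by linarith) (by simp)
          ((continuous_koIntegrand hf hf0 hb).intervalIntegrable _ _) fun s hs => ?_
        refine inv_anti₀ (sqrt_prim_max_pos hf hf0 hb s) (Real.sqrt_le_sqrt ?_)
        exact (monotone_prim hf hf0 (max_le hs.2 ha)).trans hp
  have h2 : Tendsto (fun a => (√(f a / a))⁻¹) atTop (𝓝[>] 0) := by
    refine tendsto_nhdsWithin_iff.2 ⟨?_, ?_⟩
    · refine squeeze_zero' (Eventually.of_forall fun a => by positivity) ?_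
        (by simpa using h1.const_mul 2)
      filter_upwards [eventually_ge_atTop b] with a ha
      have := (hle a ha).2
      linarith
    · filter_upwards [eventually_ge_atTop b] with a ha
      exact inv_pos.2 (Real.sqrt_pos.2 (div_pos (hle a ha).1 (hb0.trans_le ha)))
  have h3 := h2.inv_tendsto_nhdsGT_zero
  simp only [Pi.inv_def, inv_inv] at h3
  refine (h3.atTop_mul_atTop₀ h3).congr' ?_
  filter_upwards [eventually_ge_atTop b] with a ha
  exact Real.mul_self_sqrt (div_pos (hle a ha).1 (hb0.trans_le ha)).le

variable {m r : ℝ}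

/-- The Keller-Osserman estimate: radial solutions are locally bounded, independently of their
boundary values. -/
lemma exists_forall_radialSol_le (hm : 1 < m) (hf : Continuous f) (hf0 : ∀ t, 0 ≤ f t)
    (hmono : Monotone f) (hb0 : 0 < b) (hb : 0 < prim f b) {L : ℝ}
    (hL : Tendsto (koPrim f b) atTop (𝓝 L)) {ρ₀ : ℝ} (h0 : 0 ≤ ρ₀) (hρ₀ : ρ₀ < r) :
    ∃ A, ∀ (q : ℝ → ℝ) (c : ℝ), Continuous q → (∀ t, 0 ≤ q t) → 0 ≤ c →
      (∀ ρ ∈ Set.Icc 0 r, q ρ = f (radialSol m q c ρ)) → radialSol m q c ρ₀ ≤ A := by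
  set δ := (r - ρ₀) / 2 with hδ
  have hδ0 : 0 < δ := by rw [hδ]; linarith
  have hm0 : 0 < √m := Real.sqrt_pos.2 (by linarith)
  have e1 := (tendsto_div_atTop_of_koPrim hf hf0 hmono hb0 hb hL).eventually_ge_atTop
    (2 * m / δ ^ 2)
  have e2 : ∀ᶠ a in atTop, L - δ * (√m)⁻¹ < koPrim f b (2 * a) :=
    (hL.comp (tendsto_id.const_mul_atTop two_pos)).eventually
      (lt_mem_nhds (by have := mul_pos hδ0 (inv_pos.2 hm0); linarith))
  obtain ⟨A, hA⟩ := eventually_atTop.1 (e1.and (e2.and (eventually_ge_atTop b)))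
  refine ⟨A, fun q c hq hq0 hc h => ?_⟩
  by_contra! hlt
  obtain ⟨h1, h2, h3⟩ := hA _ hlt.le
  set a := radialSol m q c ρ₀ with ha
  have ha0 : 0 < a := hb0.trans_le h3
  have hρ₁ : ρ₀ + δ ∈ Set.Icc ρ₀ r := ⟨by linarith, by rw [hδ]; linarith⟩
  have hgrow := radialSol_quadratic_growth (c := c) hm hq hq0 (monotoneOn_source hm hq hq0 hmono h)
    h0 hρ₁
  have hdouble : 2 * a ≤ radialSol m q c (ρ₀ + δ) := by
    have h4 : a ≤ (ρ₀ + δ - ρ₀) ^ 2 * (q ρ₀ / (2 * m)) := by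
      rw [h ρ₀ ⟨h0, hρ₀.le⟩, ← ha, add_sub_cancel_left]
      rw [le_div_iff₀ ha0, div_mul_eq_mul_div, div_le_iff₀ (by positivity)] at h1
      have hm0' : 0 < 2 * m := by linarith
      rw [← mul_div_assoc, le_div_iff₀ hm0']
      linarith
    linarith
  have h5 := le_koPrim_radialSol hm hq hq0 hc hf hf0 hmono h hb h0 hρ₁.1 hρ₁.2
    (by linarith) hdouble
  have h6 := (monotone_koPrim hf hf0 hb).ge_of_tendsto hL (radialSol m q c r)
  have h7 := monotone_koPrim hf hf0 hb hdouble
  have h8 : r - (ρ₀ + δ) = δ := by rw [hδ]; ring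
  rw [h8] at h5
  linarith

end KellerOsserman

section Limit

variable {d : ℕ} {R : Finset (E d)} {k : E d → ℝ} {m : ℝ} {φ : ℝ → ℝ} {r : ℝ}

/-- A locally bounded pointwise limit of distributional solutions is a distributional solution. -/
lemma IsDunklSol.of_tendsto (hR0 : ∀ α ∈ R, α ≠ 0) (hk : ∀ α ∈ R, 0 < k α) (hr : 0 < r)
    (hφc : ContinuousOn φ (Set.Ici 0)) (hφmono : MonotoneOn φ (Set.Ici 0))
    (hφ0 : ∀ t, 0 ≤ t → 0 ≤ φ t) {U : ℕ → E d → ℝ} {u : E d → ℝ}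
    (hUs : ∀ n, IsDunklSol R k φ (Metric.ball 0 r) (U n))
    (hUc : ∀ n, ContinuousOn (U n) (Metric.ball 0 r))
    (hU0 : ∀ n, ∀ x ∈ Metric.ball 0 r, 0 ≤ U n x)
    (hlim : ∀ x ∈ Metric.ball 0 r, Tendsto (fun n => U n x) atTop (𝓝 (u x)))
    (hbdd : ∀ ρ < r, ∃ A, ∀ n x, ‖x‖ ≤ ρ → U n x ≤ A) :
    IsDunklSol R k φ (Metric.ball 0 r) u := by
  intro ψ hψ hc hs
  obtain ⟨ρ, -, hρ, h0⟩ := exists_norm_gt_eq_zero_of_tsupport_subset hc hr hs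
  obtain ⟨A, hA⟩ := hbdd ρ hρ
  have hsub : Metric.closedBall (0 : E d) ρ ⊆ Metric.ball 0 r := Metric.closedBall_subset_ball hρ
  have hu0 : ∀ x ∈ Metric.ball (0 : E d) r, 0 ≤ u x := fun x hx =>
    ge_of_tendsto' (hlim x hx) fun n => hU0 n x hx
  have hφU : ∀ n, ContinuousOn (fun x => φ (U n x)) (Metric.ball 0 r) := fun n =>
    hφc.comp (hUc n) fun x hx => hU0 n x hx
  have hL : Tendsto (fun n => ∫ x in Metric.ball 0 r, U n x * dunklLap R k ψ x * wk R k x) atTop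
      (𝓝 (∫ x in Metric.ball 0 r, u x * dunklLap R k ψ x * wk R k x)) := by
    refine tendsto_integral_of_dominated_convergence
      (fun x => A * ‖1 * dunklLap R k ψ x * wk R k x‖) (fun n => ?_) ?_ (fun n => ?_) ?_
    · exact (integrableOn_mul_dunklLap_mul_wk hR0 hk hψ hc h0 ((hUc n).mono hsub)
        measurableSet_ball).aestronglyMeasurable
    · exact (integrableOn_mul_dunklLap_mul_wk hR0 hk hψ hc h0 (u := fun _ => 1)
        continuousOn_const measurableSet_ball).norm.const_mul A
    · refine (ae_restrict_iff' measurableSet_ball).2 (ae_of_all _ fun x hx => ?_)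
      rcases le_or_gt ‖x‖ ρ with hxρ | hxρ
      · rw [mul_assoc, one_mul, norm_mul, Real.norm_of_nonneg (hU0 n x hx)]
        exact mul_le_mul_of_nonneg_right (hA n x hxρ) (norm_nonneg _)
      · simp [dunklLap_eq_zero_of_norm_gt h0 hxρ]
    · refine (ae_restrict_iff' measurableSet_ball).2 (ae_of_all _ fun x hx => ?_)
      exact ((hlim x hx).mul_const _).mul_const _
  have hRt : Tendsto (fun n => ∫ x in Metric.ball 0 r, φ (U n x) * ψ x * wk R k x) atTop
      (𝓝 (∫ x in Metric.ball 0 r, φ (u x) * ψ x * wk R k x)) := by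
    refine tendsto_integral_of_dominated_convergence
      (fun x => φ A * ‖1 * ψ x * wk R k x‖) (fun n => ?_) ?_ (fun n => ?_) ?_
    · exact (integrableOn_mul_mul_wk hk hψ.continuous h0 ((hφU n).mono hsub)
        measurableSet_ball).aestronglyMeasurable
    · exact (integrableOn_mul_mul_wk hk hψ.continuous h0 (u := fun _ => 1)
        continuousOn_const measurableSet_ball).norm.const_mul (φ A)
    · refine (ae_restrict_iff' measurableSet_ball).2 (ae_of_all _ fun x hx => ?_)
      have hn := hU0 n x hx
      rcases le_or_gt ‖x‖ ρ with hxρ | hxρ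
      · rw [mul_assoc, one_mul, norm_mul, Real.norm_of_nonneg (hφ0 _ hn)]
        exact mul_le_mul_of_nonneg_right
          (hφmono hn (hn.trans (hA n x hxρ)) (hA n x hxρ)) (norm_nonneg _)
      · simp [h0 x hxρ]
    · refine (ae_restrict_iff' measurableSet_ball).2 (ae_of_all _ fun x hx => ?_)
      refine (Tendsto.mul_const _ ?_).mul_const _
      exact ((hφc _ (hu0 x hx)).tendsto).comp (tendsto_nhdsWithin_iff.2
        ⟨hlim x hx, Eventually.of_forall fun n => hU0 n x hx⟩)
  refine tendsto_nhds_unique hL (hRt.congr fun n => ?_)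
  exact (hUs n ψ hψ hc hs).symm

/-- A pointwise limit of locally uniformly Lipschitz functions is continuous. -/
lemma continuousOn_ball_of_tendsto {U : ℕ → E d → ℝ} {u : E d → ℝ}
    (hlim : ∀ x ∈ Metric.ball 0 r, Tendsto (fun n => U n x) atTop (𝓝 (u x)))
    (hlip : ∀ ρ < r, ∃ K, ∀ n, LipschitzOnWith K (U n) (Metric.closedBall 0 ρ)) :
    ContinuousOn u (Metric.ball 0 r) := by
  intro x hx
  obtain ⟨ρ, hxρ, hρ⟩ := exists_between (show ‖x‖ < r by simpa using hx)
  obtain ⟨K, hK⟩ := hlip ρ hρ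
  have hsub : Metric.closedBall (0 : E d) ρ ⊆ Metric.ball 0 r := Metric.closedBall_subset_ball hρ
  have hu : LipschitzOnWith K u (Metric.closedBall 0 ρ) :=
    LipschitzOnWith.of_dist_le_mul fun y hy z hz =>
      le_of_tendsto' ((hlim y (hsub hy)).dist (hlim z (hsub hz)))
        fun n => (hK n).dist_le_mul y hy z hz
  have hnhds : Metric.closedBall (0 : E d) ρ ∈ 𝓝 x :=
    mem_of_superset (Metric.isOpen_ball.mem_nhds (show x ∈ Metric.ball 0 ρ by simpa using hxρ))
      Metric.ball_subset_closedBall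
  exact (hu.continuousOn.continuousAt hnhds).continuousWithinAt

variable {q f : ℝ → ℝ} {c : ℝ}

/-- Lipschitz bound for radial solutions. -/
lemma lipschitzOnWith_radialSol_norm (hm : 1 < m) (hq : Continuous q) (hq0 : ∀ t, 0 ≤ q t)
    (hmono : MonotoneOn q (Set.Icc 0 r)) {ρ : ℝ} (hρ : ρ ∈ Set.Icc 0 r) {M : ℝ} (hM : q ρ ≤ M) :
    LipschitzOnWith (ρ * (M / m)).toNNReal (fun x : E d => radialSol m q c ‖x‖)
      (Metric.closedBall 0 ρ) := by
  have h1 : LipschitzOnWith (ρ * (M / m)).toNNReal (radialSol m q c) (Set.Icc 0 ρ) := by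
    refine (convex_Icc 0 ρ).lipschitzOnWith_of_nnnorm_hasDerivWithin_le
      (fun t _ => (hasDerivAt_radialSol hm hq c t).hasDerivWithinAt) fun t ht => ?_
    have htr : t ∈ Set.Icc 0 r := ⟨ht.1, ht.2.trans hρ.2⟩
    rw [← NNReal.coe_le_coe, coe_nnnorm, abs_of_nonneg ht.1,
      Real.norm_of_nonneg (mul_nonneg ht.1 (radialMean_nonneg hq0 t))]
    refine le_trans ?_ (Real.le_coe_toNNReal _)
    have h3 := radialMean_le_div hm hq hmono htr
    have h4 : q t / m ≤ M / m := by
      gcongr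
      exact (hmono htr hρ ht.2).trans hM
    exact mul_le_mul ht.2 (h3.trans h4) (radialMean_nonneg hq0 t) hρ.1
  have h2 : LipschitzOnWith 1 (fun x : E d => ‖x‖) (Metric.closedBall 0 ρ) :=
    lipschitzWith_one_norm.lipschitzOnWith
  have := h1.comp h2 fun x hx => ⟨norm_nonneg x, by simpa using hx⟩
  rwa [mul_one] at this

end Limit

section Truncation

variable {φ : ℝ → ℝ}

/-- The extension of a function on the half-line by its value at the origin. -/
def extendZero (φ : ℝ → ℝ) (t : ℝ) : ℝ := φ (max t 0)

lemma extendZero_of_nonneg {t : ℝ} (ht : 0 ≤ t) : extendZero φ t = φ t := by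
  rw [extendZero, max_eq_left ht]

lemma continuous_extendZero (hφc : ContinuousOn φ (Set.Ici 0)) : Continuous (extendZero φ) :=
  hφc.comp_continuous (by fun_prop) fun t => le_max_right t 0

lemma monotone_extendZero (hφmono : MonotoneOn φ (Set.Ici 0)) : Monotone (extendZero φ) :=
  fun _ _ h => hφmono (Set.mem_Ici.2 (le_max_right _ _)) (Set.mem_Ici.2 (le_max_right _ _))
    (max_le_max_right 0 h)

lemma extendZero_nonneg (hφ0 : ∀ t, 0 ≤ t → 0 ≤ φ t) (t : ℝ) : 0 ≤ extendZero φ t :=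
  hφ0 _ (le_max_right _ _)

lemma prim_extendZero {t : ℝ} (ht : 0 ≤ t) : prim (extendZero φ) t = ∫ s in (0 : ℝ)..t, φ s := by
  refine intervalIntegral.integral_congr fun s hs => ?_
  rw [Set.uIcc_of_le ht] at hs
  exact extendZero_of_nonneg hs.1

lemma lintegral_extendZero {a : ℝ} (ha : 0 < a) :
    ∫⁻ t in Set.Ioi a, (ENNReal.ofReal √(prim (extendZero φ) t))⁻¹
      = ∫⁻ t in Set.Ioi a, (ENNReal.ofReal √(∫ s in (0 : ℝ)..t, φ s))⁻¹ := by
  refine setLIntegral_congr_fun measurableSet_Ioi fun t ht => ?_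
  simp only [prim_extendZero (φ := φ) (ha.trans ht).le]

end Truncation

section BlowUp

variable {d : ℕ} {R : Finset (E d)} {k : E d → ℝ} {m : ℝ} {φ : ℝ → ℝ} {r : ℝ} {q : ℝ → ℝ} {c : ℝ}

lemma continuous_radialSol_norm (hm : 1 < m) (hq : Continuous q) :
    Continuous fun x : E d => radialSol m q c ‖x‖ :=
  (continuous_radialSol hm hq c).comp continuous_norm

lemma le_radialSol (hm : 1 < m) (hq : Continuous q) (hq0 : ∀ t, 0 ≤ q t) {ρ : ℝ} (hρ : 0 ≤ ρ) :
    c ≤ radialSol m q c ρ := by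
  have := monotoneOn_radialSol hm hq hq0 c Set.self_mem_Ici hρ hρ
  rwa [radialSol_zero] at this

/-- The boundary values of a radial solution bound its central value under a blow-up solution. -/
lemma radialSol_center_le (hR0 : ∀ α ∈ R, α ≠ 0)
    (hRrefl : ∀ α ∈ R, ∀ β ∈ R, dunklReflect α β ∈ R) (hk : ∀ α ∈ R, 0 < k α)
    (hkinv : ∀ α ∈ R, ∀ β ∈ R, k (dunklReflect α β) = k β) (hm : m = d + ∑ α ∈ R, k α)
    (hm1 : 1 < m) (hr : 0 < r) (hφc : ContinuousOn φ (Set.Ici 0))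
    (hφmono : MonotoneOn φ (Set.Ici 0)) {u : E d → ℝ}
    (hu : ContinuousOn u (Metric.ball 0 r)) (hu0 : ∀ x ∈ Metric.ball 0 r, 0 ≤ u x)
    (hus : IsDunklSol R k φ (Metric.ball 0 r) u)
    (hb : ∀ z ∈ frontier (Metric.ball (0 : E d) r),
      Tendsto u (nhdsWithin z (Metric.ball (0 : E d) r)) atTop)
    (hq : Continuous q) (hq0 : ∀ t, 0 ≤ q t) (hc : 0 ≤ c)
    (h : ∀ ρ ∈ Set.Icc 0 r, q ρ = φ (radialSol m q c ρ)) : c ≤ u 0 := by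
  have key := IsDunklSol.le_of_boundary_le hR0 hRrefl hk hkinv hm hm1 hr hφc hφmono hu
    (V := fun x => radialSol m q c ‖x‖) (continuous_radialSol_norm hm1 hq).continuousOn hu0
    (fun x _ => hc.trans (le_radialSol hm1 hq hq0 (norm_nonneg x))) hus
    (isDunklSol_radialSol hR0 hRrefl hk hkinv hm hm1 hr hq fun t h0 h1 => h t ⟨h0, h1.le⟩)
    (fun z hz => by
      rw [frontier_ball _ hr.ne'] at hb
      have h1 := (hb z (by simpa using hz)).eventually_ge_atTop (radialSol m q c r)
      filter_upwards [h1, self_mem_nhdsWithin] with x hx hxr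
      refine le_trans ?_ hx
      simp only [Metric.mem_ball, dist_zero_right] at hxr
      exact monotoneOn_radialSol hm1 hq hq0 c (norm_nonneg x) hr.le hxr.le)
    0 (Metric.mem_ball_self hr)
  simpa [radialSol_zero] using key

/-- Existence of a blow-up solution implies the Keller-Osserman condition. -/
lemma exists_lintegral_lt_top_of_blowup (hR0 : ∀ α ∈ R, α ≠ 0)
    (hRrefl : ∀ α ∈ R, ∀ β ∈ R, dunklReflect α β ∈ R) (hk : ∀ α ∈ R, 0 < k α)
    (hkinv : ∀ α ∈ R, ∀ β ∈ R, k (dunklReflect α β) = k β) (hm : m = d + ∑ α ∈ R, k α)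
    (hm1 : 1 < m) (hr : 0 < r) (hφz : φ 0 = 0) (hφ0 : ∀ t, 0 ≤ t → 0 ≤ φ t)
    (hφlip : LocallyLipschitzOn (Set.Ici 0) φ)
    (hφmono : MonotoneOn φ (Set.Ici 0)) {u : E d → ℝ}
    (hu : ContinuousOn u (Metric.ball 0 r)) (hu0 : ∀ x ∈ Metric.ball 0 r, 0 ≤ u x)
    (hus : IsDunklSol R k φ (Metric.ball 0 r) u)
    (hb : ∀ z ∈ frontier (Metric.ball (0 : E d) r),
      Tendsto u (nhdsWithin z (Metric.ball (0 : E d) r)) atTop) :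
    ∃ a : ℝ, 0 < a ∧ ∫⁻ t in Set.Ioi a, (ENNReal.ofReal √(∫ s in (0 : ℝ)..t, φ s))⁻¹ < ⊤ := by
  have hφc := hφlip.continuousOn
  have hf := continuous_extendZero hφc
  have hf0 := extendZero_nonneg hφ0
  have hmono := monotone_extendZero hφmono
  have hpos : ∃ b, 0 < b ∧ 0 < prim (extendZero φ) b := by
    by_cases hzero : ∀ t, 0 ≤ t → φ t = 0
    · have hu00 := hu0 0 (Metric.mem_ball_self hr)
      have := radialSol_center_le (c := u 0 + 1) hR0 hRrefl hk hkinv hm hm1 hr hφc hφmono hu hu0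
        hus hb (q := fun _ => 0) continuous_const (fun _ => le_rfl) (by linarith)
        (fun ρ _ => by rw [radialSol_zero_fun, hzero _ (by linarith)])
      linarith
    · push Not at hzero
      obtain ⟨t, ht, hφt⟩ := hzero
      have h1 := mul_le_prim_sub hf hmono (a := t) (b := t + 1) (by linarith)
      have h2 := prim_nonneg hf0 ht
      have h3 : 0 < extendZero φ t := by
        rw [extendZero_of_nonneg ht]
        exact lt_of_le_of_ne (hφ0 t ht) hφt.symm
      exact ⟨t + 1, by linarith, by linarith⟩
  obtain ⟨b, hb0, hbp⟩ := hpos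
  refine ⟨b, hb0, ?_⟩
  rw [← lintegral_extendZero hb0]
  have hbound : ∀ n : ℕ, 0 < n →
      koPrim (extendZero φ) b n ≤ koPrim (extendZero φ) b (u 0) + √2 * r := by
    intro n hn
    obtain ⟨q, c, hq, hq0, hc, hn, h⟩ := exists_radialSol_eq hm1 hr hφz hφ0 hφlip
      (n := (n : ℝ)) (by exact_mod_cast hn)
    have hcu := radialSol_center_le hR0 hRrefl hk hkinv hm hm1 hr hφc hφmono hu hu0 hus hb hq hq0
      hc h
    have := koPrim_radialSol_le hm1 hr.le hq hq0 hc hf hf0 (fun ρ hρ => by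
      rw [h ρ hρ, extendZero_of_nonneg (hc.trans (le_radialSol hm1 hq hq0 hρ.1))]) hbp
    rw [hn] at this
    have hc' := monotone_koPrim hf hf0 hbp hcu
    linarith
  refine lintegral_lt_top_of_koPrim_le (C := koPrim (extendZero φ) b (u 0) + √2 * r) hf hf0 hbp
    fun n => ?_
  refine le_trans (monotone_koPrim hf hf0 hbp ?_) (hbound (n + 1) n.succ_pos)
  push_cast
  linarith

/-- The Keller-Osserman condition implies existence of a blow-up solution. -/
lemma exists_blowup_of_lintegral_lt_top (hR0 : ∀ α ∈ R, α ≠ 0)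
    (hRrefl : ∀ α ∈ R, ∀ β ∈ R, dunklReflect α β ∈ R) (hk : ∀ α ∈ R, 0 < k α)
    (hkinv : ∀ α ∈ R, ∀ β ∈ R, k (dunklReflect α β) = k β) (hm : m = d + ∑ α ∈ R, k α)
    (hm1 : 1 < m) (hr : 0 < r) (hφz : φ 0 = 0) (hφ0 : ∀ t, 0 ≤ t → 0 ≤ φ t)
    (hφlip : LocallyLipschitzOn (Set.Ici 0) φ)
    (hφmono : MonotoneOn φ (Set.Ici 0)) {a : ℝ} (ha : 0 < a)
    (hKO : ∫⁻ t in Set.Ioi a, (ENNReal.ofReal √(∫ s in (0 : ℝ)..t, φ s))⁻¹ < ⊤) :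
    ∃ u : E d → ℝ, ContinuousOn u (Metric.ball 0 r) ∧ (∀ x ∈ Metric.ball 0 r, 0 ≤ u x) ∧
      IsDunklSol R k φ (Metric.ball 0 r) u ∧
      ∀ z ∈ frontier (Metric.ball (0 : E d) r),
        Tendsto u (nhdsWithin z (Metric.ball (0 : E d) r)) atTop := by
  have hφc := hφlip.continuousOn
  have hf := continuous_extendZero hφc
  have hf0 := extendZero_nonneg hφ0
  have hmono := monotone_extendZero hφmono
  rw [← lintegral_extendZero ha] at hKO
  have hab : a < a + 1 := by linarith
  have hb := prim_pos_of_lintegral_lt_top hf hf0 hKO hab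
  obtain ⟨L, hL⟩ := exists_tendsto_koPrim hf hf0 hKO hab
  choose q c hq hq0 hc hn h using fun n : ℕ =>
    exists_radialSol_eq hm1 hr hφz hφ0 hφlip (n := (n + 1 : ℝ)) (by positivity)
  have hpos : ∀ n {ρ : ℝ}, 0 ≤ ρ → 0 ≤ radialSol m (q n) (c n) ρ := fun n ρ hρ =>
    (hc n).trans (le_radialSol hm1 (hq n) (hq0 n) hρ)
  have hf' : ∀ n, ∀ ρ ∈ Set.Icc 0 r, q n ρ = extendZero φ (radialSol m (q n) (c n) ρ) :=
    fun n ρ hρ => by rw [h n ρ hρ, extendZero_of_nonneg (hpos n hρ.1)]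
  have hbdd : ∀ ρ, 0 ≤ ρ → ρ < r → ∃ A, ∀ n, radialSol m (q n) (c n) ρ ≤ A := fun ρ h0 h1 => by
    obtain ⟨A, hA⟩ := exists_forall_radialSol_le hm1 hf hf0 hmono (by linarith) hb hL h0 h1
    exact ⟨A, fun n => hA _ _ (hq n) (hq0 n) (hc n) (hf' n)⟩
  set U : ℕ → E d → ℝ := fun n x => radialSol m (q n) (c n) ‖x‖ with hU
  have hUc : ∀ n, Continuous (U n) := fun n => continuous_radialSol_norm hm1 (hq n)
  have hU0 : ∀ n x, 0 ≤ U n x := fun n x => hpos n (norm_nonneg x)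
  have hUs : ∀ n, IsDunklSol R k φ (Metric.ball 0 r) (U n) := fun n =>
    isDunklSol_radialSol hR0 hRrefl hk hkinv hm hm1 hr (hq n) fun t h0 h1 => h n t ⟨h0, h1.le⟩
  have hstep : ∀ n, ∀ x ∈ Metric.ball (0 : E d) r, U n x ≤ U (n + 1) x := fun n => by
    refine IsDunklSol.le_of_boundary_le hR0 hRrefl hk hkinv hm hm1 hr hφc hφmono
      (hUc (n + 1)).continuousOn (hUc n).continuousOn (fun x _ => hU0 _ x) (fun x _ => hU0 _ x)
      (hUs (n + 1)) (hUs n) fun z hz => ?_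
    have hlt : U n z < U (n + 1) z := by
      simp only [hU, hz, hn]
      push_cast
      linarith
    exact (((hUc n).tendsto z).eventually_lt ((hUc (n + 1)).tendsto z) hlt).filter_mono
      nhdsWithin_le_nhds |>.mono fun _ hx => hx.le
  have hUmono : ∀ x ∈ Metric.ball (0 : E d) r, Monotone fun n => U n x := fun x hx =>
    monotone_nat_of_le_succ fun n => hstep n x hx
  have hUb : ∀ x ∈ Metric.ball (0 : E d) r, BddAbove (Set.range fun n => U n x) := fun x hx => by
    obtain ⟨A, hA⟩ := hbdd ‖x‖ (norm_nonneg x) (by simpa using hx)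
    exact ⟨A, Set.forall_mem_range.2 hA⟩
  have hlim : ∀ x ∈ Metric.ball (0 : E d) r, Tendsto (fun n => U n x) atTop (𝓝 (⨆ n, U n x)) :=
    fun x hx => tendsto_atTop_ciSup (hUmono x hx) (hUb x hx)
  refine ⟨fun x => ⨆ n, U n x, continuousOn_ball_of_tendsto hlim fun ρ hρ => ?_,
    fun x _ => Real.iSup_nonneg fun n => hU0 n x,
    IsDunklSol.of_tendsto hR0 hk hr hφc hφmono hφ0 hUs (fun n => (hUc n).continuousOn)
      (fun n x _ => hU0 n x) hlim fun ρ hρ => ?_, fun z hz => ?_⟩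
  · rcases lt_or_ge ρ 0 with hneg | hnn
    · exact ⟨0, fun n => by simp [Metric.closedBall_eq_empty.2 hneg]⟩
    · obtain ⟨A, hA⟩ := hbdd ρ hnn hρ
      refine ⟨_, fun n => lipschitzOnWith_radialSol_norm hm1 (hq n) (hq0 n)
        (monotoneOn_source hm1 (hq n) (hq0 n) hmono (hf' n)) ⟨hnn, hρ.le⟩
        (M := extendZero φ A) ?_⟩
      rw [hf' n ρ ⟨hnn, hρ.le⟩]
      exact hmono (hA n)
  · rcases lt_or_ge ρ 0 with hneg | hnn
    · exact ⟨0, fun n x hx => absurd (norm_nonneg x) (by linarith)⟩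
    · obtain ⟨A, hA⟩ := hbdd ρ hnn hρ
      exact ⟨A, fun n x hx => le_trans
        (monotoneOn_radialSol hm1 (hq n) (hq0 n) (c n) (norm_nonneg x) hnn hx) (hA n)⟩
  · rw [frontier_ball _ hr.ne'] at hz
    have hz' : ‖z‖ = r := by simpa using hz
    refine tendsto_atTop.2 fun B => ?_
    obtain ⟨n, hnB⟩ := exists_nat_gt B
    have hlt : B < U n z := by
      simp only [hU, hz', hn]
      linarith
    filter_upwards [self_mem_nhdsWithin,
      nhdsWithin_le_nhds (((hUc n).tendsto z).eventually (lt_mem_nhds hlt))] with x hx hxB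
    exact hxB.le.trans (le_ciSup (hUb x hx) n)

end BlowUp

/-- existence of a boundary blow-up solution of Δ_k u = φ(u) in the ball B_r
iff ∫_a^∞ dt/√(∫_0^t φ(s) ds) < ∞ for some a > 0. -/
theorem dunkl_blowup_iff
    (d : ℕ) (hd : 1 ≤ d)
    (R : Finset (E d)) (hR0 : ∀ α ∈ R, α ≠ 0)
    (hRline : ∀ α ∈ R, (R : Set (E d)) ∩ {x | ∃ c : ℝ, x = c • α} = {α, -α})
    (hRrefl : ∀ α ∈ R, ∀ β ∈ R, dunklReflect α β ∈ R)
    (k : E d → ℝ) (hkpos : ∀ α ∈ R, 0 < k α)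
    (hkinv : ∀ α ∈ R, ∀ β ∈ R, k (dunklReflect α β) = k β)
    (hm : 2 < (d : ℝ) + ∑ α ∈ R, k α)
    (φ : ℝ → ℝ) (hφ0 : φ 0 = 0)
    (hφmono : MonotoneOn φ (Set.Ici 0))
    (hφnonneg : ∀ t : ℝ, 0 ≤ t → 0 ≤ φ t)
    (hφlip : ∀ x ∈ Set.Ici (0 : ℝ), ∃ K : NNReal, ∃ s ∈ nhdsWithin x (Set.Ici 0),
      LipschitzOnWith K φ s)
    (r : ℝ) (hr : 0 < r) :
    (∃ u : E d → ℝ,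
        ContinuousOn u (Metric.ball (0 : E d) r) ∧
        (∀ x ∈ Metric.ball (0 : E d) r, 0 ≤ u x) ∧
        IsDunklSol R k φ (Metric.ball 0 r) u ∧
        (∀ z ∈ frontier (Metric.ball (0 : E d) r),
          Tendsto u (nhdsWithin z (Metric.ball (0 : E d) r)) atTop)) ↔
      (∃ a : ℝ, 0 < a ∧
        ∫⁻ t in Set.Ioi a,
          (ENNReal.ofReal (Real.sqrt (∫ s in (0:ℝ)..t, φ s)))⁻¹ < ⊤) := by
  have hm1 : 1 < (d : ℝ) + ∑ α ∈ R, k α := by linarith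
  have hlip : LocallyLipschitzOn (Set.Ici 0) φ := fun x hx => hφlip x hx
  constructor
  · rintro ⟨u, hu, hu0, hus, hb⟩
    exact exists_lintegral_lt_top_of_blowup hR0 hRrefl hkpos hkinv rfl hm1 hr hφ0 hφnonneg hlip
      hφmono hu hu0 hus hb
  · rintro ⟨a, ha, hKO⟩
    exact exists_blowup_of_lintegral_lt_top hR0 hRrefl hkpos hkinv rfl hm1 hr hφ0 hφnonneg hlip
      hφmono ha hKO
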